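/- There exists β₀ > 0 such that for all β < β₀ the following holds. For all n ≥ 1 and even numbers k₁,…,k_n with k₁ ≥ 4, there is a constant K depending only on β₀, n, k = k₁+⋯+k_n (not on N) such that for every N ≥ 1, every h ≥ 0, and every (t₁,…,t_N) with t₁²+⋯+t_N² = 1, |E⟨∏_{l=1}^n S_l^{k_l}⟩ − (k₁ − 1)·E⟨S₀² S₁^{k₁−2} ∏_{l=2}^n S_l^{k_l}⟩| ≤ K·max_{i≤N}|t_i|. -/

import Mathlib

open MeasureTheory ProbabilityTheory Finset

noncomputable section

/-- A spin configuration on `N` sites. -/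
abbrev Cfg (N : ℕ) := Fin N → Bool

/-- The spin value `±1` of a Boolean. -/
def spin (b : Bool) : ℝ := if b then 1 else -1

/-- Minus the SK Hamiltonian. -/
def negH (N : ℕ) (β h : ℝ) (g : Fin N → Fin N → ℝ) (σ : Cfg N) : ℝ :=
  (β / Real.sqrt N) *
      ∑ i : Fin N, ∑ j : Fin N, (if i < j then g i j * spin (σ i) * spin (σ j) else 0) +
    h * ∑ i : Fin N, spin (σ i)

/-- Gibbs average `⟨f⟩` of a function of `ι`-indexed replicas. -/
def gibbs (N : ℕ) (β h : ℝ) (g : Fin N → Fin N → ℝ) {ι : Type} [DecidableEq ι] [Fintype ι]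
    (f : (ι → Cfg N) → ℝ) : ℝ :=
  (∑ σs : ι → Cfg N, f σs * ∏ l, Real.exp (negH N β h g (σs l))) /
    (∑ σ : Cfg N, Real.exp (negH N β h g σ)) ^ (Fintype.card ι)

/-- The law of the disorder: i.i.d. standard Gaussians. -/
def gaussN (N : ℕ) : Measure (Fin N → Fin N → ℝ) :=
  Measure.pi fun _ => Measure.pi fun _ => gaussianReal 0 1

/-- `ν(f) = E⟨f⟩`. -/
def nu (N : ℕ) (β h : ℝ) {ι : Type} [DecidableEq ι] [Fintype ι]
    (f : (ι → Cfg N) → ℝ) : ℝ :=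
  ∫ g, gibbs N β h g f ∂ gaussN N

/-- `S_l = Σ_i t_i (σ_i^{1(l)} - σ_i^{2(l)})`, replica pairs indexed by `Fin m × Fin 2`. -/
def Sbar (N m : ℕ) (t : Fin N → ℝ) (σs : Fin m × Fin 2 → Cfg N) (l : Fin m) : ℝ :=
  ∑ i, t i * (spin (σs (l, 0) i) - spin (σs (l, 1) i))

/-- `a(k)`: the `k`-th moment of a standard Gaussian. -/
def gaussMoment (k : ℕ) : ℝ := ∫ x, x ^ k ∂ (gaussianReal 0 1 : Measure ℝ)

/-- The overlap `R_{l,l'}` of two configurations. -/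
def overlap (N : ℕ) (σ τ : Cfg N) : ℝ := (∑ i, spin (σ i) * spin (τ i)) / N

section DirectionalDerivatives

variable {E : Type*} [NormedAddCommGroup E] [NormedSpace ℝ E]

/-- The `k`-fold derivative of `f` in the direction `t`. -/
def dirD (t : E) : ℕ → (E → ℝ) → E → ℝ
  | 0, f => f
  | k + 1, f => fun e => fderiv ℝ (dirD t k f) e t

theorem contDiff_fderiv_apply_const {f : E → ℝ} (hf : ContDiff ℝ (⊤ : ℕ∞) f) (w : E) :
    ContDiff ℝ (⊤ : ℕ∞) fun e => fderiv ℝ f e w :=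
  (hf.fderiv_right (m := (⊤ : ℕ∞)) (by exact_mod_cast le_top)).clm_apply contDiff_const

theorem contDiff_dirD (t : E) {f : E → ℝ} (hf : ContDiff ℝ (⊤ : ℕ∞) f) (k : ℕ) :
    ContDiff ℝ (⊤ : ℕ∞) (dirD t k f) := by
  induction k with
  | zero => exact hf
  | succ k ih => exact contDiff_fderiv_apply_const ih t

theorem fderiv_fderiv_comm {f : E → ℝ} (hf : ContDiff ℝ (⊤ : ℕ∞) f) (t w e : E) :
    fderiv ℝ (fun x => fderiv ℝ f x t) e w = fderiv ℝ (fun x => fderiv ℝ f x w) e t := by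
  have hd : DifferentiableAt ℝ (fderiv ℝ f) e :=
    ((hf.fderiv_right (m := (⊤ : ℕ∞)) (by exact_mod_cast le_top)).differentiable
      (by simp)).differentiableAt
  have h := second_derivative_symmetric (f := f) (f' := fderiv ℝ f) (x := e)
    (fun y => (hf.differentiable (by simp) y).hasFDerivAt) hd.hasFDerivAt t w
  have key : ∀ a b : E, fderiv ℝ (fun x => fderiv ℝ f x a) e b = fderiv ℝ (fderiv ℝ f) e b a := by
    intro a b
    have := (hd.hasFDerivAt.clm_apply (hasFDerivAt_const a e)).fderiv
    rw [this]; simp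
  rw [key, key, h]

theorem fderiv_dirD (t : E) {f : E → ℝ} (hf : ContDiff ℝ (⊤ : ℕ∞) f) (k : ℕ) (e w : E) :
    fderiv ℝ (dirD t k f) e w = dirD t k (fun x => fderiv ℝ f x w) e := by
  induction k generalizing e with
  | zero => rfl
  | succ k ih =>
    have h := fderiv_fderiv_comm (contDiff_dirD t hf k) t w e
    simp only [dirD]
    rw [h]
    congr 2
    funext x
    exact ih x

theorem hasDerivAt_line {f : E → ℝ} (hf : ContDiff ℝ (⊤ : ℕ∞) f) (e t : E) (u : ℝ) :
    HasDerivAt (fun u : ℝ => f (e + u • t)) (fderiv ℝ f (e + u • t) t) u := by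
  have h1 : HasDerivAt (fun u : ℝ => e + u • t) t u := by
    simpa using ((hasDerivAt_id u).smul_const t).const_add e
  exact ((hf.differentiable (by simp) _).hasFDerivAt).comp_hasDerivAt u h1

theorem iteratedDeriv_line (t : E) {f : E → ℝ} (hf : ContDiff ℝ (⊤ : ℕ∞) f) (k : ℕ) (e : E) :
    iteratedDeriv k (fun u : ℝ => f (e + u • t)) = fun u => dirD t k f (e + u • t) := by
  induction k with
  | zero => simp [dirD]
  | succ k ih =>
    rw [iteratedDeriv_succ, ih]
    funext u
    exact (hasDerivAt_line (contDiff_dirD t hf k) e t u).deriv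

theorem dirD_eq_iteratedDeriv (t : E) {f : E → ℝ} (hf : ContDiff ℝ (⊤ : ℕ∞) f) (k : ℕ) (e : E) :
    dirD t k f e = iteratedDeriv k (fun u : ℝ => f (e + u • t)) 0 := by
  rw [iteratedDeriv_line t hf]; simp

theorem dirD_sum (t : E) {κ : Type*} (s : Finset κ) (c : κ → ℝ) {f : κ → E → ℝ}
    (hf : ∀ j, ContDiff ℝ (⊤ : ℕ∞) (f j)) (k : ℕ) (e : E) :
    dirD t k (fun x => ∑ j ∈ s, c j * f j x) e = ∑ j ∈ s, c j * dirD t k (f j) e := by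
  induction k generalizing e with
  | zero => rfl
  | succ k ih =>
    simp only [dirD]
    have : dirD t k (fun x => ∑ j ∈ s, c j * f j x) = fun x => ∑ j ∈ s, c j * dirD t k (f j) x :=
      funext ih
    have hd : ∀ j ∈ s, HasFDerivAt (fun x => c j * dirD t k (f j) x)
        (c j • fderiv ℝ (dirD t k (f j)) e) e := fun j _ =>
      (((contDiff_dirD t (hf j) k).differentiable (by simp) e).hasFDerivAt).const_mul (c j)
    rw [this, (HasFDerivAt.fun_sum hd).fderiv]
    simp

end DirectionalDerivatives

section FiniteGibbs

variable {Ω : Type} [Fintype Ω]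

/-- The partition function of the energy `e`. -/
def Zs (e : Ω → ℝ) : ℝ := ∑ σ, Real.exp (e σ)

/-- The log-partition function of the energy `e`. -/
def Phi (e : Ω → ℝ) : ℝ := Real.log (Zs e)

/-- The Gibbs average of `f` for the energy `e`. -/
def avg (e f : Ω → ℝ) : ℝ := (∑ σ, f σ * Real.exp (e σ)) / Zs e

/-- The Gibbs variance of `f` for the energy `e`. -/
def gvar (e f : Ω → ℝ) : ℝ := avg e (fun σ => (f σ - avg e f) ^ 2)

theorem avg_add (e f g : Ω → ℝ) : avg e (fun σ => f σ + g σ) = avg e f + avg e g := by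
  simp only [avg, add_mul, sum_add_distrib, add_div]

theorem avg_sub (e f g : Ω → ℝ) : avg e (fun σ => f σ - g σ) = avg e f - avg e g := by
  simp only [avg, sub_mul, sum_sub_distrib, sub_div]

theorem avg_const_mul (e : Ω → ℝ) (c : ℝ) (f : Ω → ℝ) :
    avg e (fun σ => c * f σ) = c * avg e f := by
  simp only [avg, mul_assoc, ← mul_sum, mul_div_assoc]

theorem avg_sum {κ : Type*} (s : Finset κ) (e : Ω → ℝ) (f : κ → Ω → ℝ) :
    avg e (fun σ => ∑ j ∈ s, f j σ) = ∑ j ∈ s, avg e (f j) := by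
  simp only [avg, sum_mul]
  rw [sum_comm, sum_div]

/-- Change of the energy by an additive constant. -/
theorem avg_add_const (e f : Ω → ℝ) (c : ℝ) : avg (fun σ => e σ + c) f = avg e f := by
  simp only [avg, Zs, Real.exp_add, ← mul_assoc, ← sum_mul]
  exact mul_div_mul_right _ _ (Real.exp_pos c).ne'

theorem contDiff_sum_exp (f : Ω → ℝ) :
    ContDiff ℝ (⊤ : ℕ∞) fun e : Ω → ℝ => ∑ σ, f σ * Real.exp (e σ) :=
  ContDiff.sum fun σ _ => contDiff_const.mul (Real.contDiff_exp.comp (contDiff_apply ℝ ℝ σ))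

theorem contDiff_Zs : ContDiff ℝ (⊤ : ℕ∞) (Zs : (Ω → ℝ) → ℝ) :=
  ContDiff.sum fun σ _ => Real.contDiff_exp.comp (contDiff_apply ℝ ℝ σ)

theorem hasFDerivAt_sum_exp (f e : Ω → ℝ) :
    HasFDerivAt (fun e : Ω → ℝ => ∑ σ, f σ * Real.exp (e σ))
      (∑ σ, (f σ * Real.exp (e σ)) • ContinuousLinearMap.proj (R := ℝ) (φ := fun _ : Ω => ℝ) σ)
      e := by
  refine HasFDerivAt.fun_sum fun σ _ => ?_
  have := ((hasFDerivAt_apply (𝕜 := ℝ) σ e).exp).const_mul (f σ)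
  simpa [smul_smul] using this

variable [Nonempty Ω]

theorem Zs_pos (e : Ω → ℝ) : 0 < Zs e :=
  sum_pos (fun _ _ => Real.exp_pos _) univ_nonempty

theorem exp_Phi (e : Ω → ℝ) : Real.exp (Phi e) = Zs e := Real.exp_log (Zs_pos e)

theorem avg_const (e : Ω → ℝ) (c : ℝ) : avg e (fun _ => c) = c := by
  simp only [avg, ← mul_sum]
  exact mul_div_cancel_right₀ c (Zs_pos e).ne'

theorem avg_mono {e f g : Ω → ℝ} (h : ∀ σ, f σ ≤ g σ) : avg e f ≤ avg e g := by
  unfold avg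
  gcongr with σ
  · exact (Zs_pos e).le
  · exact h σ

theorem avg_nonneg {e f : Ω → ℝ} (h : ∀ σ, 0 ≤ f σ) : 0 ≤ avg e f := by
  have := avg_mono (e := e) (f := fun _ => 0) h
  rwa [avg_const] at this

theorem abs_avg_le (e f : Ω → ℝ) : |avg e f| ≤ avg e (fun σ => |f σ|) := by
  rw [abs_le]
  constructor
  · have := avg_mono (e := e) (f := fun σ => (-1) * |f σ|) (g := f)
      (fun σ => by linarith [neg_abs_le (f σ)])
    rw [avg_const_mul] at this; linarith
  · exact avg_mono fun σ => le_abs_self _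

theorem avg_mul_sq_le (e f g : Ω → ℝ) :
    avg e (fun σ => f σ * g σ) ^ 2 ≤ avg e (fun σ => f σ ^ 2) * avg e (fun σ => g σ ^ 2) := by
  have hZ := Zs_pos e
  have h := sum_mul_sq_le_sq_mul_sq univ (fun σ => f σ * Real.exp (e σ / 2))
    (fun σ => g σ * Real.exp (e σ / 2))
  have hexp : ∀ σ, Real.exp (e σ / 2) * Real.exp (e σ / 2) = Real.exp (e σ) := fun σ => by
    rw [← Real.exp_add]; ring_nf
  have e1 : ∀ a b : Ω → ℝ, ∑ σ, (a σ * Real.exp (e σ / 2)) * (b σ * Real.exp (e σ / 2)) =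
      ∑ σ, (a σ * b σ) * Real.exp (e σ) := fun a b =>
    sum_congr rfl fun σ _ => by rw [← hexp]; ring
  have e2 : ∀ a : Ω → ℝ, ∑ σ, (a σ * Real.exp (e σ / 2)) ^ 2 =
      ∑ σ, (a σ) ^ 2 * Real.exp (e σ) := fun a =>
    sum_congr rfl fun σ _ => by rw [← hexp]; ring
  rw [e1, e2, e2] at h
  simp only [avg]
  rw [div_pow, div_mul_div_comm, ← sq]
  gcongr

theorem sq_avg_le (e f : Ω → ℝ) : avg e f ^ 2 ≤ avg e (fun σ => f σ ^ 2) := by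
  simpa [avg_const] using avg_mul_sq_le e f (fun _ => 1)

theorem gvar_eq (e f : Ω → ℝ) : gvar e f = avg e (fun σ => f σ ^ 2) - avg e f ^ 2 := by
  have : (fun σ => (f σ - avg e f) ^ 2) =
      fun σ => f σ ^ 2 + ((-2 * avg e f) * f σ + avg e f ^ 2) := by funext σ; ring
  rw [gvar, this, avg_add, avg_add, avg_const, avg_const_mul]; ring

theorem gvar_nonneg (e f : Ω → ℝ) : 0 ≤ gvar e f := avg_nonneg fun _ => sq_nonneg _

theorem gvar_le_avg_sq (e f : Ω → ℝ) (c : ℝ) : gvar e f ≤ avg e (fun σ => (f σ - c) ^ 2) := by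
  have : (fun σ => (f σ - c) ^ 2) =
      fun σ => f σ ^ 2 + ((-2 * c) * f σ + c ^ 2) := by funext σ; ring
  rw [gvar_eq, this, avg_add, avg_add, avg_const, avg_const_mul]
  nlinarith [sq_nonneg (avg e f - c)]

theorem avg_add_energy (e X f : Ω → ℝ) :
    avg (e + X) f = avg e (fun σ => f σ * Real.exp (X σ)) / avg e (fun σ => Real.exp (X σ)) := by
  have hZ := Zs_pos e
  simp only [avg, Zs, Pi.add_apply, Real.exp_add]
  rw [div_div_div_cancel_right₀ (by simpa [Zs] using hZ.ne')]
  congr 1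
  · exact sum_congr rfl fun σ _ => by ring
  · exact sum_congr rfl fun σ _ => by ring

theorem contDiff_Phi : ContDiff ℝ (⊤ : ℕ∞) (Phi : (Ω → ℝ) → ℝ) :=
  contDiff_Zs.log fun e => (Zs_pos e).ne'

theorem contDiff_avg (f : Ω → ℝ) : ContDiff ℝ (⊤ : ℕ∞) fun e : Ω → ℝ => avg e f :=
  (contDiff_sum_exp f).div contDiff_Zs fun e => (Zs_pos e).ne'

theorem fderiv_Phi (e w : Ω → ℝ) : fderiv ℝ Phi e w = avg e w := by
  have h := hasFDerivAt_sum_exp (fun _ => 1) e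
  simp only [one_mul] at h
  have h2 := HasFDerivAt.log (f := Zs) h (Zs_pos e).ne'
  change fderiv ℝ (fun x => Real.log (Zs x)) e w = _
  rw [h2.fderiv]
  simp [avg, div_eq_inv_mul, mul_comm]

theorem fderiv_avg (e f w : Ω → ℝ) :
    fderiv ℝ (fun e => avg e f) e w = avg e (fun σ => f σ * w σ) - avg e f * avg e w := by
  have hl : HasDerivAt (fun u : ℝ => e + u • w) w 0 := by
    simpa using ((hasDerivAt_id (0 : ℝ)).smul_const w).const_add e
  have h : ∀ f : Ω → ℝ, HasDerivAt (fun u : ℝ => ∑ σ, f σ * Real.exp ((e + u • w) σ))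
      (∑ σ, f σ * Real.exp (e σ) * w σ) 0 := fun f => by
    have h0 : e + (0 : ℝ) • w = e := by simp
    have := HasFDerivAt.comp_hasDerivAt (0 : ℝ) (h0 ▸ hasFDerivAt_sum_exp f e) hl
    simpa [_root_.sum_apply, Function.comp_def] using this
  have h1 := h (fun _ => 1)
  simp only [one_mul] at h1
  have h2 := (h f).fun_div h1 (Zs_pos (e + (0 : ℝ) • w)).ne'
  have h3 := hasDerivAt_line (contDiff_avg f) e w 0
  have h4 := h3.unique h2
  simp only [zero_smul, add_zero] at h4
  rw [h4]
  have hZ := (Zs_pos e).ne'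
  have e1 : ∑ x, f x * Real.exp (e x) * w x = ∑ x, f x * w x * Real.exp (e x) :=
    sum_congr rfl fun _ _ => by ring
  have e2 : ∑ x, Real.exp (e x) * w x = ∑ x, w x * Real.exp (e x) :=
    sum_congr rfl fun _ _ => by ring
  simp only [avg, e1, e2]
  change _ / Zs e ^ 2 = _
  rw [show ∑ x, Real.exp (e x) = Zs e from rfl]
  field_simp

theorem hasDerivAt_Phi_line (e X : Ω → ℝ) (u : ℝ) :
    HasDerivAt (fun u : ℝ => Phi (e + u • X)) (avg (e + u • X) X) u := by
  simpa [fderiv_Phi] using hasDerivAt_line contDiff_Phi e X u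

theorem hasDerivAt_avg_line (e f X : Ω → ℝ) (u : ℝ) :
    HasDerivAt (fun u : ℝ => avg (e + u • X) f)
      (avg (e + u • X) (fun σ => f σ * X σ) - avg (e + u • X) f * avg (e + u • X) X) u := by
  simpa [fderiv_avg] using hasDerivAt_line (contDiff_avg f) e X u

theorem hasDerivAt_avg_self_line (e X : Ω → ℝ) (u : ℝ) :
    HasDerivAt (fun u : ℝ => avg (e + u • X) X) (gvar (e + u • X) X) u := by
  have := hasDerivAt_avg_line e X X u
  rw [gvar_eq]
  simpa [sq] using this

end FiniteGibbs

theorem gvar_add_const {Ω : Type} [Fintype Ω] [Nonempty Ω] (e f : Ω → ℝ) (c : ℝ) :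
    gvar (fun σ => e σ + c) f = gvar e f := by
  simp only [gvar, avg_add_const]

section MomentBounds

theorem abs_iteratedDeriv_quotient_le (K : ℝ) (hK : 0 ≤ K) (k : ℕ) :
    ∃ C : ℝ, 0 ≤ C ∧ ∀ (q Z Y : ℝ → ℝ) (R : ℝ), 0 ≤ R → ContDiff ℝ (⊤ : ℕ∞) q →
      ContDiff ℝ (⊤ : ℕ∞) Z → (∀ u, q u * Z u = Y u) → Z 0 = 1 →
      (∀ a ≤ k, |iteratedDeriv a Z 0| ≤ K * R ^ a) →
      (∀ a ≤ k, |iteratedDeriv a Y 0| ≤ K * R ^ (a + 1)) →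
      |iteratedDeriv k q 0| ≤ C * R ^ (k + 1) := by
  induction k using Nat.strong_induction_on with
  | _ k ih =>
    choose! C hC0 hC using ih
    refine ⟨K + ∑ j ∈ range k, (k.choose j) * C j * K, ?_, ?_⟩
    · exact add_nonneg hK (sum_nonneg fun j hj =>
        mul_nonneg (mul_nonneg (by positivity) (hC0 j (mem_range.1 hj))) hK)
    intro q Z Y R hR hq hZ hqZ hZ0 hZb hYb
    have hY : Y = q * Z := funext fun u => (hqZ u).symm
    have hL := iteratedDeriv_mul (n := k) (x := (0 : ℝ)) (f := q) (g := Z)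
      (hq.contDiffAt.of_le (by exact_mod_cast le_top))
      (hZ.contDiffAt.of_le (by exact_mod_cast le_top))
    rw [← hY, sum_range_succ] at hL
    simp only [Nat.choose_self, Nat.cast_one, one_mul, Nat.sub_self, iteratedDeriv_zero, hZ0,
      mul_one] at hL
    have hq' : iteratedDeriv k q 0 = iteratedDeriv k Y 0 -
        ∑ i ∈ range k, (k.choose i) * iteratedDeriv i q 0 * iteratedDeriv (k - i) Z 0 := by
      linarith
    rw [hq', add_mul, sum_mul]
    refine (abs_sub _ _).trans (add_le_add (hYb k le_rfl) ?_)
    refine (abs_sum_le_sum_abs _ _).trans (sum_le_sum fun j hj => ?_)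
    have hjk := mem_range.1 hj
    have h1 := hC j hjk q Z Y R hR hq hZ hqZ hZ0 (fun a ha => hZb a (ha.trans hjk.le))
      (fun a ha => hYb a (ha.trans hjk.le))
    have h2 := hZb (k - j) (Nat.sub_le _ _)
    have hCj := hC0 j hjk
    rw [abs_mul, abs_mul, Nat.abs_cast]
    calc (k.choose j : ℝ) * |iteratedDeriv j q 0| * |iteratedDeriv (k - j) Z 0|
        ≤ (k.choose j : ℝ) * (C j * R ^ (j + 1)) * (K * R ^ (k - j)) := by
          refine mul_le_mul ?_ h2 (abs_nonneg _) (by positivity)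
          exact mul_le_mul_of_nonneg_left h1 (by positivity)
      _ = (k.choose j : ℝ) * C j * K * (R ^ (j + 1) * R ^ (k - j)) := by ring
      _ = _ := by rw [← pow_add]; congr 2; omega

variable {Ω : Type} [Fintype Ω]

theorem contDiff_avg_exp (e f X : Ω → ℝ) :
    ContDiff ℝ (⊤ : ℕ∞) fun u : ℝ => avg e (fun σ => f σ * Real.exp (u * X σ)) := by
  unfold avg
  refine ContDiff.div_const (ContDiff.sum fun σ _ => ?_) _
  exact (contDiff_const.mul (Real.contDiff_exp.comp (contDiff_id.mul contDiff_const))).mul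
    contDiff_const

theorem iteratedDeriv_avg_exp (e f X : Ω → ℝ) (a : ℕ) :
    iteratedDeriv a (fun u : ℝ => avg e (fun σ => f σ * Real.exp (u * X σ))) =
      fun u => avg e (fun σ => f σ * X σ ^ a * Real.exp (u * X σ)) := by
  induction a with
  | zero => simp
  | succ a ih =>
    rw [iteratedDeriv_succ, ih]
    funext u
    unfold avg
    have h : ∀ σ, HasDerivAt (fun u : ℝ => f σ * X σ ^ a * Real.exp (u * X σ) * Real.exp (e σ))
        (f σ * X σ ^ (a + 1) * Real.exp (u * X σ) * Real.exp (e σ)) u := fun σ => by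
      have h : HasDerivAt (fun u : ℝ => u * X σ) (X σ) u := by
        simpa using (hasDerivAt_id u).mul_const (X σ)
      refine ((h.exp.const_mul (f σ * X σ ^ a)).mul_const (Real.exp (e σ))).congr_deriv ?_
      ring
    exact (HasDerivAt.div_const (HasDerivAt.fun_sum fun σ _ => h σ) _).deriv

theorem iteratedDeriv_avg_exp_zero (e f X : Ω → ℝ) (a : ℕ) :
    iteratedDeriv a (fun u : ℝ => avg e (fun σ => f σ * Real.exp (u * X σ))) 0 =
      avg e (fun σ => f σ * X σ ^ a) := by
  rw [iteratedDeriv_avg_exp]; simp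

variable [Nonempty Ω]

theorem abs_dirD_avg_le (K : ℝ) (hK : 1 ≤ K) (k : ℕ) (hk : 1 ≤ k) :
    ∃ C : ℝ, 0 ≤ C ∧ ∀ (Ω : Type) [Fintype Ω] [Nonempty Ω] (e f X : Ω → ℝ) (R : ℝ), 0 ≤ R →
      (∀ a ≤ k, avg e (fun σ => (X σ - avg e X) ^ (2 * a)) ≤ K * R ^ (2 * a)) →
      gvar e f ≤ K * R ^ 2 →
      |dirD X k (fun e => avg e f) e| ≤ C * R ^ (k + 1) := by
  obtain ⟨C, hC0, hC⟩ := abs_iteratedDeriv_quotient_le K (zero_le_one.trans hK) k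
  refine ⟨C, hC0, ?_⟩
  intro Ω _ _ e f X R hR hX hf
  set Xt : Ω → ℝ := fun σ => X σ - avg e X with hXt
  set ft : Ω → ℝ := fun σ => f σ - avg e f with hft
  have hq : ContDiff ℝ (⊤ : ℕ∞) (fun u : ℝ => avg (e + u • X) f) :=
    (contDiff_avg f).comp (contDiff_const.add (contDiff_id.smul contDiff_const))
  have hsub : (fun u : ℝ => avg (e + u • X) f - avg e f) =
      (fun u : ℝ => avg (e + u • X) f) - fun _ => avg e f := rfl
  have hder : dirD X k (fun e => avg e f) e =
      iteratedDeriv k (fun u : ℝ => avg (e + u • X) f - avg e f) 0 := by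
    rw [dirD_eq_iteratedDeriv X (contDiff_avg f), hsub, iteratedDeriv_sub
      (hq.contDiffAt.of_le (by exact_mod_cast le_top)) contDiffAt_const]
    rw [iteratedDeriv_const, if_neg (by omega)]; simp
  rw [hder]
  have hM : ∀ a ≤ k, avg e (fun σ => Xt σ ^ a) ^ 2 ≤ K * R ^ (2 * a) := fun a ha => by
    refine (sq_avg_le _ _).trans ((le_of_eq ?_).trans (hX a ha))
    congr 1; funext σ; rw [← pow_mul, mul_comm a 2]
  refine hC _ (fun u => avg e (fun σ => 1 * Real.exp (u * Xt σ)))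
    (fun u => avg e (fun σ => ft σ * Real.exp (u * Xt σ))) R hR (hq.sub contDiff_const)
    (contDiff_avg_exp e (fun _ => 1) Xt) ?_ ?_ ?_ ?_
  · intro u
    have h1 : avg (e + u • X) f - avg e f = avg (e + u • Xt) ft := by
      have : e + u • X = fun σ => (e + u • Xt) σ + u * avg e X := by
        funext σ; simp [hXt]; ring
      rw [this, avg_add_const, hft, avg_sub, avg_const]
    rw [h1, avg_add_energy]
    have hpos : avg e (fun σ => Real.exp (u * Xt σ)) ≠ 0 := by
      have := Zs_pos (e + u • Xt)
      unfold avg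
      refine (div_pos ?_ (Zs_pos e)).ne'
      exact sum_pos (fun σ _ => by positivity) univ_nonempty
    simp only [Pi.smul_apply, smul_eq_mul, one_mul]
    field_simp
  · simp [avg_const]
  · intro a ha
    rw [iteratedDeriv_avg_exp_zero]
    simp only [one_mul]
    refine abs_le_of_sq_le_sq ?_ (by positivity)
    refine (hM a ha).trans ?_
    rw [mul_pow, ← pow_mul, mul_comm a 2]
    gcongr
    nlinarith
  · intro a ha
    rw [iteratedDeriv_avg_exp_zero]
    refine abs_le_of_sq_le_sq ?_ (by positivity)
    refine (avg_mul_sq_le e ft (fun σ => Xt σ ^ a)).trans ?_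
    have h1 : avg e (fun σ => (Xt σ ^ a) ^ 2) ≤ K * R ^ (2 * a) := by
      refine (le_of_eq ?_).trans (hX a ha)
      congr 1; funext σ; rw [← pow_mul, mul_comm a 2]
    calc _ ≤ (K * R ^ 2) * (K * R ^ (2 * a)) :=
          mul_le_mul hf h1 (avg_nonneg fun σ => sq_nonneg _) (by positivity)
      _ = _ := by ring

end MomentBounds

section RankOne

theorem one_add_sq_mul_exp_le (a z : ℝ) :
    (1 + z ^ 2) * Real.exp (a * z - z ^ 2 / 2) ≤ 8 * Real.exp (a ^ 2) * Real.exp (-(1 / 8) * z ^ 2) := by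
  have h1 : 1 + z ^ 2 ≤ 8 * Real.exp (z ^ 2 / 8) := by
    have := Real.add_one_le_exp (z ^ 2 / 8); nlinarith
  calc (1 + z ^ 2) * Real.exp (a * z - z ^ 2 / 2)
      ≤ (8 * Real.exp (z ^ 2 / 8)) * Real.exp (a * z - z ^ 2 / 2) := by gcongr
    _ = 8 * Real.exp (z ^ 2 / 8 + (a * z - z ^ 2 / 2)) := by rw [Real.exp_add]; ring
    _ ≤ 8 * Real.exp (a ^ 2 + -(1 / 8) * z ^ 2) := by
        refine mul_le_mul_of_nonneg_left (Real.exp_le_exp.2 ?_) (by norm_num)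
        nlinarith [sq_nonneg (z / 2 - a)]
    _ = _ := by rw [Real.exp_add]; ring

theorem exists_abs_bound {Ω : Type} [Fintype Ω] (f : Ω → ℝ) : ∃ M : ℝ, 0 ≤ M ∧ ∀ σ, |f σ| ≤ M :=
  ⟨∑ σ, |f σ|, sum_nonneg fun _ _ => abs_nonneg _, fun σ =>
    single_le_sum (f := fun σ => |f σ|) (fun _ _ => abs_nonneg _) (mem_univ σ)⟩

variable {Ω : Type} [Fintype Ω] [Nonempty Ω]

/-- The unnormalised density of the Gaussian mixing variable. -/
def mixW (e U : Ω → ℝ) (z : ℝ) : ℝ := Real.exp (-(z ^ 2 / 2)) * Zs (e + z • U)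

theorem mixW_pos (e U : Ω → ℝ) (z : ℝ) : 0 < mixW e U z :=
  mul_pos (Real.exp_pos _) (Zs_pos _)

theorem avg_mul_mixW (e U f : Ω → ℝ) (z : ℝ) :
    avg (e + z • U) f * mixW e U z =
      ∑ σ, f σ * Real.exp (e σ) * Real.exp (U σ * z - z ^ 2 / 2) := by
  have := (Zs_pos (e + z • U)).ne'
  rw [mixW, avg, div_mul_eq_mul_div, div_eq_iff this, sum_mul, sum_mul]
  refine sum_congr rfl fun σ _ => ?_
  rw [sub_eq_add_neg, Real.exp_add, Pi.add_apply, Real.exp_add, Pi.smul_apply, smul_eq_mul,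
    mul_comm z (U σ)]
  ring

theorem mixW_eq (e U : Ω → ℝ) (z : ℝ) :
    mixW e U z = ∑ σ, Real.exp (e σ) * Real.exp (U σ * z - z ^ 2 / 2) := by
  simpa [avg_const] using avg_mul_mixW e U (fun _ => 1) z

theorem hasDerivAt_mixW (e U : Ω → ℝ) (z : ℝ) :
    HasDerivAt (mixW e U) (-(z - avg (e + z • U) U) * mixW e U z) z := by
  have h : HasDerivAt (fun z => ∑ σ, Real.exp (e σ) * Real.exp (U σ * z - z ^ 2 / 2))
      (∑ σ, Real.exp (e σ) * (Real.exp (U σ * z - z ^ 2 / 2) * (U σ - z))) z := by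
    refine HasDerivAt.fun_sum fun σ _ => ?_
    have h1 : HasDerivAt (fun z : ℝ => U σ * z - z ^ 2 / 2) (U σ - z) z := by
      refine (((hasDerivAt_id z).const_mul (U σ)).sub
        (((hasDerivAt_id z).pow 2).div_const 2)).congr_deriv ?_
      simp
    exact h1.exp.const_mul _
  rw [← funext (mixW_eq e U)] at h
  refine h.congr_deriv ?_
  rw [ neg_sub, sub_mul, avg_mul_mixW, mixW_eq, mul_sum, ← sum_sub_distrib]
  exact sum_congr rfl fun σ _ => by ring

theorem integrable_mul_mixW (e U : Ω → ℝ) {F : ℝ → ℝ} (hF : Continuous F) {C : ℝ}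
    (hC : ∀ z, |F z| ≤ C * (1 + z ^ 2)) : Integrable fun z => F z * mixW e U z := by
  have hW : Continuous (mixW e U) := continuous_iff_continuousAt.2 fun z =>
    (hasDerivAt_mixW e U z).continuousAt
  have hC0 : 0 ≤ C := by simpa using (abs_nonneg _).trans (hC 0)
  have hg : Integrable fun z : ℝ => (∑ σ, Real.exp (e σ) * (C * (8 * Real.exp (U σ ^ 2)))) *
      Real.exp (-(1 / 8) * z ^ 2) := (integrable_exp_neg_mul_sq (by norm_num)).const_mul _
  refine hg.mono' (hF.mul hW).aestronglyMeasurable (Filter.Eventually.of_forall fun z => ?_)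
  rw [Real.norm_eq_abs, abs_mul, abs_of_pos (mixW_pos e U z), mixW_eq, mul_sum, sum_mul]
  refine sum_le_sum fun σ _ => ?_
  calc |F z| * (Real.exp (e σ) * Real.exp (U σ * z - z ^ 2 / 2))
      ≤ (C * (1 + z ^ 2)) * (Real.exp (e σ) * Real.exp (U σ * z - z ^ 2 / 2)) := by
        gcongr; exact hC z
    _ = Real.exp (e σ) * (C * ((1 + z ^ 2) * Real.exp (U σ * z - z ^ 2 / 2))) := by ring
    _ ≤ Real.exp (e σ) * (C * (8 * Real.exp (U σ ^ 2) * Real.exp (-(1 / 8) * z ^ 2))) := by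
        have := one_add_sq_mul_exp_le (U σ) z
        gcongr
    _ = _ := by ring

theorem integral_exp_lin_sub_sq (a : ℝ) :
    ∫ z : ℝ, Real.exp (a * z - z ^ 2 / 2) = Real.sqrt (2 * Real.pi) * Real.exp (a ^ 2 / 2) := by
  have h : ∀ z : ℝ, Real.exp (a * z - z ^ 2 / 2) =
      Real.exp (a ^ 2 / 2) * Real.exp (-(1 / 2) * (z - a) ^ 2) := fun z => by
    rw [← Real.exp_add]; congr 1; ring
  simp_rw [h]
  rw [integral_const_mul, integral_sub_right_eq_self (fun z => Real.exp (-(1 / 2) * z ^ 2)) a,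
    integral_gaussian, mul_comm]
  congr 2; ring

theorem integral_avg_mul_mixW (e U f : Ω → ℝ) :
    ∫ z, avg (e + z • U) f * mixW e U z =
      Real.sqrt (2 * Real.pi) * ∑ σ, f σ * Real.exp (e σ + U σ ^ 2 / 2) := by
  simp_rw [avg_mul_mixW]
  have hi : ∀ a : ℝ, Integrable fun z : ℝ => Real.exp (a * z - z ^ 2 / 2) := fun a => by
    by_contra h
    have h1 := integral_exp_lin_sub_sq a
    rw [integral_undef h] at h1
    have : 0 < Real.sqrt (2 * Real.pi) * Real.exp (a ^ 2 / 2) := by positivity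
    linarith
  rw [integral_finsetSum _ fun σ _ => (hi (U σ)).const_mul _, mul_sum]
  refine sum_congr rfl fun σ _ => ?_
  rw [integral_const_mul, integral_exp_lin_sub_sq, Real.exp_add]; ring

/-- The Gibbs covariance of `f` and `g` for the energy `e`. -/
def gcov (e f g : Ω → ℝ) : ℝ := avg e (fun σ => f σ * g σ) - avg e f * avg e g

theorem abs_avg_le_of_bound (e f : Ω → ℝ) {M : ℝ} (h : ∀ σ, |f σ| ≤ M) : |avg e f| ≤ M := by
  refine (abs_avg_le e f).trans ?_
  simpa [avg_const] using avg_mono (e := e) h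

/-- One-dimensional Brascamp-Lieb argument for a Gaussian mixture of exponential tilts. -/
theorem gvar_add_half_sq_le (e U f : Ω → ℝ) (lam Q : ℝ) (hlam : lam < 1)
    (hU : ∀ z : ℝ, gvar (e + z • U) U ≤ lam)
    (hQ : ∀ z : ℝ, gvar (e + z • U) f + (1 / (1 - lam)) * gcov (e + z • U) f U ^ 2 ≤ Q) :
    gvar (fun σ => e σ + U σ ^ 2 / 2) f ≤ Q := by
  have hl : 0 < 1 - lam := by linarith
  set m : ℝ → ℝ := fun z => avg (e + z • U) f with hm
  set m' : ℝ → ℝ := fun z => gcov (e + z • U) f U with hm'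
  set W := mixW e U with hWdef
  set V : ℝ → ℝ := fun z => z - avg (e + z • U) U with hV
  have hline : Continuous fun z : ℝ => e + z • U := by fun_prop
  have hcont : ∀ g : Ω → ℝ, Continuous fun z : ℝ => avg (e + z • U) g := fun g =>
    (contDiff_avg g).continuous.comp hline
  have hmd : ∀ z, HasDerivAt m (m' z) z := fun z => hasDerivAt_avg_line e f U z
  have hm'c : Continuous m' := (hcont _).sub ((hcont _).mul (hcont _))
  have hVd : ∀ z, HasDerivAt V (1 - gvar (e + z • U) U) z := fun z =>
    (hasDerivAt_id z).sub (hasDerivAt_avg_self_line e U z)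
  have hVc : Continuous V := continuous_id.sub (hcont U)
  obtain ⟨MU, hMU0, hMU⟩ := exists_abs_bound U
  obtain ⟨Mf, hMf0, hMf⟩ := exists_abs_bound f
  obtain ⟨Mg, hMg0, hMg⟩ := exists_abs_bound fun σ => f σ * U σ
  have hUb : ∀ z : ℝ, |avg (e + z • U) U| ≤ MU := fun z => abs_avg_le_of_bound _ _ hMU
  have hm'b : ∀ z, |m' z| ≤ Mg + Mf * MU := fun z => by
    refine (abs_sub _ _).trans (add_le_add (abs_avg_le_of_bound _ _ hMg) ?_)
    rw [abs_mul]
    exact mul_le_mul (abs_avg_le_of_bound _ _ hMf) (hUb z) (abs_nonneg _) hMf0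
  obtain ⟨c, hc⟩ : ∃ c, V c = 0 := by
    have h1 : V (-MU) ≤ 0 := by simp only [hV]; linarith [neg_abs_le (avg (e + (-MU) • U) U), hUb (-MU)]
    have h2 : 0 ≤ V MU := by simp only [hV]; linarith [le_abs_self (avg (e + MU • U) U), hUb MU]
    obtain ⟨c, -, hc⟩ := intermediate_value_Icc (by linarith : -MU ≤ MU) hVc.continuousOn ⟨h1, h2⟩
    exact ⟨c, hc⟩
  set B : ℝ → ℝ := fun z => ∫ x in c..z, m' x ^ 2 with hB
  have hBd : ∀ z, HasDerivAt B (m' z ^ 2) z := fun z =>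
    ((hm'c.pow 2).integral_hasStrictDerivAt c z).hasDerivAt
  have hBc : B c = 0 := by simp [hB]
  have hBcont : Continuous B := continuous_iff_continuousAt.2 fun z => (hBd z).continuousAt
  have hmono : ∀ s : ℝ, Monotone fun z => B z - 2 * s * (m z - m c) + s ^ 2 * (z - c) := fun s => by
    refine monotone_of_hasDerivAt_nonneg (f' := fun z => (m' z - s) ^ 2) (fun z => ?_)
      (fun z => sq_nonneg _)
    refine (((hBd z).sub (((hmd z).sub_const (m c)).const_mul (2 * s))).add
      (((hasDerivAt_id z).sub_const c).const_mul (s ^ 2))).congr_deriv ?_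
    ring
  have hVmono : Monotone fun z => V z - (1 - lam) * (z - c) := by
    refine monotone_of_hasDerivAt_nonneg
      (fun z => (hVd z).sub (((hasDerivAt_id z).sub_const c).const_mul (1 - lam))) (fun z => ?_)
    have := hU z
    simp only [Pi.zero_apply]; linarith
  have hBmono : Monotone B := by simpa using hmono 0
  have hkey : ∀ z, (1 - lam) * (m z - m c) ^ 2 ≤ V z * B z := by
    intro z
    rcases eq_or_ne z c with rfl | hzc
    · simp [hc]
    have hzc' : z - c ≠ 0 := sub_ne_zero.2 hzc
    have hs : B z - 2 * ((m z - m c) / (z - c)) * (m z - m c) +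
        ((m z - m c) / (z - c)) ^ 2 * (z - c) = B z - (m z - m c) ^ 2 / (z - c) := by
      field_simp; ring
    have hms := hmono ((m z - m c) / (z - c))
    rcases lt_or_gt_of_ne hzc with h | h
    · have h1 := hms h.le
      have h2 := hVmono h.le
      have h3 := hBmono h.le
      simp only [hs, hBc, hc, sub_self, mul_zero, add_zero] at h1 h2 h3
      have h4 : (m z - m c) ^ 2 ≤ (z - c) * B z := by
        have : B z ≤ (m z - m c) ^ 2 / (z - c) := by linarith
        rwa [le_div_iff_of_neg (by linarith), mul_comm] at this
      nlinarith
    · have h1 := hms h.le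
      have h2 := hVmono h.le
      have h3 := hBmono h.le
      simp only [hs, hBc, hc, sub_self, mul_zero, add_zero] at h1 h2 h3
      have h4 : (m z - m c) ^ 2 ≤ (z - c) * B z := by
        have : (m z - m c) ^ 2 / (z - c) ≤ B z := by linarith
        rwa [div_le_iff₀ (by linarith), mul_comm] at this
      nlinarith
  set M2 := (Mg + Mf * MU) ^ 2 with hM2
  have hM20 : 0 ≤ M2 := sq_nonneg _
  have hm'2 : ∀ z, m' z ^ 2 ≤ M2 := fun z => sq_le_sq' (by linarith [neg_abs_le (m' z), hm'b z])
    ((le_abs_self _).trans (hm'b z))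
  have hBb : ∀ z, |B z| ≤ M2 * |z - c| := fun z => by
    have := intervalIntegral.norm_integral_le_of_norm_le_const (a := c) (b := z)
      (f := fun x => m' x ^ 2) (C := M2) (fun x _ => by
        rw [Real.norm_eq_abs, abs_of_nonneg (sq_nonneg _)]; exact hm'2 x)
    simpa using this
  have hBb' : ∀ z, |B z| ≤ (M2 * (1 + |c|)) * (1 + z ^ 2) := fun z => by
    refine (hBb z).trans ?_
    have h1 : |z - c| ≤ |z| + |c| := abs_sub _ _
    have h2 : |z| ≤ 1 + z ^ 2 := by nlinarith [sq_abs z, sq_nonneg (|z| - 1)]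
    have h3 : |z - c| ≤ (1 + |c|) * (1 + z ^ 2) := by nlinarith [abs_nonneg c, sq_nonneg z]
    nlinarith
  have hVb : ∀ z, |V z| ≤ |z| + MU := fun z => (abs_sub _ _).trans (by linarith [hUb z])
  have hVBb : ∀ z, |V z * B z| ≤ (M2 * ((1 + MU) * (2 * (1 + |c|)))) * (1 + z ^ 2) := fun z => by
    rw [abs_mul]
    have h1 : |z - c| ≤ |z| + |c| := abs_sub _ _
    have h4 : (|z| + MU) * (|z| + |c|) ≤ ((1 + MU) * (2 * (1 + |c|))) * (1 + z ^ 2) := by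
      have e1 : |z| + MU ≤ (1 + MU) * (1 + |z|) := by nlinarith [abs_nonneg z]
      have e2 : |z| + |c| ≤ (1 + |c|) * (1 + |z|) := by nlinarith [abs_nonneg z, abs_nonneg c]
      have e3 : (1 + |z|) * (1 + |z|) ≤ 2 * (1 + z ^ 2) := by
        nlinarith [sq_abs z, sq_nonneg (|z| - 1)]
      calc _ ≤ ((1 + MU) * (1 + |z|)) * ((1 + |c|) * (1 + |z|)) := by gcongr
        _ = ((1 + MU) * (1 + |c|)) * ((1 + |z|) * (1 + |z|)) := by ring
        _ ≤ ((1 + MU) * (1 + |c|)) * (2 * (1 + z ^ 2)) := by gcongr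
        _ = _ := by ring
    calc |V z| * |B z| ≤ (|z| + MU) * (M2 * |z - c|) := by
          gcongr
          · exact hVb z
          · exact hBb z
      _ ≤ (|z| + MU) * (M2 * (|z| + |c|)) := by gcongr
      _ = M2 * ((|z| + MU) * (|z| + |c|)) := by ring
      _ ≤ _ := by rw [mul_assoc]; gcongr
  have hIB : Integrable fun z => B z * W z := integrable_mul_mixW e U hBcont hBb'
  have hIVB : Integrable fun z => V z * B z * W z :=
    integrable_mul_mixW e U (hVc.mul hBcont) hVBb
  have hIm : Integrable fun z => m' z ^ 2 * W z := by
    refine integrable_mul_mixW e U (hm'c.pow 2) (C := M2) fun z => ?_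
    rw [abs_of_nonneg (sq_nonneg _)]
    nlinarith [hm'2 z, sq_nonneg z]
  have hparts : ∫ z, (m' z ^ 2 * W z - V z * B z * W z) = 0 := by
    refine integral_eq_zero_of_hasDerivAt_of_integrable (f := fun z => B z * W z) (fun z => ?_)
      (hIm.sub hIVB) hIB
    refine ((hBd z).mul (hasDerivAt_mixW e U z)).congr_deriv ?_
    simp only [hV, hWdef]; ring
  set F : Ω → ℝ := fun σ => (f σ - m c) ^ 2 with hF
  have hA : ∀ z, avg (e + z • U) F ≤ Q + (1 / (1 - lam)) * (V z * B z - m' z ^ 2) := fun z => by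
    have h1 : avg (e + z • U) F = gvar (e + z • U) f + (m z - m c) ^ 2 := by
      have : F = fun σ => f σ ^ 2 + ((-2 * m c) * f σ + m c ^ 2) := by
        funext σ; simp only [hF]; ring
      rw [gvar_eq, this, avg_add, avg_add, avg_const, avg_const_mul]
      simp only [hm]; ring
    have h2 := hQ z
    have h3 : (m z - m c) ^ 2 ≤ (1 / (1 - lam)) * (V z * B z) := by
      rw [one_div, inv_mul_eq_div, le_div_iff₀ hl, mul_comm]; exact hkey z
    change _ + (1 / (1 - lam)) * m' z ^ 2 ≤ Q at h2
    rw [h1, mul_sub]; linarith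
  have hIW : ∀ g : Ω → ℝ, Integrable fun z => avg (e + z • U) g * W z := fun g => by
    obtain ⟨Mx, h0, hx⟩ := exists_abs_bound g
    refine integrable_mul_mixW e U (hcont g) (C := Mx) fun z => ?_
    exact (abs_avg_le_of_bound _ _ hx).trans (by nlinarith [sq_nonneg z])
  have hIW1 : Integrable W := by simpa [avg_const] using hIW fun _ => 1
  have hint : ∫ z, avg (e + z • U) F * W z ≤ Q * ∫ z, W z := by
    calc _ ≤ ∫ z, (Q * W z + (-(1 / (1 - lam))) * (m' z ^ 2 * W z - V z * B z * W z)) := by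
          refine integral_mono (hIW F) ((hIW1.const_mul Q).add ((hIm.sub hIVB).const_mul _))
            fun z => ?_
          have := mul_le_mul_of_nonneg_right (hA z) (mixW_pos e U z).le
          simp only [hWdef] at this ⊢
          linarith
      _ = _ := by
          have h0 : Integrable fun z => m' z ^ 2 * W z - V z * B z * W z := hIm.sub hIVB
          rw [integral_add (hIW1.const_mul Q) (h0.const_mul _), integral_const_mul,
            integral_const_mul, hparts]; ring
  have hs : 0 < Real.sqrt (2 * Real.pi) := by positivity
  have hW1 := integral_avg_mul_mixW e U fun _ => 1
  simp only [avg_const, one_mul] at hW1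
  rw [integral_avg_mul_mixW, hWdef, hW1, ← mul_assoc, mul_comm Q, mul_assoc] at hint
  have hfin := le_of_mul_le_mul_left hint hs
  refine (gvar_le_avg_sq _ f (m c)).trans ?_
  rw [avg, div_le_iff₀ (Zs_pos _)]
  exact hfin

end RankOne

section SpinSystems

theorem hasDerivAt_tanh (x : ℝ) : HasDerivAt Real.tanh (1 - Real.tanh x ^ 2) x := by
  have hc := (Real.cosh_pos x).ne'
  have h := (Real.hasDerivAt_sinh x).div (Real.hasDerivAt_cosh x) hc
  have he : Real.tanh = Real.sinh / Real.cosh := funext Real.tanh_eq_sinh_div_cosh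
  rw [he]
  refine h.congr_deriv ?_
  simp only [Pi.div_apply]
  field_simp

variable {N : ℕ}

/-- The linear observable with coefficients `v`. -/
def lin (v : Fin N → ℝ) (σ : Cfg N) : ℝ := ∑ i, v i * spin (σ i)

theorem lin_add (v w : Fin N → ℝ) (σ : Cfg N) : lin (v + w) σ = lin v σ + lin w σ := by
  simp [lin, add_mul, sum_add_distrib]

theorem lin_smul (r : ℝ) (v : Fin N → ℝ) (σ : Cfg N) : lin (r • v) σ = r * lin v σ := by
  simp [lin, mul_sum, mul_assoc]

theorem spin_sq (b : Bool) : spin b ^ 2 = 1 := by cases b <;> simp [spin]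

theorem lin_sq_le (v : Fin N → ℝ) (σ : Cfg N) : lin v σ ^ 2 ≤ N * ∑ i, v i ^ 2 := by
  have := sum_mul_sq_le_sq_mul_sq univ v (fun i => spin (σ i))
  simp only [spin_sq, sum_const, card_univ, Fintype.card_fin, nsmul_eq_mul, mul_one] at this
  rw [mul_comm]; exact this

theorem Zs_lin (h : Fin N → ℝ) : Zs (lin h) = ∏ i, (2 * Real.cosh (h i)) := by
  have h1 : ∀ i, 2 * Real.cosh (h i) = ∑ b : Bool, Real.exp (h i * spin b) := fun i => by
    simp [spin, Real.cosh_eq]; ring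
  simp_rw [h1]
  rw [prod_univ_sum, Fintype.piFinset_univ]
  refine sum_congr rfl fun σ _ => ?_
  rw [lin, Real.exp_sum]

theorem avg_lin_lin (h v : Fin N → ℝ) : avg (lin h) (lin v) = ∑ i, v i * Real.tanh (h i) := by
  have h1 := hasDerivAt_Phi_line (lin h) (lin v) 0
  have h2 : (fun u : ℝ => Phi (lin h + u • lin v)) =
      fun u : ℝ => ∑ i, Real.log (2 * Real.cosh (h i + u * v i)) := by
    funext u
    have : lin h + u • lin v = lin (h + u • v) := by
      funext σ; simp [lin_add, lin_smul]
    rw [this, Phi, Zs_lin, Real.log_prod fun i _ => by have := Real.cosh_pos ((h + u • v) i); positivity]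
    simp
  rw [h2] at h1
  have h3 : HasDerivAt (fun u : ℝ => ∑ i, Real.log (2 * Real.cosh (h i + u * v i)))
      (∑ i, v i * Real.tanh (h i)) 0 := by
    refine HasDerivAt.fun_sum fun i _ => ?_
    have hl : HasDerivAt (fun u : ℝ => h i + u * v i) (v i) 0 := by
      simpa using ((hasDerivAt_id (0 : ℝ)).mul_const (v i)).const_add (h i)
    have hc := Real.cosh_pos (h i + 0 * v i)
    refine ((hl.cosh.const_mul 2).log (by positivity)).congr_deriv ?_
    have hc' := Real.cosh_pos (h i)
    rw [Real.tanh_eq_sinh_div_cosh]; simp; field_simp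
  have := h1.unique h3
  simpa using this

theorem gvar_lin_lin (h v : Fin N → ℝ) : gvar (lin h) (lin v) ≤ ∑ i, v i ^ 2 := by
  have h1 := hasDerivAt_avg_self_line (lin h) (lin v) 0
  have h2 : (fun u : ℝ => avg (lin h + u • lin v) (lin v)) =
      fun u : ℝ => ∑ i, v i * Real.tanh (h i + u * v i) := by
    funext u
    have : lin h + u • lin v = lin (h + u • v) := by
      funext σ; simp [lin_add, lin_smul]
    rw [this, avg_lin_lin]; simp
  rw [h2] at h1
  have h3 : HasDerivAt (fun u : ℝ => ∑ i, v i * Real.tanh (h i + u * v i))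
      (∑ i, v i * ((1 - Real.tanh (h i) ^ 2) * v i)) 0 := by
    refine HasDerivAt.fun_sum fun i _ => ?_
    have hl : HasDerivAt (fun u : ℝ => h i + u * v i) (v i) 0 := by
      simpa using ((hasDerivAt_id (0 : ℝ)).mul_const (v i)).const_add (h i)
    refine (((hasDerivAt_tanh _).comp 0 hl).const_mul (v i)).congr_deriv ?_
    simp
  have := h1.unique h3
  simp only [zero_smul, add_zero] at this
  rw [this]
  refine sum_le_sum fun i _ => ?_
  nlinarith [mul_nonneg (sq_nonneg (v i)) (sq_nonneg (Real.tanh (h i)))]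

theorem gcov_mul_right {Ω : Type} [Fintype Ω] (e f g : Ω → ℝ) (r : ℝ) :
    gcov e f (fun σ => r * g σ) = r * gcov e f g := by
  have : (fun σ => f σ * (r * g σ)) = fun σ => r * (f σ * g σ) := by funext σ; ring
  rw [gcov, gcov, this, avg_const_mul, avg_const_mul]; ring

theorem gvar_add_mul {Ω : Type} [Fintype Ω] [Nonempty Ω] (e f g : Ω → ℝ) (r : ℝ) :
    gvar e (fun σ => f σ + r * g σ) = gvar e f + 2 * r * gcov e f g + r ^ 2 * gvar e g := by
  have : (fun σ => (f σ + r * g σ) ^ 2) =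
      fun σ => f σ ^ 2 + ((2 * r) * (f σ * g σ) + r ^ 2 * g σ ^ 2) := by funext σ; ring
  rw [gvar_eq, this, avg_add, avg_add, avg_const_mul, avg_const_mul, avg_add, avg_const_mul,
    gvar_eq, gvar_eq, gcov]
  ring

theorem gvar_add_sum_sq_le {κ : Type} [DecidableEq κ] (u : κ → Fin N → ℝ) (lam : κ → ℝ)
    (hu : ∀ a b, ∑ i, u a i * u b i = if a = b then 1 else 0)
    (hlam : ∀ a, 0 ≤ lam a ∧ lam a ≤ 1 / 4) (S : Finset κ) (h v : Fin N → ℝ) :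
    gvar (fun σ => lin h σ + ∑ a ∈ S, lam a * lin (u a) σ ^ 2 / 2) (lin v) ≤
      ∑ i, v i ^ 2 + (1 / 2) * ∑ a ∈ S, (∑ i, u a i * v i) ^ 2 := by
  induction S using Finset.induction_on generalizing h v with
  | empty => simpa using gvar_lin_lin h v
  | insert b S hb ih =>
    obtain ⟨hl0, hl1⟩ := hlam b
    set e : Cfg N → ℝ := fun σ => lin h σ + ∑ a ∈ S, lam a * lin (u a) σ ^ 2 / 2 with he
    set U : Cfg N → ℝ := fun σ => Real.sqrt (lam b) * lin (u b) σ with hU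
    have hsq : Real.sqrt (lam b) ^ 2 = lam b := Real.sq_sqrt hl0
    have hen : (fun σ => lin h σ + ∑ a ∈ insert b S, lam a * lin (u a) σ ^ 2 / 2) =
        fun σ => e σ + U σ ^ 2 / 2 := by
      funext σ
      rw [sum_insert hb, he, hU, mul_pow, hsq]; ring
    have hez : ∀ z : ℝ, e + z • U = fun σ => lin (h + (z * Real.sqrt (lam b)) • u b) σ +
        ∑ a ∈ S, lam a * lin (u a) σ ^ 2 / 2 := fun z => by
      funext σ
      simp only [he, hU, Pi.add_apply, Pi.smul_apply, smul_eq_mul, lin_add, lin_smul]; ring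
    have hub : ∑ i, u b i ^ 2 = 1 := by
      have := hu b b
      simpa [sq] using this
    have hQ : ∀ (w : Fin N → ℝ) (r : ℝ), ∑ i, (w + r • u b) i ^ 2 +
        (1 / 2) * ∑ a ∈ S, (∑ i, u a i * (w + r • u b) i) ^ 2 =
        (∑ i, w i ^ 2 + (1 / 2) * ∑ a ∈ S, (∑ i, u a i * w i) ^ 2) +
          2 * r * ∑ i, u b i * w i + r ^ 2 := fun w r => by
      have h1 : ∑ i, (w + r • u b) i ^ 2 =
          ∑ i, w i ^ 2 + 2 * r * ∑ i, u b i * w i + r ^ 2 * ∑ i, u b i ^ 2 := by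
        rw [mul_sum, mul_sum, ← sum_add_distrib, ← sum_add_distrib]
        refine sum_congr rfl fun i _ => ?_
        simp only [Pi.add_apply, Pi.smul_apply, smul_eq_mul]; ring
      have h2 : ∀ a ∈ S, (∑ i, u a i * (w + r • u b) i) ^ 2 = (∑ i, u a i * w i) ^ 2 := by
        intro a ha
        have hab : a ≠ b := fun h => hb (h ▸ ha)
        have : ∑ i, u a i * (w + r • u b) i = ∑ i, u a i * w i + r * ∑ i, u a i * u b i := by
          rw [mul_sum, ← sum_add_distrib]
          refine sum_congr rfl fun i _ => ?_
          simp only [Pi.add_apply, Pi.smul_apply, smul_eq_mul]; ring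
        rw [this, hu a b, if_neg hab]; simp
      rw [h1, sum_congr rfl h2, hub]; ring
    have hub1 : ∀ z : ℝ, gvar (e + z • U) (lin (u b)) ≤ 1 := fun z => by
      have h1 := ih (h + (z * Real.sqrt (lam b)) • u b) (0 + (1 : ℝ) • u b)
      rw [← hez, hQ 0 1] at h1
      simpa using h1
    have hscale : ∀ e' : Cfg N → ℝ, gvar e' U = lam b * gvar e' (lin (u b)) := fun e' => by
      have := gvar_add_mul e' (fun _ => 0) (lin (u b)) (Real.sqrt (lam b))
      rw [hsq] at this
      simp only [zero_add, gcov, zero_mul, avg_const, gvar] at this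
      simpa [hU, gvar, avg_const] using this
    rw [hen, sum_insert hb]
    refine gvar_add_half_sq_le e U (lin v) (lam b) _ (by linarith) (fun z => ?_) (fun z => ?_)
    · rw [hscale]; nlinarith [hub1 z, gvar_nonneg (e + z • U) (lin (u b))]
    · set d := ∑ i, u b i * v i with hd
      set c := gcov (e + z • U) (lin v) (lin (u b)) with hc
      rw [hU, gcov_mul_right, mul_pow, hsq, ← hc]
      have h1 := ih (h + (z * Real.sqrt (lam b)) • u b) (v + (c - d) • u b)
      rw [← hez, hQ v (c - d)] at h1
      have h2 : lin (v + (c - d) • u b) = fun σ => lin v σ + (c - d) * lin (u b) σ := by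
        funext σ; rw [lin_add, lin_smul]
      rw [h2, gvar_add_mul, ← hc, ← hd] at h1
      have h3 := gvar_nonneg (e + z • U) (lin (u b))
      have h4 : 1 / (1 - lam b) * (lam b * c ^ 2) ≤ (1 / 3) * c ^ 2 := by
        have hpos : 0 < 1 - lam b := by linarith
        rw [← mul_assoc]
        refine mul_le_mul_of_nonneg_right ?_ (sq_nonneg c)
        rw [one_div, inv_mul_eq_div, div_le_iff₀ hpos]; linarith
      have h5 := mul_nonneg (sq_nonneg (c - d)) h3
      have h6 := sq_nonneg (c - 3 / 2 * d)
      change gvar (e + z • U) (lin v) + _ ≤ _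
      nlinarith

theorem exists_spectral (A : Matrix (Fin N) (Fin N) ℝ) (hA : A.IsHermitian) :
    ∃ (u : Fin N → Fin N → ℝ) (lam : Fin N → ℝ),
      (∀ a b, ∑ i, u a i * u b i = if a = b then 1 else 0) ∧
      (∀ x : Fin N → ℝ, ∑ a, (∑ i, u a i * x i) ^ 2 = ∑ i, x i ^ 2) ∧
      ∀ x : Fin N → ℝ, ∑ i, ∑ j, A i j * x i * x j = ∑ a, lam a * (∑ i, u a i * x i) ^ 2 := by
  set b := hA.eigenvectorBasis with hb
  have hin : ∀ (a : Fin N) (x : Fin N → ℝ), inner ℝ (b a) (WithLp.toLp 2 x) = ∑ i, b a i * x i :=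
    fun a x => by simp [PiLp.inner_apply, mul_comm]
  have hin' : ∀ (a : Fin N) (x : Fin N → ℝ), inner ℝ (WithLp.toLp 2 x) (b a) = ∑ i, b a i * x i :=
    fun a x => by rw [real_inner_comm]; exact hin a x
  refine ⟨fun a i => b a i, hA.eigenvalues, fun a c => ?_, fun x => ?_, fun x => ?_⟩
  · have := orthonormal_iff_ite.1 b.orthonormal a c
    rw [← this]
    simp [PiLp.inner_apply, mul_comm]
  · have := b.sum_inner_mul_inner (WithLp.toLp 2 x) (WithLp.toLp 2 x)
    simp only [hin, hin'] at this
    simp_rw [sq]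
    rw [this, PiLp.inner_apply]
    simp [sq]
  · have h1 := b.sum_inner_mul_inner (WithLp.toLp 2 x) (WithLp.toLp 2 (A.mulVec x))
    have h2 : ∀ a, ∑ i, b a i * A.mulVec x i = hA.eigenvalues a * ∑ i, b a i * x i := fun a => by
      have h3 := hA.mulVec_eigenvectorBasis a
      have h4 : dotProduct (fun i => b a i) (A.mulVec x) =
          dotProduct (A.mulVec (fun i => b a i)) x := by
        rw [Matrix.dotProduct_mulVec, ← Matrix.mulVec_transpose]
        congr 2
      change dotProduct (fun i => b a i) (A.mulVec x) = _
      rw [h4]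
      have h5 : A.mulVec (fun i => b a i) = hA.eigenvalues a • fun i => b a i := h3
      rw [h5, smul_dotProduct]; rfl
    simp only [hin, hin', h2] at h1
    have h6 : ∑ i, ∑ j, A i j * x i * x j =
        inner ℝ (WithLp.toLp 2 x) (WithLp.toLp 2 (A.mulVec x)) := by
      simp only [PiLp.inner_apply, Matrix.mulVec, dotProduct]
      refine sum_congr rfl fun i _ => ?_
      simp only [RCLike.inner_apply, conj_trivial, sum_mul]
      exact sum_congr rfl fun j _ => by ring
    rw [h6, ← h1]
    exact sum_congr rfl fun a _ => by ring

theorem gvar_quadratic_le (J : Fin N → Fin N → ℝ) (hJ : ∀ i j, J i j = J j i)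
    (hb : ∀ x : Fin N → ℝ, |∑ i, ∑ j, J i j * x i * x j| ≤ (1 / 8) * ∑ i, x i ^ 2)
    (h v : Fin N → ℝ) :
    gvar (fun σ => (1 / 2) * (∑ i, ∑ j, J i j * spin (σ i) * spin (σ j)) + lin h σ) (lin v) ≤
      2 * ∑ i, v i ^ 2 := by
  set A : Matrix (Fin N) (Fin N) ℝ := fun i j => J i j + if i = j then 1 / 8 else 0 with hA
  have hAH : A.IsHermitian := by
    refine Matrix.IsHermitian.ext fun i j => ?_
    simp [hA, hJ i j, eq_comm]
  obtain ⟨u, lam, hu, hx, hq⟩ := exists_spectral A hAH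
  have hAq : ∀ x : Fin N → ℝ, ∑ i, ∑ j, A i j * x i * x j =
      ∑ i, ∑ j, J i j * x i * x j + (1 / 8) * ∑ i, x i ^ 2 := fun x => by
    simp only [hA, add_mul, sum_add_distrib, ite_mul, zero_mul, sum_ite_eq, mem_univ, if_true]
    rw [mul_sum]
    congr 1
    exact sum_congr rfl fun i _ => by ring
  have hlam : ∀ a, 0 ≤ lam a ∧ lam a ≤ 1 / 4 := fun a => by
    have h1 := hq (u a)
    have h2 := hb (u a)
    have h3 : ∑ i, u a i ^ 2 = 1 := by simpa [sq] using hu a a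
    have h4 : ∑ c, lam c * (∑ i, u c i * u a i) ^ 2 = lam a := by
      simp [hu]
    rw [hAq, h4, h3] at h1
    rw [h3] at h2
    have := abs_le.1 h2
    constructor <;> linarith [this.1, this.2]
  have hmain := gvar_add_sum_sq_le u lam hu hlam univ h v
  have hen : (fun σ => lin h σ + ∑ a ∈ univ, lam a * lin (u a) σ ^ 2 / 2) =
      fun σ => ((1 / 2) * (∑ i, ∑ j, J i j * spin (σ i) * spin (σ j)) + lin h σ) + N / 16 := by
    funext σ
    have h1 := hq (fun i => spin (σ i))
    rw [hAq] at h1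
    simp only [spin_sq, sum_const, card_univ, Fintype.card_fin, nsmul_eq_mul, mul_one] at h1
    rw [← sum_div]
    simp only [lin] at h1 ⊢
    rw [← h1]; ring
  rw [hen, gvar_add_const, hx] at hmain
  linarith [sum_nonneg fun i (_ : i ∈ univ) => sq_nonneg (v i)]

end SpinSystems

section Subgaussian

theorem pow_two_mul_le_factorial_mul (x : ℝ) (a : ℕ) :
    x ^ (2 * a) ≤ (2 * a).factorial * (Real.exp x + Real.exp (-x)) := by
  have h := Real.pow_div_factorial_le_exp |x| (abs_nonneg x) (2 * a)
  rw [(even_two_mul a).pow_abs, div_le_iff₀ (by positivity), mul_comm (Real.exp _)] at h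
  refine h.trans (mul_le_mul_of_nonneg_left ?_ (by positivity))
  rcases abs_cases x with ⟨h, -⟩ | ⟨h, -⟩ <;> rw [h] <;>
    linarith [Real.exp_pos x, Real.exp_pos (-x)]

theorem avg_exp_centered {Ω : Type} [Fintype Ω] [Nonempty Ω] (e X : Ω → ℝ) (s : ℝ) :
    avg e (fun σ => Real.exp (s * (X σ - avg e X))) =
      Real.exp (Phi (e + s • X) - Phi e - s * avg e X) := by
  rw [Real.exp_sub, Real.exp_sub, exp_Phi, exp_Phi, avg, div_right_comm]
  congr 1
  rw [show Zs (e + s • X) = ∑ σ, Real.exp ((e + s • X) σ) from rfl, sum_div]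
  refine sum_congr rfl fun σ _ => ?_
  rw [Pi.add_apply, Real.exp_add, mul_sub, Real.exp_sub, Pi.smul_apply, smul_eq_mul]
  ring

theorem avg_exp_centered_le {Ω : Type} [Fintype Ω] [Nonempty Ω] (e X : Ω → ℝ)
    (h : ∀ s : ℝ, gvar (e + s • X) X ≤ 2) (s : ℝ) :
    avg e (fun σ => Real.exp (s * (X σ - avg e X))) ≤ Real.exp (s ^ 2) := by
  rw [avg_exp_centered, Real.exp_le_exp]
  set φ : ℝ → ℝ := fun s => Phi (e + s • X) - s * avg e X - s ^ 2 with hφ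
  set φ' : ℝ → ℝ := fun s => avg (e + s • X) X - avg e X - 2 * s with hφ'
  have hd : ∀ s, HasDerivAt φ (φ' s) s := fun s => by
    refine (((hasDerivAt_Phi_line e X s).sub ((hasDerivAt_id s).mul_const _)).sub
      ((hasDerivAt_id s).pow 2)).congr_deriv ?_
    simp [hφ']
  have hd' : ∀ s, HasDerivAt φ' (gvar (e + s • X) X - 2) s := fun s => by
    refine (((hasDerivAt_avg_self_line e X s).sub_const _).sub
      ((hasDerivAt_id s).const_mul 2)).congr_deriv ?_
    simp
  have hanti : Antitone φ' := antitone_of_hasDerivAt_nonpos hd' fun s => by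
    have := h s
    simp only [Pi.zero_apply]; linarith
  have h0 : φ' 0 = 0 := by simp [hφ']
  have hcont : Continuous φ := continuous_iff_continuousAt.2 fun z => (hd z).continuousAt
  have hle : φ s ≤ φ 0 := by
    rcases le_total 0 s with hs | hs
    · refine antitoneOn_of_deriv_nonpos (convex_Ici 0) hcont.continuousOn
        (fun x _ => (hd x).differentiableAt.differentiableWithinAt) (fun x hx => ?_)
        (Set.self_mem_Ici) (Set.mem_Ici.2 hs) hs
      rw [interior_Ici] at hx
      rw [(hd x).deriv, ← h0]
      exact hanti (le_of_lt hx)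
    · refine monotoneOn_of_deriv_nonneg (convex_Iic 0) hcont.continuousOn
        (fun x _ => (hd x).differentiableAt.differentiableWithinAt) (fun x hx => ?_)
        (Set.mem_Iic.2 hs) (Set.self_mem_Iic) hs
      rw [interior_Iic] at hx
      rw [(hd x).deriv, ← h0]
      exact hanti (le_of_lt hx)
  simp only [hφ, zero_smul, add_zero, zero_mul, sub_zero, ne_eq, OfNat.ofNat_ne_zero,
    not_false_eq_true, zero_pow] at hle
  linarith

theorem avg_centered_pow_le {Ω : Type} [Fintype Ω] [Nonempty Ω] (e X : Ω → ℝ)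
    (h : ∀ s : ℝ, gvar (e + s • X) X ≤ 2) (a : ℕ) :
    avg e (fun σ => (X σ - avg e X) ^ (2 * a)) ≤ (2 * a).factorial * 6 := by
  have h1 := avg_exp_centered_le e X h 1
  have h2 := avg_exp_centered_le e X h (-1)
  simp only [one_mul, neg_mul, one_pow, neg_sq] at h1 h2
  have h3 := Real.exp_one_lt_d9
  refine (avg_mono (e := e) fun σ => pow_two_mul_le_factorial_mul (X σ - avg e X) a).trans ?_
  rw [avg_const_mul, avg_add]
  exact mul_le_mul_of_nonneg_left (by linarith) (by positivity)

variable {N : ℕ}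

/-- `R` controls the fluctuations of linear observables under the Gibbs measure with energy `e`,
uniformly in the external fields: either by uniform variance bounds, or trivially. -/
def RadBound (e : Cfg N → ℝ) (R : ℝ) : Prop :=
  (R = 1 ∧ ∀ h v : Fin N → ℝ, gvar (e + lin h) (lin v) ≤ 2 * ∑ i, v i ^ 2) ∨
    (1 ≤ R ∧ 4 * N ≤ R ^ 2)

theorem RadBound.one_le {e : Cfg N → ℝ} {R : ℝ} (hR : RadBound e R) : 1 ≤ R := by
  rcases hR with ⟨rfl, -⟩ | ⟨h, -⟩
  exacts [le_rfl, h]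

theorem RadBound.gvar_le {e : Cfg N → ℝ} {R : ℝ} (hR : RadBound e R) (h v : Fin N → ℝ)
    (hv : ∑ i, v i ^ 2 = 1) : gvar (e + lin h) (lin v) ≤ 2 * R ^ 2 := by
  rcases hR with ⟨rfl, hg⟩ | ⟨h1, h4⟩
  · simpa [hv] using hg h v
  · refine (gvar_le_avg_sq _ _ 0).trans ?_
    refine (avg_mono (g := fun _ => (N : ℝ)) fun σ => ?_).trans ?_
    · simpa [hv] using lin_sq_le v σ
    · rw [avg_const]; nlinarith [(Nat.cast_nonneg N : (0 : ℝ) ≤ N)]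

theorem RadBound.avg_centered_pow_le {e : Cfg N → ℝ} {R : ℝ} (hR : RadBound e R)
    (h v : Fin N → ℝ) (hv : ∑ i, v i ^ 2 = 1) (a : ℕ) :
    avg (e + lin h) (fun σ => (lin v σ - avg (e + lin h) (lin v)) ^ (2 * a)) ≤
      (2 * a).factorial * 6 * R ^ (2 * a) := by
  have hfac : (1 : ℝ) ≤ (2 * a).factorial := by exact_mod_cast Nat.succ_le_of_lt (Nat.factorial_pos _)
  rcases hR with ⟨rfl, hg⟩ | ⟨h1, h4⟩
  · rw [one_pow, mul_one]
    refine _root_.avg_centered_pow_le _ _ (fun s => ?_) a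
    have := hg (h + s • v) v
    rw [hv, mul_one] at this
    convert this using 2
    funext σ; simp [lin_add, lin_smul, add_assoc]
  · have hlin : ∀ σ, |lin v σ| ≤ Real.sqrt N := fun σ => by
      refine Real.abs_le_sqrt ?_
      simpa [hv] using lin_sq_le v σ
    have hbd : ∀ σ, (lin v σ - avg (e + lin h) (lin v)) ^ (2 * a) ≤ R ^ (2 * a) := fun σ => by
      rw [pow_mul, pow_mul]
      refine pow_le_pow_left₀ (sq_nonneg _) ?_ a
      refine le_trans ?_ h4
      have := (abs_sub (lin v σ) (avg (e + lin h) (lin v))).trans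
        (add_le_add (hlin σ) (abs_avg_le_of_bound _ _ hlin))
      have h0 := abs_nonneg (lin v σ - avg (e + lin h) (lin v))
      rw [← sq_abs]
      have hs := Real.sq_sqrt (Nat.cast_nonneg N : (0 : ℝ) ≤ N)
      nlinarith [Real.sqrt_nonneg (N : ℝ)]
    refine (avg_mono hbd).trans ?_
    rw [avg_const]
    have : 0 ≤ R ^ (2 * a) := by positivity
    nlinarith

/-- The magnetisation of the `i`-th spin. -/
def mag (i : Fin N) (e : Cfg N → ℝ) : ℝ := avg e fun σ => spin (σ i)

theorem contDiff_mag (i : Fin N) : ContDiff ℝ (⊤ : ℕ∞) (mag i) := contDiff_avg _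

theorem avg_lin (e : Cfg N → ℝ) (v : Fin N → ℝ) : avg e (lin v) = ∑ i, v i * mag i e := by
  unfold lin
  rw [avg_sum]
  exact sum_congr rfl fun i _ => avg_const_mul _ _ _

theorem abs_sum_mul_dirD_mag_le (k : ℕ) (hk : 1 ≤ k) :
    ∃ C : ℝ, 0 ≤ C ∧ ∀ (N : ℕ) (e : Cfg N → ℝ) (R : ℝ), RadBound e R →
      ∀ h t w : Fin N → ℝ, ∑ i, t i ^ 2 = 1 → ∑ i, w i ^ 2 = 1 →
        |∑ j, w j * dirD (lin t) k (mag j) (e + lin h)| ≤ C * R ^ (k + 1) := by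
  obtain ⟨C, hC0, hC⟩ := abs_dirD_avg_le ((2 * k).factorial * 6)
    (by have : (1 : ℝ) ≤ (2 * k).factorial := by
          exact_mod_cast Nat.succ_le_of_lt (Nat.factorial_pos _)
        linarith) k hk
  refine ⟨C, hC0, fun N e R hR h t w ht hw => ?_⟩
  have h1 := hC (Cfg N) (e + lin h) (lin w) (lin t) R (zero_le_one.trans hR.one_le)
    (fun a ha => (hR.avg_centered_pow_le h t ht a).trans ?_) ((hR.gvar_le h w hw).trans ?_)
  · rw [← dirD_sum (lin t) univ w (fun j => contDiff_mag j) k (e + lin h)]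
    simpa only [← avg_lin] using h1
  · have : ((2 * a).factorial : ℝ) ≤ (2 * k).factorial := by
      exact_mod_cast Nat.factorial_le (by omega)
    have := hR.one_le
    gcongr
  · have : (1 : ℝ) ≤ (2 * k).factorial := by
      exact_mod_cast Nat.succ_le_of_lt (Nat.factorial_pos _)
    gcongr; linarith

theorem sum_sq_dirD_mag_le (k : ℕ) (hk : 1 ≤ k) :
    ∃ C : ℝ, 0 ≤ C ∧ ∀ (N : ℕ) (e : Cfg N → ℝ) (R : ℝ), RadBound e R →
      ∀ h t : Fin N → ℝ, ∑ i, t i ^ 2 = 1 →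
        ∑ j, dirD (lin t) k (mag j) (e + lin h) ^ 2 ≤ C * R ^ (2 * (k + 1)) := by
  obtain ⟨C, hC0, hC⟩ := abs_sum_mul_dirD_mag_le k hk
  refine ⟨C ^ 2, sq_nonneg C, fun N e R hR h t ht => ?_⟩
  set D : Fin N → ℝ := fun j => dirD (lin t) k (mag j) (e + lin h) with hD
  set S := ∑ j, D j ^ 2 with hS
  have hR0 := zero_le_one.trans hR.one_le
  rcases (sum_nonneg fun j (_ : j ∈ univ) => sq_nonneg (D j)).eq_or_lt with h0 | h0
  · change S ≤ _
    rw [hS, ← h0]; positivity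
  · have hs : 0 < Real.sqrt S := Real.sqrt_pos.2 h0
    have hsq : Real.sqrt S ^ 2 = S := Real.sq_sqrt h0.le
    have h1 := hC N e R hR h t (fun j => D j / Real.sqrt S) ht (by
      simp_rw [div_pow, hsq, ← sum_div]
      exact div_self h0.ne')
    have h2 : ∑ j, D j / Real.sqrt S * dirD (lin t) k (mag j) (e + lin h) = Real.sqrt S := by
      have : ∀ j, D j / Real.sqrt S * dirD (lin t) k (mag j) (e + lin h) =
          D j ^ 2 / Real.sqrt S := fun j => by
        change D j / Real.sqrt S * D j = _
        ring
      simp_rw [this, ← sum_div]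
      exact Real.div_sqrt
    rw [h2, abs_of_pos hs] at h1
    change S ≤ _
    rw [← hsq]
    refine (pow_le_pow_left₀ hs.le h1 2).trans (le_of_eq ?_)
    rw [mul_pow, ← pow_mul, mul_comm (k + 1) 2]

end Subgaussian

section Net

variable {N : ℕ}

/-- The quadratic form with upper-triangular coefficients `g`. -/
def quadForm (g : Fin N → Fin N → ℝ) (x : Fin N → ℝ) : ℝ :=
  ∑ i, ∑ j, if i < j then g i j * x i * x j else 0

/-- The interaction energy of the spins in `A`. -/
def pairEnergy (b : ℝ) (A : Finset (Fin N)) (g : Fin N → Fin N → ℝ) (σ : Cfg N) : ℝ :=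
  b * quadForm g fun i => if i ∈ A then spin (σ i) else 0

theorem quadForm_smul (g : Fin N → Fin N → ℝ) (r : ℝ) (x : Fin N → ℝ) :
    quadForm g (r • x) = r ^ 2 * quadForm g x := by
  simp only [quadForm, mul_sum]
  refine sum_congr rfl fun i _ => sum_congr rfl fun j _ => ?_
  split_ifs
  · simp only [Pi.smul_apply, smul_eq_mul]; ring
  · simp

theorem quadForm_neg (g : Fin N → Fin N → ℝ) (x : Fin N → ℝ) :
    quadForm (-g) x = -quadForm g x := by
  simp only [quadForm, ← sum_neg_distrib]
  refine sum_congr rfl fun i _ => sum_congr rfl fun j _ => ?_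
  split_ifs <;> simp

theorem quadForm_update (g : Fin N → Fin N → ℝ) (x : Fin N → ℝ) (i : Fin N) :
    ∃ α γ : ℝ, ∀ s, quadForm g (Function.update x i s) = α + γ * s := by
  have h : ∀ a c : Fin N, ∃ α γ : ℝ, ∀ s, (if a < c then g a c * Function.update x i s a *
      Function.update x i s c else 0) = α + γ * s := by
    intro a c
    by_cases hac : a < c
    · by_cases ha : a = i
      · refine ⟨0, g a c * x c, fun s => ?_⟩
        have hc : c ≠ i := fun h => hac.ne (ha.trans h.symm)
        rw [if_pos hac, ha, Function.update_self, Function.update_of_ne hc]; ring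
      · by_cases hc : c = i
        · refine ⟨0, g a c * x a, fun s => ?_⟩
          rw [if_pos hac, hc, Function.update_self, Function.update_of_ne ha]; ring
        · refine ⟨g a c * x a * x c, 0, fun s => ?_⟩
          rw [if_pos hac, Function.update_of_ne hc, Function.update_of_ne ha]; ring
    · exact ⟨0, 0, fun s => by rw [if_neg hac]; ring⟩
  choose α γ hαγ using h
  refine ⟨∑ a, ∑ c, α a c, ∑ a, ∑ c, γ a c, fun s => ?_⟩
  simp only [quadForm, hαγ, sum_add_distrib, sum_mul]

theorem exists_int_rounding (g : Fin N → Fin N → ℝ) (x : Fin N → ℝ) :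
    ∃ z : Fin N → ℤ, (∀ i, |(z i : ℝ) - x i| ≤ 1) ∧
      quadForm g x ≤ quadForm g fun i => (z i : ℝ) := by
  have h : ∀ S : Finset (Fin N), ∃ y : Fin N → ℝ, (∀ i ∈ S, ∃ z : ℤ, y i = z) ∧
      (∀ i, |y i - x i| ≤ 1) ∧ (∀ i ∉ S, y i = x i) ∧ quadForm g x ≤ quadForm g y := by
    intro S
    induction S using Finset.induction_on with
    | empty => exact ⟨x, by simp, by simp, by simp, le_rfl⟩
    | insert a S ha ih =>
      obtain ⟨y, h1, h2, h3, h4⟩ := ih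
      obtain ⟨α, γ, hαγ⟩ := quadForm_update g y a
      have hy : quadForm g y = α + γ * x a := by
        rw [← h3 a ha, ← hαγ, Function.update_eq_self]
      obtain ⟨z, hz1, hz2⟩ : ∃ z : ℤ, |(z : ℝ) - x a| ≤ 1 ∧ γ * x a ≤ γ * z := by
        rcases le_total 0 γ with hγ | hγ
        · refine ⟨⌈x a⌉, ?_, mul_le_mul_of_nonneg_left (Int.le_ceil _) hγ⟩
          rw [abs_le]; constructor <;> linarith [Int.le_ceil (x a), Int.ceil_lt_add_one (x a)]
        · refine ⟨⌊x a⌋, ?_, mul_le_mul_of_nonpos_left (Int.floor_le _) hγ⟩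
          rw [abs_le]; constructor <;> linarith [Int.floor_le (x a), Int.lt_floor_add_one (x a)]
      refine ⟨Function.update y a z, fun i hi => ?_, fun i => ?_, fun i hi => ?_, ?_⟩
      · rcases eq_or_ne i a with rfl | hia
        · exact ⟨z, by simp⟩
        · rw [Function.update_of_ne hia]
          exact h1 i ((mem_insert.1 hi).resolve_left hia)
      · rcases eq_or_ne i a with rfl | hia
        · simpa using hz1
        · rw [Function.update_of_ne hia]; exact h2 i
      · rw [mem_insert, not_or] at hi
        rw [Function.update_of_ne hi.1]; exact h3 i hi.2
      · rw [hαγ]; linarith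
  obtain ⟨y, h1, h2, -, h4⟩ := h univ
  choose z hz using fun i => h1 i (mem_univ i)
  refine ⟨z, fun i => by rw [← hz]; exact h2 i, ?_⟩
  have : y = fun i => (z i : ℝ) := funext hz
  rwa [← this]

/-- The integer points of squared norm at most `4 N`. -/
def intBall (N : ℕ) : Finset (Fin N → ℤ) :=
  {z ∈ Fintype.piFinset fun _ => Icc (-(2 * N : ℤ)) (2 * N) | ∑ i, z i ^ 2 ≤ 4 * N}

theorem mem_intBall {z : Fin N → ℤ} (hz : ∑ i, z i ^ 2 ≤ 4 * N) : z ∈ intBall N := by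
  refine mem_filter.2 ⟨Fintype.mem_piFinset.2 fun i => ?_, hz⟩
  have h1 : z i ^ 2 ≤ 4 * N :=
    (single_le_sum (f := fun i => z i ^ 2) (fun _ _ => sq_nonneg _) (mem_univ i)).trans hz
  have hN : (1 : ℤ) ≤ N := by have := i.pos; omega
  rw [mem_Icc]
  exact abs_le.1 (abs_le_of_sq_le_sq (by nlinarith) (by positivity))

/-- The disorder has a large quadratic form on some integer point. -/
def netBad (b : ℝ) (N : ℕ) : Set (Fin N → Fin N → ℝ) :=
  {g | ∃ z ∈ intBall N, (N : ℝ) / 16 < |b * quadForm g fun i => (z i : ℝ)|}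

theorem quadForm_le_of_not_netBad (b : ℝ) (hN : 1 ≤ N) {g : Fin N → Fin N → ℝ}
    (hg : g ∉ netBad b N) (x : Fin N → ℝ) :
    |b * quadForm g x| ≤ (1 / 16) * ∑ i, x i ^ 2 := by
  have hNr : (1 : ℝ) ≤ N := by exact_mod_cast hN
  have key : ∀ (g' : Fin N → Fin N → ℝ), (∀ z ∈ intBall N, quadForm g' (fun i => (z i : ℝ)) ≤ N / 16) →
      ∀ x : Fin N → ℝ, ∑ i, x i ^ 2 = N → quadForm g' x ≤ N / 16 := by
    intro g' hg' x hx
    obtain ⟨z, hz1, hz2⟩ := exists_int_rounding g' x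
    refine hz2.trans (hg' z (mem_intBall ?_))
    have : ∀ i, (z i : ℝ) ^ 2 ≤ 2 * x i ^ 2 + 2 := fun i => by
      have := hz1 i
      have h2 := sq_le_sq' (by linarith [neg_abs_le ((z i : ℝ) - x i)]) ((le_abs_self _).trans this)
      nlinarith [sq_nonneg ((z i : ℝ) - 2 * x i)]
    have h3 := sum_le_sum fun i (_ : i ∈ univ) => this i
    rw [sum_add_distrib, ← mul_sum, hx] at h3
    simp only [sum_const, card_univ, Fintype.card_fin, nsmul_eq_mul] at h3
    have h4 : ((∑ i, z i ^ 2 : ℤ) : ℝ) ≤ ((4 * N : ℤ) : ℝ) := by push_cast; linarith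
    exact_mod_cast h4
  have hq : ∀ x : Fin N → ℝ, quadForm (b • g) x = b * quadForm g x := fun x => by
    simp only [quadForm, mul_sum]
    refine sum_congr rfl fun i _ => sum_congr rfl fun j _ => ?_
    split_ifs
    · simp only [Pi.smul_apply, smul_eq_mul]; ring
    · simp
  have hng : ∀ z ∈ intBall N, |b * quadForm g fun i => (z i : ℝ)| ≤ N / 16 := fun z hz => by
    by_contra hcon
    exact hg ⟨z, hz, not_le.1 hcon⟩
  have hmain : ∀ x : Fin N → ℝ, ∑ i, x i ^ 2 = N → |b * quadForm g x| ≤ N / 16 := fun x hx => by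
    rw [abs_le']
    constructor
    · rw [← hq]
      exact key _ (fun z hz => by rw [hq]; exact (le_abs_self _).trans (hng z hz)) x hx
    · rw [← hq, ← quadForm_neg]
      exact key _ (fun z hz => by
        rw [quadForm_neg, hq]; exact (neg_le_abs _).trans (hng z hz)) x hx
  rcases (sum_nonneg fun j (_ : j ∈ univ) => sq_nonneg (x j)).eq_or_lt with h0 | h0
  · have hx : x = 0 := by
      funext i
      have := (sum_eq_zero_iff_of_nonneg fun j _ => sq_nonneg (x j)).1 h0.symm i (mem_univ i)
      simpa using this
    simp [hx, quadForm]
  · set r := Real.sqrt (N / ∑ i, x i ^ 2) with hr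
    have hr2 : r ^ 2 = N / ∑ i, x i ^ 2 := Real.sq_sqrt (by positivity)
    have h1 := hmain (r • x) (by
      simp only [Pi.smul_apply, smul_eq_mul, mul_pow, ← mul_sum, hr2]
      field_simp)
    rw [quadForm_smul, hr2, mul_left_comm, abs_mul, abs_of_nonneg (by positivity),
      div_mul_eq_mul_div, div_le_iff₀ h0] at h1
    have h2 : (0 : ℝ) < N := by linarith
    nlinarith

theorem radBound_one_of_not_netBad (b : ℝ) (hN : 1 ≤ N) {g : Fin N → Fin N → ℝ}
    (hg : g ∉ netBad b N) (A : Finset (Fin N)) : RadBound (pairEnergy b A g) 1 := by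
  refine Or.inl ⟨rfl, fun h v => ?_⟩
  set J : Fin N → Fin N → ℝ := fun i j => if i ∈ A ∧ j ∈ A then
    b * ((if i < j then g i j else 0) + if j < i then g j i else 0) else 0 with hJ
  have hsum : ∀ x : Fin N → ℝ, ∑ i, ∑ j, J i j * x i * x j =
      2 * (b * quadForm g fun i => if i ∈ A then x i else 0) := fun x => by
    have e1 : ∑ i, ∑ j, (if i ∈ A ∧ j ∈ A then b * (if i < j then g i j else 0) else 0) * x i * x j =
        b * quadForm g fun i => if i ∈ A then x i else 0 := by
      simp only [quadForm, mul_sum]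
      refine sum_congr rfl fun i _ => sum_congr rfl fun j _ => ?_
      by_cases hi : i ∈ A <;> by_cases hj : j ∈ A <;> by_cases hij : i < j <;>
        simp [hi, hj, hij, mul_assoc]
    have e2 : ∑ i, ∑ j, (if i ∈ A ∧ j ∈ A then b * (if j < i then g j i else 0) else 0) * x i * x j =
        b * quadForm g fun i => if i ∈ A then x i else 0 := by
      rw [← e1, sum_comm]
      refine sum_congr rfl fun i _ => sum_congr rfl fun j _ => ?_
      by_cases hi : i ∈ A <;> by_cases hj : j ∈ A <;> simp only [hi, hj, and_self, and_true, and_false, if_true, if_false] <;> ring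
    rw [two_mul]
    nth_rewrite 1 [← e1]
    rw [← e2, ← sum_add_distrib]
    refine sum_congr rfl fun i _ => ?_
    rw [← sum_add_distrib]
    refine sum_congr rfl fun j _ => ?_
    simp only [hJ]
    split_ifs <;> ring
  have := gvar_quadratic_le J (fun i j => ?_) (fun x => ?_) h v
  · convert this using 2
    funext σ
    rw [hsum]
    simp [pairEnergy]
  · simp only [hJ, and_comm (a := i ∈ A)]
    rw [add_comm]
  · rw [hsum, abs_mul]
    have h1 := quadForm_le_of_not_netBad b hN hg fun i => if i ∈ A then x i else 0
    have h2 : ∑ i, (if i ∈ A then x i else 0) ^ 2 ≤ ∑ i, x i ^ 2 := sum_le_sum fun i _ => by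
      split_ifs
      · exact le_rfl
      · simpa using sq_nonneg (x i)
    rw [abs_two]; linarith

end Net

section NetProbability

variable {N : ℕ}

instance : IsProbabilityMeasure (gaussN N) := by unfold gaussN; infer_instance

theorem integrable_exp_gaussN (c : Fin N → Fin N → ℝ) :
    Integrable (fun g => Real.exp (∑ i, ∑ j, c i j * g i j)) (gaussN N) := by
  simp only [Real.exp_sum]
  unfold gaussN
  exact Integrable.fintype_prod fun i =>
    Integrable.fintype_prod fun j => integrable_exp_mul_gaussianReal (c i j)

theorem integral_exp_gaussN (c : Fin N → Fin N → ℝ) :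
    ∫ g, Real.exp (∑ i, ∑ j, c i j * g i j) ∂gaussN N =
      Real.exp (∑ i, ∑ j, c i j ^ 2 / 2) := by
  simp only [Real.exp_sum]
  unfold gaussN
  rw [integral_fintype_prod_eq_prod (fun i (x : Fin N → ℝ) => ∏ j, Real.exp (c i j * x j))]
  refine prod_congr rfl fun i _ => ?_
  rw [integral_fintype_prod_eq_prod (fun j (x : ℝ) => Real.exp (c i j * x))]
  refine prod_congr rfl fun j _ => ?_
  have := mgf_gaussianReal (μ := 0) (v := 1) (X := id) (p := gaussianReal 0 1)
    Measure.map_id (c i j)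
  simpa [mgf] using this

theorem quadForm_eq_sum (r : ℝ) (g : Fin N → Fin N → ℝ) (x : Fin N → ℝ) :
    r * quadForm g x = ∑ i, ∑ j, (if i < j then r * x i * x j else 0) * g i j := by
  simp only [quadForm, mul_sum]
  refine sum_congr rfl fun i _ => sum_congr rfl fun j _ => ?_
  split_ifs
  · ring
  · simp

theorem integrable_exp_quadForm (r : ℝ) (x : Fin N → ℝ) :
    Integrable (fun g => Real.exp (r * quadForm g x)) (gaussN N) := by
  simp only [quadForm_eq_sum]
  exact integrable_exp_gaussN _

theorem integral_exp_quadForm_le (r : ℝ) (x : Fin N → ℝ) :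
    ∫ g, Real.exp (r * quadForm g x) ∂gaussN N ≤ Real.exp (r ^ 2 * (∑ i, x i ^ 2) ^ 2 / 2) := by
  simp only [quadForm_eq_sum]
  rw [integral_exp_gaussN, Real.exp_le_exp, sq (∑ i, x i ^ 2), sum_mul_sum, mul_sum, sum_div]
  refine sum_le_sum fun i _ => ?_
  rw [mul_sum, sum_div]
  refine sum_le_sum fun j _ => ?_
  split_ifs
  · exact le_of_eq (by ring)
  · have : 0 ≤ r ^ 2 * (x i ^ 2 * x j ^ 2) / 2 := by positivity
    simpa using this

theorem card_intBall_le (N : ℕ) : ((intBall N).card : ℝ) ≤ Real.exp (6 * N) := by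
  have hsum : ∑ z ∈ Icc (-(2 * N : ℤ)) (2 * N), Real.exp (-(z : ℝ) ^ 2) ≤ 4 := by
    have hsub : Icc (-(2 * N : ℤ)) (2 * N) ⊆ (range (2 * N + 1)).image (fun n : ℕ => (n : ℤ)) ∪
        (range (2 * N + 1)).image (fun n : ℕ => -(n : ℤ)) := by
      intro z hz
      rw [mem_Icc] at hz
      simp only [mem_union, mem_image, mem_range]
      rcases le_total 0 z with h | h
      · exact Or.inl ⟨z.toNat, by omega, by omega⟩
      · exact Or.inr ⟨(-z).toNat, by omega, by omega⟩
    have hgeom : ∑ n ∈ range (2 * N + 1), Real.exp (-(n : ℝ) ^ 2) ≤ 2 := by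
      refine le_trans (sum_le_sum fun n _ => ?_) (sum_geometric_two_le (2 * N + 1))
      have h1 : (n : ℝ) ≤ (n : ℝ) ^ 2 := by exact_mod_cast Nat.le_self_pow two_ne_zero n
      have h2 : Real.exp (-1) ≤ 1 / 2 := by
        rw [Real.exp_neg, one_div]
        exact inv_anti₀ (by norm_num) (by linarith [Real.add_one_le_exp (1 : ℝ)])
      calc Real.exp (-(n : ℝ) ^ 2) ≤ Real.exp (n * (-1)) := Real.exp_le_exp.2 (by linarith)
        _ = Real.exp (-1) ^ n := Real.exp_nat_mul _ _
        _ ≤ _ := pow_le_pow_left₀ (Real.exp_pos _).le h2 n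
    refine (sum_le_sum_of_subset_of_nonneg hsub fun _ _ _ => (Real.exp_pos _).le).trans ?_
    have hu := sum_union_inter (s₁ := (range (2 * N + 1)).image (fun n : ℕ => (n : ℤ)))
      (s₂ := (range (2 * N + 1)).image (fun n : ℕ => -(n : ℤ)))
      (f := fun z : ℤ => Real.exp (-(z : ℝ) ^ 2))
    have h0 : 0 ≤ ∑ z ∈ ((range (2 * N + 1)).image (fun n : ℕ => (n : ℤ))) ∩
      ((range (2 * N + 1)).image (fun n : ℕ => -(n : ℤ))), Real.exp (-(z : ℝ) ^ 2) :=
      sum_nonneg fun _ _ => (Real.exp_pos _).le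
    rw [sum_image (by intro a _ b _ h; simpa using h),
      sum_image (by intro a _ b _ h; simpa using h)] at hu
    push_cast at hu
    simp only [neg_sq] at hu
    linarith
  have h1 : ((intBall N).card : ℝ) ≤
      ∑ z ∈ Fintype.piFinset fun _ : Fin N => Icc (-(2 * N : ℤ)) (2 * N),
        Real.exp (4 * N) * ∏ i, Real.exp (-(z i : ℝ) ^ 2) := by
    rw [card_eq_sum_ones, Nat.cast_sum]
    refine le_trans (sum_le_sum fun z hz => ?_)
      (sum_le_sum_of_subset_of_nonneg (filter_subset _ _) fun _ _ _ => by positivity)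
    have hz2 := (mem_filter.1 hz).2
    have hz3 : ∑ i, (z i : ℝ) ^ 2 ≤ 4 * N := by exact_mod_cast hz2
    rw [← Real.exp_sum, ← Real.exp_add, Nat.cast_one, Real.one_le_exp_iff, sum_neg_distrib]
    linarith
  have h2 : ∑ z ∈ Fintype.piFinset fun _ : Fin N => Icc (-(2 * N : ℤ)) (2 * N),
      ∏ i, Real.exp (-(z i : ℝ) ^ 2) =
      ∏ _i : Fin N, ∑ z ∈ Icc (-(2 * N : ℤ)) (2 * N), Real.exp (-(z : ℝ) ^ 2) :=
    (prod_univ_sum (fun _ : Fin N => Icc (-(2 * N : ℤ)) (2 * N))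
      fun _ (z : ℤ) => Real.exp (-(z : ℝ) ^ 2)).symm
  rw [← mul_sum, h2, prod_const, card_univ, Fintype.card_fin] at h1
  refine h1.trans ?_
  have h4 : (4 : ℝ) ≤ Real.exp 2 := by
    have := Real.add_one_le_exp (1 : ℝ)
    have h : Real.exp 2 = Real.exp 1 * Real.exp 1 := by rw [← Real.exp_add]; norm_num
    rw [h]; nlinarith
  calc _ ≤ Real.exp (4 * N) * Real.exp 2 ^ N := by
        refine mul_le_mul_of_nonneg_left ?_ (Real.exp_pos _).le
        exact pow_le_pow_left₀ (sum_nonneg fun _ _ => (Real.exp_pos _).le) (hsum.trans h4) N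
    _ = _ := by rw [← Real.exp_nat_mul, ← Real.exp_add]; congr 1; ring

theorem measurable_quadForm (x : Fin N → ℝ) :
    Measurable fun g : Fin N → Fin N → ℝ => quadForm g x := by
  unfold quadForm
  refine Finset.measurable_sum _ fun i _ => Finset.measurable_sum _ fun j _ => ?_
  split_ifs
  · fun_prop
  · fun_prop

theorem measurableSet_netBad (b : ℝ) (N : ℕ) : MeasurableSet (netBad b N) := by
  have : netBad b N = ⋃ z ∈ intBall N,
      {g | (N : ℝ) / 16 < |b * quadForm g fun i => (z i : ℝ)|} := by
    ext g; simp [netBad]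
  rw [this]
  exact Finset.measurableSet_biUnion _ fun z _ =>
    measurableSet_lt measurable_const ((measurable_quadForm _).const_mul b).abs

theorem measureReal_netBad_le (b : ℝ) (hN : 1 ≤ N) (hb : b ^ 2 * N ≤ 1 / 65536) :
    (gaussN N).real (netBad b N) ≤ 2 * Real.exp (-N) := by
  have hNr : (1 : ℝ) ≤ N := by exact_mod_cast hN
  set F : (Fin N → Fin N → ℝ) → ℝ := fun g => ∑ z ∈ intBall N, Real.exp (-(16 * N)) *
    (Real.exp ((256 * b) * quadForm g fun i => (z i : ℝ)) +
      Real.exp ((-(256 * b)) * quadForm g fun i => (z i : ℝ))) with hF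
  have hFi : Integrable F (gaussN N) := integrable_finsetSum _ fun z _ =>
    ((integrable_exp_quadForm _ _).add (integrable_exp_quadForm _ _)).const_mul _
  have hz : ∀ z ∈ intBall N, ∀ r : ℝ, r ^ 2 = (256 * b) ^ 2 →
      ∫ g, Real.exp (r * quadForm g fun i => (z i : ℝ)) ∂gaussN N ≤ Real.exp (8 * N) := by
    intro z hz r hr
    refine (integral_exp_quadForm_le _ _).trans (Real.exp_le_exp.2 ?_)
    have hz2 : ∑ i, (z i : ℝ) ^ 2 ≤ 4 * N := by exact_mod_cast (mem_filter.1 hz).2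
    have hz0 : 0 ≤ ∑ i, (z i : ℝ) ^ 2 := sum_nonneg fun _ _ => sq_nonneg _
    have h3 : (∑ i, (z i : ℝ) ^ 2) ^ 2 ≤ 16 * N * N := by nlinarith
    rw [hr]
    have h4 : (256 * b) ^ 2 * (∑ i, (z i : ℝ) ^ 2) ^ 2 ≤ (256 * b) ^ 2 * (16 * N * N) := by gcongr
    nlinarith
  have hint : ∫ g, F g ∂gaussN N ≤ 2 * Real.exp (-N) := by
    have hi : ∀ z : Fin N → ℤ, Integrable (fun g => Real.exp (-(16 * N)) *
        (Real.exp ((256 * b) * quadForm g fun i => (z i : ℝ)) +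
          Real.exp ((-(256 * b)) * quadForm g fun i => (z i : ℝ)))) (gaussN N) := fun z =>
      ((integrable_exp_quadForm _ _).add (integrable_exp_quadForm _ _)).const_mul _
    rw [hF, integral_finsetSum _ fun z _ => hi z]
    calc _ ≤ ∑ z ∈ intBall N, Real.exp (-(16 * N)) * (2 * Real.exp (8 * N)) := by
          refine sum_le_sum fun z hzm => ?_
          rw [integral_const_mul, integral_add (integrable_exp_quadForm _ _)
            (integrable_exp_quadForm _ _)]
          refine mul_le_mul_of_nonneg_left ?_ (Real.exp_pos _).le
          linarith [hz z hzm (256 * b) rfl, hz z hzm (-(256 * b)) (by ring)]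
      _ = (intBall N).card * (2 * (Real.exp (-(16 * N)) * Real.exp (8 * N))) := by
          rw [sum_const, nsmul_eq_mul]; ring
      _ ≤ Real.exp (6 * N) * (2 * (Real.exp (-(16 * N)) * Real.exp (8 * N))) := by
          gcongr; exact card_intBall_le N
      _ = 2 * Real.exp (-(2 * N)) := by
          rw [← Real.exp_add, mul_left_comm, ← Real.exp_add]; congr 2; ring
      _ ≤ _ := by gcongr; linarith
  refine le_trans ?_ hint
  rw [← integral_indicator_one (measurableSet_netBad b N)]
  refine integral_mono ((integrable_const (1 : ℝ)).indicator (measurableSet_netBad b N)) hFi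
    fun g => ?_
  have hterm : ∀ z : Fin N → ℤ, 0 ≤ Real.exp (-(16 * N)) *
    (Real.exp ((256 * b) * quadForm g fun i => (z i : ℝ)) +
      Real.exp ((-(256 * b)) * quadForm g fun i => (z i : ℝ))) := fun z => by positivity
  by_cases hg : g ∈ netBad b N
  · rw [Set.indicator_of_mem hg]
    obtain ⟨z, hzm, hzq⟩ := hg
    refine le_trans ?_ (single_le_sum (fun z _ => hterm z) hzm)
    rw [mul_add, ← Real.exp_add, ← Real.exp_add]
    simp only [Pi.one_apply]
    rcases abs_cases (b * quadForm g fun i => (z i : ℝ)) with ⟨h, -⟩ | ⟨h, -⟩ <;> rw [h] at hzq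
    · have := Real.one_le_exp (x := -(16 * N) + 256 * b * quadForm g fun i => (z i : ℝ))
        (by linarith)
      linarith [Real.exp_pos (-(16 * N) + -(256 * b) * quadForm g fun i => (z i : ℝ))]
    · have := Real.one_le_exp (x := -(16 * N) + -(256 * b) * quadForm g fun i => (z i : ℝ))
        (by linarith)
      linarith [Real.exp_pos (-(16 * N) + 256 * b * quadForm g fun i => (z i : ℝ))]
  · rw [Set.indicator_of_notMem hg]
    exact sum_nonneg fun z _ => hterm z

open Classical in
/-- The random radius controlling the fluctuations of linear observables. -/
def radius (b : ℝ) (g : Fin N → Fin N → ℝ) : ℝ :=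
  if g ∈ netBad b N then 2 * Real.sqrt N else 1

theorem measurable_radius (b : ℝ) : Measurable (radius b : (Fin N → Fin N → ℝ) → ℝ) := by
  classical
  exact Measurable.ite (measurableSet_netBad b N) measurable_const measurable_const

theorem one_le_radius (b : ℝ) (hN : 1 ≤ N) (g : Fin N → Fin N → ℝ) : 1 ≤ radius b g := by
  have : (1 : ℝ) ≤ Real.sqrt N := Real.one_le_sqrt.2 (by exact_mod_cast hN)
  unfold radius
  split_ifs <;> linarith

theorem radius_le (b : ℝ) (hN : 1 ≤ N) (g : Fin N → Fin N → ℝ) :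
    radius b g ≤ 2 * Real.sqrt N := by
  have : (1 : ℝ) ≤ Real.sqrt N := Real.one_le_sqrt.2 (by exact_mod_cast hN)
  unfold radius
  split_ifs <;> linarith

theorem radBound_radius (b : ℝ) (hN : 1 ≤ N) (g : Fin N → Fin N → ℝ) (A : Finset (Fin N)) :
    RadBound (pairEnergy b A g) (radius b g) := by
  by_cases hg : g ∈ netBad b N
  · refine Or.inr ⟨one_le_radius b hN g, ?_⟩
    rw [radius, if_pos hg, mul_pow, Real.sq_sqrt (Nat.cast_nonneg N)]; norm_num
  · rw [radius, if_neg hg]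
    exact radBound_one_of_not_netBad b hN hg A

theorem integrable_radius_pow (b : ℝ) (hN : 1 ≤ N) (p : ℕ) :
    Integrable (fun g => radius b g ^ p) (gaussN N) := by
  refine Integrable.of_bound ((measurable_radius b).pow_const p).aestronglyMeasurable
    ((2 * Real.sqrt N) ^ p) (Filter.Eventually.of_forall fun g => ?_)
  have := one_le_radius b hN g
  rw [Real.norm_eq_abs, abs_of_nonneg (by positivity)]
  exact pow_le_pow_left₀ (by linarith) (radius_le b hN g) p

theorem integral_radius_pow_le (p : ℕ) :
    ∃ K : ℝ, 0 ≤ K ∧ ∀ (N : ℕ) (b : ℝ), 1 ≤ N → b ^ 2 * N ≤ 1 / 65536 →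
      ∫ g, radius b g ^ p ∂gaussN N ≤ K := by
  refine ⟨1 + 2 ^ p * (2 * p.factorial), by positivity, fun N b hN hb => ?_⟩
  have hNr : (1 : ℝ) ≤ N := by exact_mod_cast hN
  have hpt : ∀ g, radius b g ^ p ≤
      1 + (2 * Real.sqrt N) ^ p * (netBad b N).indicator (fun _ => (1 : ℝ)) g := fun g => by
    by_cases hg : g ∈ netBad b N
    · rw [Set.indicator_of_mem hg, radius, if_pos hg]; linarith
    · rw [Set.indicator_of_notMem hg, radius, if_neg hg]; simp
  have hind : Integrable ((netBad b N).indicator (fun _ => (1 : ℝ))) (gaussN N) :=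
    (integrable_const (1 : ℝ)).indicator (measurableSet_netBad b N)
  refine (integral_mono (integrable_radius_pow b hN p)
    ((integrable_const 1).add (hind.const_mul _)) hpt).trans ?_
  have hadd := integral_add (μ := gaussN N) (integrable_const (1 : ℝ))
    (hind.const_mul ((2 * Real.sqrt N) ^ p))
  have h1 : ∫ g, (netBad b N).indicator (fun _ => (1 : ℝ)) g ∂gaussN N =
      (gaussN N).real (netBad b N) := integral_indicator_one (measurableSet_netBad b N)
  rw [integral_const_mul, h1] at hadd
  refine hadd.le.trans ?_
  simp only [integral_const, probReal_univ, smul_eq_mul, mul_one]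
  have h2 := measureReal_netBad_le b hN hb
  have hs : Real.sqrt N ≤ N := by
    rw [Real.sqrt_le_left (by linarith)]; nlinarith
  have h3 : (N : ℝ) ^ p * Real.exp (-N) ≤ p.factorial := by
    have := Real.pow_div_factorial_le_exp (N : ℝ) (by linarith) p
    rw [div_le_iff₀ (by positivity)] at this
    rw [Real.exp_neg, ← div_eq_mul_inv, div_le_iff₀ (Real.exp_pos _), mul_comm]
    exact this
  have h4 : (2 * Real.sqrt N) ^ p ≤ 2 ^ p * (N : ℝ) ^ p := by
    rw [mul_pow]; gcongr
  calc _ ≤ 1 + (2 ^ p * (N : ℝ) ^ p) * (2 * Real.exp (-N)) := by gcongr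
    _ = 1 + 2 ^ p * (2 * ((N : ℝ) ^ p * Real.exp (-N))) := by ring
    _ ≤ _ := by gcongr

end NetProbability

section GaussianVectors

open Real (pi)

variable {N : ℕ}

/-- The standard Gaussian measure on `ℝ^N`. -/
def gaussVec (N : ℕ) : Measure (Fin N → ℝ) := Measure.pi fun _ => gaussianReal 0 1

instance : IsProbabilityMeasure (gaussVec N) := by unfold gaussVec; infer_instance

theorem measurePreserving_rotation (θ : ℝ) :
    MeasurePreserving
      (fun p : (Fin N → ℝ) × (Fin N → ℝ) =>
        ((fun i => Real.cos θ * p.1 i + Real.sin θ * p.2 i : Fin N → ℝ),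
          (fun i => -Real.sin θ * p.1 i + Real.cos θ * p.2 i : Fin N → ℝ)))
      ((gaussVec N).prod (gaussVec N)) ((gaussVec N).prod (gaussVec N)) := by
  have h1 : MeasurePreserving (fun p : ℝ × ℝ => (Real.cos θ * p.1 + Real.sin θ * p.2,
      -Real.sin θ * p.1 + Real.cos θ * p.2)) ((gaussianReal 0 1).prod (gaussianReal 0 1))
      ((gaussianReal 0 1).prod (gaussianReal 0 1)) := by
    refine ⟨by fun_prop, ?_⟩
    have := IsGaussian.map_rotation_eq_self (μ := gaussianReal 0 1) (by simp) θ
    convert! this using 2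
  have h2 := measurePreserving_pi (fun _ : Fin N => (gaussianReal 0 1).prod (gaussianReal 0 1))
    (fun _ : Fin N => (gaussianReal 0 1).prod (gaussianReal 0 1)) fun _ => h1
  have h3 := measurePreserving_arrowProdEquivProdArrow ℝ ℝ (Fin N)
    (fun _ => gaussianReal 0 1) (fun _ => gaussianReal 0 1)
  exact (h3.comp h2).comp (h3.symm _)

theorem integrable_exp_gaussVec (c : Fin N → ℝ) :
    Integrable (fun z => Real.exp (∑ i, c i * z i)) (gaussVec N) := by
  simp only [Real.exp_sum]
  unfold gaussVec
  exact Integrable.fintype_prod fun i => integrable_exp_mul_gaussianReal (c i)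

theorem integral_exp_gaussVec (c : Fin N → ℝ) :
    ∫ z, Real.exp (∑ i, c i * z i) ∂gaussVec N = Real.exp ((∑ i, c i ^ 2) / 2) := by
  simp only [Real.exp_sum, sum_div]
  unfold gaussVec
  rw [integral_fintype_prod_eq_prod (fun j (x : ℝ) => Real.exp (c j * x))]
  refine prod_congr rfl fun j _ => ?_
  have := mgf_gaussianReal (μ := 0) (v := 1) (X := id) (p := gaussianReal 0 1)
    Measure.map_id (c j)
  simpa [mgf] using this

theorem lintegral_linear_pow_le (a : Fin N → ℝ) (q : ℕ) :
    ∫⁻ z, ENNReal.ofReal ((∑ i, a i * z i) ^ (2 * q)) ∂gaussVec N ≤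
      ENNReal.ofReal (4 * (2 * q).factorial * (∑ i, a i ^ 2) ^ q) := by
  set S := ∑ i, a i ^ 2 with hS
  have hS0 : 0 ≤ S := sum_nonneg fun i _ => sq_nonneg (a i)
  rcases hS0.eq_or_lt with h0 | h0
  · have ha : ∀ i, a i = 0 := fun i => by
      have := (sum_eq_zero_iff_of_nonneg fun i _ => sq_nonneg (a i)).1 h0.symm i (mem_univ i)
      simpa using this
    rcases Nat.eq_zero_or_pos q with rfl | hq
    · simp
    · simp [ha, hq.ne']
  · set s := (Real.sqrt S)⁻¹ with hs
    have hs0 : 0 < s := by positivity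
    have hs2 : s ^ 2 * S = 1 := by
      rw [hs, inv_pow, Real.sq_sqrt hS0, inv_mul_cancel₀ h0.ne']
    have hpt : ∀ z : Fin N → ℝ, (∑ i, a i * z i) ^ (2 * q) ≤ (2 * q).factorial * S ^ q *
        (Real.exp (∑ i, (s * a i) * z i) + Real.exp (∑ i, (-s * a i) * z i)) := fun z => by
      have h := pow_two_mul_le_factorial_mul (s * ∑ i, a i * z i) q
      have e1 : (s * ∑ i, a i * z i) = ∑ i, (s * a i) * z i := by
        rw [mul_sum]; exact sum_congr rfl fun i _ => by ring
      have e2 : -(s * ∑ i, a i * z i) = ∑ i, (-s * a i) * z i := by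
        rw [mul_sum, ← sum_neg_distrib]; exact sum_congr rfl fun i _ => by ring
      rw [e2, mul_pow, e1] at h
      have h3 := mul_le_mul_of_nonneg_left h (pow_nonneg hS0 q)
      have e3 : S ^ q * (s ^ (2 * q) * (∑ i, a i * z i) ^ (2 * q)) =
          (∑ i, a i * z i) ^ (2 * q) := by
        rw [pow_mul s, ← mul_assoc, ← mul_pow, mul_comm S, hs2, one_pow, one_mul]
      rw [e3] at h3
      refine h3.trans (le_of_eq (by ring))
    have hi : Integrable (fun z : Fin N → ℝ => (2 * q).factorial * S ^ q *
        (Real.exp (∑ i, (s * a i) * z i) + Real.exp (∑ i, (-s * a i) * z i))) (gaussVec N) :=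
      ((integrable_exp_gaussVec _).add (integrable_exp_gaussVec _)).const_mul _
    refine (lintegral_mono fun z => ENNReal.ofReal_le_ofReal (hpt z)).trans ?_
    rw [← ofReal_integral_eq_lintegral_ofReal hi (Filter.Eventually.of_forall fun z => by positivity)]
    refine ENNReal.ofReal_le_ofReal ?_
    rw [integral_const_mul, integral_add (integrable_exp_gaussVec _) (integrable_exp_gaussVec _),
      integral_exp_gaussVec, integral_exp_gaussVec]
    have e4 : ∑ i, (s * a i) ^ 2 = 1 := by simp only [mul_pow, ← mul_sum, ← hS, hs2]
    have e5 : ∑ i, (-s * a i) ^ 2 = 1 := by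
      simp only [mul_pow, ← mul_sum, ← hS, neg_sq, hs2]
    rw [e4, e5]
    have h6 : Real.exp (1 / 2) ≤ 2 := by
      have h7 : Real.exp (1 / 2) ^ 2 = Real.exp 1 := by rw [← Real.exp_nat_mul]; norm_num
      nlinarith [Real.exp_one_lt_d9, Real.exp_pos (1 / 2)]
    have h8 : (0 : ℝ) ≤ (2 * q).factorial * S ^ q := by positivity
    nlinarith

theorem integral_pow_le_of_continuous {f : ℝ → ℝ} (hf : Continuous f) (q : ℕ) :
    (∫ θ in Set.Ioc (0 : ℝ) 1, f θ) ^ (2 * q) ≤ ∫ θ in Set.Ioc (0 : ℝ) 1, f θ ^ (2 * q) := by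
  have : IsProbabilityMeasure (volume.restrict (Set.Ioc (0 : ℝ) 1)) := ⟨by simp⟩
  refine ConvexOn.map_integral_le (g := fun x : ℝ => x ^ (2 * q)) (even_two_mul q).convexOn_pow
    (continuous_pow _).continuousOn isClosed_univ (by simp) ?_ ?_
  · exact (hf.integrableOn_Icc).mono_set Set.Ioc_subset_Icc_self
  · exact ((hf.pow _).integrableOn_Icc).mono_set Set.Ioc_subset_Icc_self

set_option maxHeartbeats 800000 in
/-- A Gaussian Poincaré inequality of arbitrary even order for odd parts. -/
theorem lintegral_sub_neg_pow_le (F : (Fin N → ℝ) → ℝ) (hF : ContDiff ℝ 1 F) (q : ℕ) :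
    ∫⁻ z, ENNReal.ofReal ((F z - F fun i => -z i) ^ (2 * q)) ∂gaussVec N ≤
      ENNReal.ofReal (Real.pi ^ (2 * q) * (4 * (2 * q).factorial)) *
        ∫⁻ z, ENNReal.ofReal ((∑ i, fderiv ℝ F z (Pi.single i 1) ^ 2) ^ q) ∂gaussVec N := by
  set rot : ℝ → (Fin N → ℝ) × (Fin N → ℝ) → (Fin N → ℝ) := fun θ p i =>
    Real.cos θ * p.1 i + Real.sin θ * p.2 i with hrot
  set rot' : ℝ → (Fin N → ℝ) × (Fin N → ℝ) → (Fin N → ℝ) := fun θ p i =>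
    -Real.sin θ * p.1 i + Real.cos θ * p.2 i with hrot'
  set D : (Fin N → ℝ) × (Fin N → ℝ) → ℝ := fun p => fderiv ℝ F p.1 p.2 with hD
  have hDc : Continuous D :=
    ((hF.continuous_fderiv (by simp)).comp continuous_fst).clm_apply continuous_snd
  have hc1 : Continuous fun x : ((Fin N → ℝ) × (Fin N → ℝ)) × ℝ =>
      D (rot (Real.pi * x.2) x.1, rot' (Real.pi * x.2) x.1) := by
    refine hDc.comp (Continuous.prodMk ?_ ?_) <;> exact continuous_pi fun i => by fun_prop
  have hderiv : ∀ p θ, HasDerivAt (fun θ : ℝ => F (rot (Real.pi * θ) p))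
      (Real.pi * D (rot (Real.pi * θ) p, rot' (Real.pi * θ) p)) θ := by
    intro p θ
    have h1 : HasDerivAt (fun θ : ℝ => rot (Real.pi * θ) p)
        (Real.pi • rot' (Real.pi * θ) p) θ := by
      rw [hasDerivAt_pi]
      intro i
      have h0 : HasDerivAt (fun θ : ℝ => Real.pi * θ) Real.pi θ := by
        simpa using (hasDerivAt_id θ).const_mul Real.pi
      refine ((h0.cos.mul_const (p.1 i)).add (h0.sin.mul_const (p.2 i))).congr_deriv ?_
      simp only [hrot', Pi.smul_apply, smul_eq_mul]; ring
    refine (((hF.differentiable (by simp) _).hasFDerivAt).comp_hasDerivAt θ h1).congr_deriv ?_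
    simp [hD]
  have hcp : ∀ p, Continuous fun θ : ℝ => D (rot (Real.pi * θ) p, rot' (Real.pi * θ) p) :=
    fun p => hc1.comp (f := fun θ : ℝ => (p, θ)) (by fun_prop)
  have hftc : ∀ p : (Fin N → ℝ) × (Fin N → ℝ), (F p.1 - F fun i => -p.1 i) ^ (2 * q) ≤
      Real.pi ^ (2 * q) * ∫ θ in Set.Ioc (0 : ℝ) 1,
        D (rot (Real.pi * θ) p, rot' (Real.pi * θ) p) ^ (2 * q) := by
    intro p
    have h1 := intervalIntegral.integral_eq_sub_of_hasDerivAt (a := 0) (b := 1)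
      (fun θ _ => hderiv p θ) (((hcp p).const_mul _).intervalIntegrable 0 1)
    have e0 : rot (Real.pi * 0) p = p.1 := by ext i; simp [hrot]
    have e1 : rot (Real.pi * 1) p = fun i => -p.1 i := by ext i; simp [hrot]
    rw [e0, e1, intervalIntegral.integral_const_mul,
      intervalIntegral.integral_of_le zero_le_one] at h1
    have hneg : F p.1 - (F fun i => -p.1 i) = -((F fun i => -p.1 i) - F p.1) := by ring
    rw [hneg, (even_two_mul q).neg_pow, ← h1, mul_pow]
    refine mul_le_mul_of_nonneg_left ?_ (by positivity)
    exact integral_pow_le_of_continuous (hcp p) q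
  have hmeas : Measurable fun x : ((Fin N → ℝ) × (Fin N → ℝ)) × ℝ => ENNReal.ofReal
      (D (rot (Real.pi * x.2) x.1, rot' (Real.pi * x.2) x.1) ^ (2 * q)) :=
    (hc1.pow _).measurable.ennreal_ofReal
  have hDm : Measurable fun p => ENNReal.ofReal (D p ^ (2 * q)) :=
    (hDc.pow _).measurable.ennreal_ofReal
  have hfst : ∫⁻ z, ENNReal.ofReal ((F z - F fun i => -z i) ^ (2 * q)) ∂gaussVec N =
      ∫⁻ p, ENNReal.ofReal ((F p.1 - F fun i => -p.1 i) ^ (2 * q))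
        ∂(gaussVec N).prod (gaussVec N) := by
    have hm : Measurable fun z : Fin N → ℝ => ENNReal.ofReal ((F z - F fun i => -z i) ^ (2 * q)) := by
      refine (Continuous.measurable ?_).ennreal_ofReal
      exact ((hF.continuous).sub (hF.continuous.comp (by fun_prop))).pow _
    exact (measurePreserving_fst.lintegral_comp hm).symm
  rw [hfst]
  calc _ ≤ ∫⁻ p, ENNReal.ofReal (Real.pi ^ (2 * q)) * (∫⁻ θ in Set.Ioc (0 : ℝ) 1,
        ENNReal.ofReal (D (rot (Real.pi * θ) p, rot' (Real.pi * θ) p) ^ (2 * q)))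
          ∂(gaussVec N).prod (gaussVec N) := by
        refine lintegral_mono fun p => ?_
        refine (ENNReal.ofReal_le_ofReal (hftc p)).trans (le_of_eq ?_)
        rw [ENNReal.ofReal_mul (by positivity)]
        congr 1
        exact ofReal_integral_eq_lintegral_ofReal
          ((((hcp p).pow _).integrableOn_Icc).mono_set Set.Ioc_subset_Icc_self)
          (Filter.Eventually.of_forall fun θ => (even_two_mul q).pow_nonneg _)
    _ = ENNReal.ofReal (Real.pi ^ (2 * q)) * ∫⁻ θ in Set.Ioc (0 : ℝ) 1, ∫⁻ p,
        ENNReal.ofReal (D (rot (Real.pi * θ) p, rot' (Real.pi * θ) p) ^ (2 * q))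
          ∂(gaussVec N).prod (gaussVec N) := by
        rw [lintegral_const_mul _ hmeas.lintegral_prod_right']
        congr 1
        exact lintegral_lintegral_swap hmeas.aemeasurable
    _ = ENNReal.ofReal (Real.pi ^ (2 * q)) *
        ∫⁻ p, ENNReal.ofReal (D p ^ (2 * q)) ∂(gaussVec N).prod (gaussVec N) := by
        have : ∀ θ, ∫⁻ p, ENNReal.ofReal (D (rot (Real.pi * θ) p, rot' (Real.pi * θ) p) ^ (2 * q))
            ∂(gaussVec N).prod (gaussVec N) =
            ∫⁻ p, ENNReal.ofReal (D p ^ (2 * q)) ∂(gaussVec N).prod (gaussVec N) := fun θ =>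
          (measurePreserving_rotation (Real.pi * θ)).lintegral_comp hDm
        simp [this]
    _ ≤ ENNReal.ofReal (Real.pi ^ (2 * q)) * ∫⁻ z, ENNReal.ofReal (4 * (2 * q).factorial *
        (∑ i, fderiv ℝ F z (Pi.single i 1) ^ 2) ^ q) ∂gaussVec N := by
        gcongr
        rw [lintegral_prod _ hDm.aemeasurable]
        refine lintegral_mono fun z => ?_
        refine le_trans (le_of_eq ?_)
          (lintegral_linear_pow_le (fun i => fderiv ℝ F z (Pi.single i 1)) q)
        refine lintegral_congr fun w => ?_
        congr 2
        have : w = ∑ i, w i • (Pi.single i 1 : Fin N → ℝ) := by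
          ext j; simp [Finset.sum_apply, Pi.single_apply]
        simp only [hD]
        conv_lhs => rw [this]
        rw [map_sum]
        exact sum_congr rfl fun i _ => by rw [map_smul, smul_eq_mul, mul_comm]
    _ = _ := by
        have hg : Measurable fun z => ENNReal.ofReal
            ((∑ i, fderiv ℝ F z (Pi.single i 1) ^ 2) ^ q) := by
          refine (Continuous.measurable ?_).ennreal_ofReal
          refine (continuous_finsetSum _ fun i _ => ?_).pow _
          exact ((hF.continuous_fderiv (by simp)).clm_apply continuous_const).pow _
        have h1 : ∀ z, ENNReal.ofReal (4 * (2 * q).factorial *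
            (∑ i, fderiv ℝ F z (Pi.single i 1) ^ 2) ^ q) = ENNReal.ofReal (4 * (2 * q).factorial) *
            ENNReal.ofReal ((∑ i, fderiv ℝ F z (Pi.single i 1) ^ 2) ^ q) := fun z =>
          ENNReal.ofReal_mul (by positivity)
        simp only [h1]
        rw [lintegral_const_mul _ hg, ← mul_assoc, ENNReal.ofReal_mul (p := Real.pi ^ (2 * q)) (by positivity)]

end GaussianVectors

section Resampling

variable {N : ℕ}

/-- The couplings of the site `i`. -/
def rowOf (i : Fin N) (g : Fin N → Fin N → ℝ) : Fin N → ℝ := fun j =>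
  if i < j then g i j else g j i

/-- Replace the couplings of the site `i`. -/
def resample (i : Fin N) (p : (Fin N → Fin N → ℝ) × (Fin N → ℝ)) : Fin N → Fin N → ℝ :=
  fun a b => if a = i ∧ i < b then p.2 b else if b = i ∧ a ≤ i then p.2 a else p.1 a b

theorem rowOf_resample (i : Fin N) (p : (Fin N → Fin N → ℝ) × (Fin N → ℝ)) :
    rowOf i (resample i p) = p.2 := by
  ext j
  unfold rowOf resample
  split_ifs with h1 h2 h3 h4 <;> try rfl
  · exact absurd ⟨rfl, h1⟩ h2
  · omega
  · simp_all
  · simp_all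

theorem pairEnergy_resample (b : ℝ) {i : Fin N} {A : Finset (Fin N)} (hi : i ∉ A)
    (p : (Fin N → Fin N → ℝ) × (Fin N → ℝ)) :
    pairEnergy b A (resample i p) = pairEnergy b A p.1 := by
  ext σ
  unfold pairEnergy quadForm
  congr 1
  refine sum_congr rfl fun a _ => sum_congr rfl fun c _ => ?_
  by_cases ha : a = i
  · subst ha; simp [hi]
  by_cases hc : c = i
  · subst hc; simp [hi]
  simp [resample, ha, hc]

theorem measurable_resample (i : Fin N) : Measurable (resample i) := by
  refine measurable_pi_lambda _ fun a => measurable_pi_lambda _ fun c => ?_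
  unfold resample
  split_ifs <;> fun_prop

theorem prod_resample (i : Fin N) (f : Fin N → Fin N → ENNReal) :
    (∏ a, ∏ c, if (a = i ∧ i < c) ∨ (c = i ∧ a ≤ i) then 1 else f a c) *
      ∏ c, (if i < c then f i c else f c i) = ∏ a, ∏ c, f a c := by
  have h : ∀ a c, f a c = (if (a = i ∧ i < c) ∨ (c = i ∧ a ≤ i) then 1 else f a c) *
      ((if a = i then (if i < c then f i c else 1) else 1) *
        (if c = i then (if a ≤ i then f a i else 1) else 1)) := by
    intro a c
    by_cases h1 : a = i
    · subst h1
      by_cases h2 : c = a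
      · subst h2; simp
      · by_cases h3 : a < c <;> simp [h2, h3]
    · by_cases h2 : c = i
      · subst h2
        by_cases h3 : a ≤ c <;> simp [h1, h3]
      · simp [h1, h2]
  rw [prod_congr rfl fun a _ => prod_congr rfl fun c _ => h a c]
  simp only [prod_mul_distrib]
  congr 1
  have e1 : ∏ a, ∏ c, (if a = i then (if i < c then f i c else 1) else 1) =
      ∏ c, if i < c then f i c else 1 := by
    rw [prod_comm]; simp
  have e2 : ∏ a, ∏ c, (if c = i then (if a ≤ i then f a i else 1) else 1) =
      ∏ a, if a ≤ i then f a i else 1 := by simp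
  rw [e1, e2, ← prod_mul_distrib]
  refine prod_congr rfl fun c _ => ?_
  by_cases h : i < c
  · simp [h, not_le.2 h]
  · simp [h, not_lt.1 h]

theorem measurePreserving_resample (i : Fin N) :
    MeasurePreserving (resample i) ((gaussN N).prod (gaussVec N)) (gaussN N) := by
  refine ⟨measurable_resample i, ?_⟩
  conv_rhs => unfold gaussN
  refine (Measure.pi_eq_generateFrom (C := fun _ => Set.pi Set.univ ''
    Set.pi Set.univ fun _ : Fin N => {s : Set ℝ | MeasurableSet s}) (fun _ => generateFrom_pi)
    (fun _ => isPiSystem_pi) (fun _ => ⟨fun _ => Set.univ, fun _ => ⟨fun _ => Set.univ,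
      fun _ _ => by simp, Set.pi_univ _⟩, fun _ => measure_lt_top _ _,
      Set.iUnion_const _⟩) fun s hs => ?_).symm
  choose! u hu1 hu2 using hs
  have hu : ∀ a c, MeasurableSet (u a c) := fun a c => hu1 a c (Set.mem_univ c)
  have hs' : s = fun a => Set.pi Set.univ (u a) := funext fun a => (hu2 a).symm
  subst hs'
  rw [Measure.map_apply (measurable_resample i) (MeasurableSet.univ_pi fun a =>
    MeasurableSet.univ_pi (hu a))]
  have hpre : resample i ⁻¹' Set.pi Set.univ (fun a => Set.pi Set.univ (u a)) =
      (Set.pi Set.univ fun a => Set.pi Set.univ fun c =>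
        if (a = i ∧ i < c) ∨ (c = i ∧ a ≤ i) then Set.univ else u a c) ×ˢ
      (Set.pi Set.univ fun c => if i < c then u i c else u c i) := by
    ext ⟨g, z⟩
    simp only [Set.mem_preimage, Set.mem_pi, Set.mem_univ, true_imp_iff, Set.mem_prod]
    constructor
    · refine fun h => ⟨fun a c => ?_, fun c => ?_⟩
      · have := h a c
        split_ifs with h1
        · trivial
        · rw [not_or] at h1
          simpa [resample, h1.1, h1.2] using this
      · split_ifs with h1
        · simpa [resample, h1] using h i c
        · have := h c i
          simpa [resample, not_lt.1 h1] using this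
    · rintro ⟨h1, h2⟩ a c
      unfold resample
      split_ifs with h3 h4
      · obtain ⟨rfl, h5⟩ := h3
        simpa [h5] using h2 c
      · obtain ⟨rfl, h5⟩ := h4
        simpa [not_lt.2 h5] using h2 a
      · have := h1 a c
        rwa [if_neg (not_or.2 ⟨h3, h4⟩)] at this
  rw [hpre, Measure.prod_prod]
  unfold gaussN gaussVec
  simp only [Measure.pi_pi]
  rw [← prod_resample i fun a c => gaussianReal 0 1 (u a c)]
  congr 1
  · refine prod_congr rfl fun a _ => prod_congr rfl fun c _ => ?_
    split_ifs <;> simp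
  · refine prod_congr rfl fun c _ => ?_
    split_ifs <;> rfl

/-- Averaging over the couplings of a site that is decoupled from `A`. -/
theorem lintegral_resample (b : ℝ) {i : Fin N} {A : Finset (Fin N)} (hi : i ∉ A)
    {Ψ : (Cfg N → ℝ) → (Fin N → ℝ) → ENNReal} (hΨ : Measurable fun p : (Cfg N → ℝ) × (Fin N → ℝ) =>
      Ψ p.1 p.2) :
    ∫⁻ g, Ψ (pairEnergy b A g) (rowOf i g) ∂gaussN N =
      ∫⁻ g, ∫⁻ z, Ψ (pairEnergy b A g) z ∂gaussVec N ∂gaussN N := by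
  have hE : Measurable (pairEnergy b A : (Fin N → Fin N → ℝ) → Cfg N → ℝ) :=
    measurable_pi_lambda _ fun σ => (measurable_quadForm _).const_mul b
  have hr : Measurable (rowOf i : (Fin N → Fin N → ℝ) → Fin N → ℝ) := by
    refine measurable_pi_lambda _ fun j => ?_
    unfold rowOf
    split_ifs <;> fun_prop
  have hm : Measurable fun g => Ψ (pairEnergy b A g) (rowOf i g) := hΨ.comp (hE.prodMk hr)
  rw [← (measurePreserving_resample i).lintegral_comp hm]
  simp only [pairEnergy_resample b hi, rowOf_resample]
  have hm2 : Measurable fun p : (Fin N → Fin N → ℝ) × (Fin N → ℝ) => Ψ (pairEnergy b A p.1) p.2 :=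
    hΨ.comp ((hE.comp measurable_fst).prodMk measurable_snd)
  exact lintegral_prod _ hm2.aemeasurable

end Resampling

section TanhComposition

theorem contDiff_tanh : ContDiff ℝ (⊤ : ℕ∞) Real.tanh := by
  have he : Real.tanh = fun x => Real.sinh x / Real.cosh x := funext Real.tanh_eq_sinh_div_cosh
  rw [he]
  exact Real.contDiff_sinh.div Real.contDiff_cosh fun x => (Real.cosh_pos x).ne'

theorem tanh_sq_le_one (x : ℝ) : Real.tanh x ^ 2 ≤ 1 := by
  rw [Real.tanh_eq_sinh_div_cosh, div_pow, div_le_one (by have := Real.cosh_pos x; positivity),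
    Real.cosh_sq]
  linarith

theorem abs_iteratedDeriv_one_sub_sq_le {M : ℝ → ℝ} (hM : ContDiff ℝ (⊤ : ℕ∞) M) {X : ℝ}
    (hX : 0 ≤ X) (h0 : |M 0| ≤ 1) {k : ℕ} (h : ∀ p, 1 ≤ p → p ≤ k → |iteratedDeriv p M 0| ≤ X)
    {l : ℕ} (hl : 1 ≤ l) (hlk : l ≤ k) :
    |iteratedDeriv l (fun u => 1 - M u ^ 2) 0| ≤ 2 ^ l * (X * (1 + X)) := by
  have hMl : ContDiffAt ℝ l M 0 := hM.contDiffAt.of_le (by exact_mod_cast le_top)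
  have hall : ∀ p ≤ k, |iteratedDeriv p M 0| ≤ 1 + X := fun p hp => by
    rcases Nat.eq_zero_or_pos p with rfl | hp0
    · simpa using h0.trans (by linarith)
    · exact (h p hp0 hp).trans (by linarith)
  have e1 : iteratedDeriv l (fun u => 1 - M u ^ 2) 0 = -∑ p ∈ range (l + 1),
      (l.choose p : ℝ) * iteratedDeriv p M 0 * iteratedDeriv (l - p) M 0 := by
    rw [iteratedDeriv_const_sub hl, iteratedDeriv_neg,
      show (fun u => M u ^ 2) = M * M from funext fun u => sq (M u), iteratedDeriv_mul hMl hMl]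
  have e2 : ((2 : ℝ) ^ l) = ∑ p ∈ range (l + 1), (l.choose p : ℝ) := by
    exact_mod_cast (Nat.sum_range_choose l).symm
  rw [e1, abs_neg, e2, sum_mul]
  refine (abs_sum_le_sum_abs _ _).trans (sum_le_sum fun p hp => ?_)
  rw [mem_range] at hp
  rw [mul_assoc, abs_mul, Nat.abs_cast, abs_mul]
  refine mul_le_mul_of_nonneg_left ?_ (by positivity)
  rcases Nat.eq_zero_or_pos p with rfl | hp0
  · rw [mul_comm]
    exact mul_le_mul (h _ (by omega) (by omega)) (hall _ (by omega)) (abs_nonneg _) hX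
  · exact mul_le_mul (h _ hp0 (by omega)) (hall _ (by omega)) (abs_nonneg _) hX

theorem iteratedDeriv_tanh_comp_succ {ϑ : ℝ → ℝ} (hϑ : ContDiff ℝ (⊤ : ℕ∞) ϑ) (k : ℕ) :
    iteratedDeriv (k + 1) (fun u => Real.tanh (ϑ u)) 0 = ∑ l ∈ range (k + 1),
      (k.choose l : ℝ) * iteratedDeriv l (fun u => 1 - Real.tanh (ϑ u) ^ 2) 0 *
        iteratedDeriv (k - l + 1) ϑ 0 := by
  have hd : deriv (fun u => Real.tanh (ϑ u)) = (fun u => 1 - Real.tanh (ϑ u) ^ 2) * deriv ϑ := by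
    funext u
    exact ((hasDerivAt_tanh (ϑ u)).comp u
      ((hϑ.differentiable (by simp) u).hasDerivAt)).deriv
  have h1 : ContDiff ℝ (⊤ : ℕ∞) fun u => 1 - Real.tanh (ϑ u) ^ 2 :=
    contDiff_const.sub ((contDiff_tanh.comp hϑ).pow 2)
  have h2 : ContDiff ℝ (⊤ : ℕ∞) (deriv ϑ) := (contDiff_infty_iff_deriv.1 hϑ).2
  rw [iteratedDeriv_succ', hd, iteratedDeriv_mul (h1.contDiffAt.of_le (by exact_mod_cast le_top))
    (h2.contDiffAt.of_le (by exact_mod_cast le_top))]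
  simp only [iteratedDeriv_succ']

theorem abs_iteratedDeriv_tanh_comp_succ_le {ϑ : ℝ → ℝ} (hϑ : ContDiff ℝ (⊤ : ℕ∞) ϑ) {k : ℕ}
    {a X : ℝ} (ha0 : 0 ≤ a) (hX : 0 ≤ X) (ha : ∀ j, 1 ≤ j → j ≤ k → |iteratedDeriv j ϑ 0| ≤ a)
    (h : ∀ p, 1 ≤ p → p ≤ k → |iteratedDeriv p (fun u => Real.tanh (ϑ u)) 0| ≤ X) :
    |iteratedDeriv (k + 1) (fun u => Real.tanh (ϑ u)) 0| ≤
      |iteratedDeriv (k + 1) ϑ 0| + 4 ^ k * (X * (1 + X)) * a := by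
  rw [iteratedDeriv_tanh_comp_succ hϑ, sum_range_succ']
  have hm : ContDiff ℝ (⊤ : ℕ∞) fun u => Real.tanh (ϑ u) := contDiff_tanh.comp hϑ
  have h0 : |Real.tanh (ϑ 0)| ≤ 1 := by
    rw [← sq_le_one_iff_abs_le_one]; exact tanh_sq_le_one _
  refine (abs_add_le _ _).trans ?_
  rw [add_comm]
  refine add_le_add ?_ ?_
  · simp only [Nat.choose_zero_right, Nat.cast_one, one_mul, iteratedDeriv_zero, Nat.sub_zero,
      abs_mul]
    refine mul_le_of_le_one_left (abs_nonneg _) ?_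
    rw [abs_of_nonneg (by linarith [tanh_sq_le_one (ϑ 0)])]
    linarith [sq_nonneg (Real.tanh (ϑ 0))]
  · have e2 : ((2 : ℝ) ^ k) = ∑ p ∈ range (k + 1), (k.choose p : ℝ) := by
      exact_mod_cast (Nat.sum_range_choose k).symm
    have e3 : ∑ l ∈ range k, (k.choose (l + 1) : ℝ) ≤ 2 ^ k := by
      rw [e2, sum_range_succ']; simp
    have hXX : 0 ≤ X * (1 + X) := by positivity
    calc _ ≤ ∑ l ∈ range k, (k.choose (l + 1) : ℝ) * (2 ^ k * (X * (1 + X)) * a) := by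
          refine (abs_sum_le_sum_abs _ _).trans (sum_le_sum fun l hl => ?_)
          rw [mem_range] at hl
          rw [mul_assoc, abs_mul, Nat.abs_cast, abs_mul]
          refine mul_le_mul_of_nonneg_left ?_ (by positivity)
          refine mul_le_mul ?_ (ha _ (by omega) (by omega)) (abs_nonneg _) (by positivity)
          refine (abs_iteratedDeriv_one_sub_sq_le hm hX h0 h (by omega) (by omega)).trans ?_
          refine mul_le_mul_of_nonneg_right ?_ hXX
          exact pow_le_pow_right₀ one_le_two (by omega)
      _ ≤ 2 ^ k * (2 ^ k * (X * (1 + X)) * a) := by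
          rw [← sum_mul]; gcongr
      _ = _ := by
          rw [show (4 : ℝ) = 2 * 2 by norm_num, mul_pow]; ring

theorem abs_iteratedDeriv_tanh_comp_le (k : ℕ) :
    ∃ (K : ℝ) (P : ℕ), 0 ≤ K ∧ ∀ (ϑ : ℝ → ℝ) (a : ℝ), ContDiff ℝ (⊤ : ℕ∞) ϑ → 0 ≤ a →
      (∀ j, 1 ≤ j → j ≤ k → |iteratedDeriv j ϑ 0| ≤ a) → ∀ j, 1 ≤ j → j ≤ k →
        |iteratedDeriv j (fun u => Real.tanh (ϑ u)) 0| ≤ K * a * (1 + a) ^ P := by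
  induction k with
  | zero => exact ⟨0, 0, le_rfl, fun _ _ _ _ _ j h1 h2 => by omega⟩
  | succ k ih =>
    obtain ⟨K, P, hK, hb⟩ := ih
    refine ⟨K + (1 + 4 ^ k * (K * (1 + K))), 2 * P + 2, by positivity,
      fun ϑ a hϑ ha0 ha j hj1 hj2 => ?_⟩
    have h1a : (1 : ℝ) ≤ 1 + a := by linarith
    have hbk := hb ϑ a hϑ ha0 fun j h1 h2 => ha j h1 (by omega)
    rcases Nat.lt_or_ge k j with h | h
    · obtain rfl : j = k + 1 := by omega
      refine (abs_iteratedDeriv_tanh_comp_succ_le hϑ ha0 (X := K * a * (1 + a) ^ P) (by positivity)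
        (fun j h1 h2 => ha j h1 (by omega)) hbk).trans ?_
      have h2 := ha (k + 1) hj1 hj2
      have h3 : (1 : ℝ) ≤ (1 + a) ^ (2 * P + 2) := one_le_pow₀ h1a
      have h4 : K * a * (1 + a) ^ P ≤ K * (1 + a) ^ (P + 1) := by
        rw [show K * (1 + a) ^ (P + 1) = K * (1 + a) * (1 + a) ^ P by ring]
        gcongr
        linarith
      have h5 : 1 + K * a * (1 + a) ^ P ≤ (1 + K) * (1 + a) ^ (P + 1) := by
        have : (1 : ℝ) ≤ (1 + a) ^ (P + 1) := one_le_pow₀ h1a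
        linarith
      have h6 : K * a * (1 + a) ^ P * (1 + K * a * (1 + a) ^ P) * a ≤
          K * (1 + a) ^ (P + 1) * ((1 + K) * (1 + a) ^ (P + 1)) * a := by gcongr
      have h7 : K * (1 + a) ^ (P + 1) * ((1 + K) * (1 + a) ^ (P + 1)) * a =
        K * (1 + K) * a * (1 + a) ^ (2 * P + 2) := by ring
      have h8 : a ≤ a * (1 + a) ^ (2 * P + 2) := le_mul_of_one_le_right ha0 h3
      have h9 : 0 ≤ K * a * (1 + a) ^ (2 * P + 2) := by positivity
      calc _ ≤ a + 4 ^ k * (K * a * (1 + a) ^ P * (1 + K * a * (1 + a) ^ P) * a) := by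
            exact add_le_add h2 (le_of_eq (by ring))
        _ ≤ a * (1 + a) ^ (2 * P + 2) + 4 ^ k * (K * (1 + K) * a * (1 + a) ^ (2 * P + 2)) := by
            rw [← h7]; gcongr
        _ ≤ _ := by linarith
    · refine (hbk j hj1 h).trans ?_
      have h3 : (1 + a) ^ P ≤ (1 + a) ^ (2 * P + 2) := pow_le_pow_right₀ h1a (by omega)
      have h4 : (0 : ℝ) ≤ 1 + 4 ^ k * (K * (1 + K)) := by positivity
      gcongr
      linarith

/-- The nonlinear part of the higher derivatives of `tanh ∘ ϑ` is quadratically small. -/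
theorem abs_iteratedDeriv_tanh_comp_le_add (k : ℕ) :
    ∃ (K : ℝ) (P : ℕ), 0 ≤ K ∧ ∀ (ϑ : ℝ → ℝ) (a : ℝ), ContDiff ℝ (⊤ : ℕ∞) ϑ → 0 ≤ a →
      (∀ j, 1 ≤ j → j ≤ k → |iteratedDeriv j ϑ 0| ≤ a) →
        |iteratedDeriv (k + 1) (fun u => Real.tanh (ϑ u)) 0| ≤
          |iteratedDeriv (k + 1) ϑ 0| + K * a ^ 2 * (1 + a) ^ P := by
  obtain ⟨K, P, hK, hb⟩ := abs_iteratedDeriv_tanh_comp_le k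
  refine ⟨4 ^ k * (K * (1 + K)), 2 * P + 1, by positivity, fun ϑ a hϑ ha0 ha => ?_⟩
  have h1a : (1 : ℝ) ≤ 1 + a := by linarith
  refine (abs_iteratedDeriv_tanh_comp_succ_le hϑ ha0 (X := K * a * (1 + a) ^ P) (by positivity)
    ha (hb ϑ a hϑ ha0 ha)).trans (add_le_add le_rfl ?_)
  have h4 : K * a * (1 + a) ^ P ≤ K * (1 + a) ^ (P + 1) := by
    rw [show K * (1 + a) ^ (P + 1) = K * (1 + a) * (1 + a) ^ P by ring]
    gcongr
    linarith
  have h5 : 1 + K * a * (1 + a) ^ P ≤ (1 + K) * (1 + a) ^ (P + 1) := by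
    have : (1 : ℝ) ≤ (1 + a) ^ (P + 1) := one_le_pow₀ h1a
    linarith
  calc _ ≤ 4 ^ k * (K * a * (1 + a) ^ P * ((1 + K) * (1 + a) ^ (P + 1))) * a := by gcongr
    _ = _ := by ring

end TanhComposition

section LeaveOneOut

variable {N : ℕ}

/-- The configuration with the spin at `i` reversed. -/
def flipAt (i : Fin N) (σ : Cfg N) : Cfg N := Function.update σ i (!σ i)

theorem flipAt_flipAt (i : Fin N) (σ : Cfg N) : flipAt i (flipAt i σ) = σ := by
  simp [flipAt]

theorem spin_flipAt_self (i : Fin N) (σ : Cfg N) : spin (flipAt i σ i) = -spin (σ i) := by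
  cases h : σ i <;> simp [flipAt, spin, h]

theorem flipAt_of_ne {i j : Fin N} (h : j ≠ i) (σ : Cfg N) : flipAt i σ j = σ j := by
  simp [flipAt, h]

theorem two_mul_sum_eq_sum_flipAt (i : Fin N) (F : Cfg N → ℝ) :
    2 * ∑ σ, F σ = ∑ σ, (F σ + F (flipAt i σ)) := by
  have h : ∑ σ, F (flipAt i σ) = ∑ σ, F σ :=
    Equiv.sum_comp (Function.Involutive.toPerm (flipAt i) (flipAt_flipAt i)) F
  rw [sum_add_distrib, h]; ring

theorem exp_add_exp_spin (f : ℝ → ℝ) (b : Bool) : f (spin b) + f (-spin b) = f 1 + f (-1) := by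
  cases b <;> simp [spin, add_comm]

theorem mag_eq_tanh_half_sub (i : Fin N) {B V : Cfg N → ℝ} (hB : ∀ σ, B (flipAt i σ) = B σ)
    (hV : ∀ σ, V (flipAt i σ) = V σ) :
    mag i (fun σ => B σ + spin (σ i) * V σ) = Real.tanh ((Phi (B + V) - Phi (B - V)) / 2) := by
  have h1 : 2 * ∑ σ, spin (σ i) * Real.exp (B σ + spin (σ i) * V σ) = Zs (B + V) - Zs (B - V) := by
    rw [two_mul_sum_eq_sum_flipAt i, Zs, Zs, ← sum_sub_distrib]
    refine sum_congr rfl fun σ _ => ?_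
    rw [spin_flipAt_self, hB, hV, exp_add_exp_spin fun s => s * Real.exp (B σ + s * V σ)]
    simp [sub_eq_add_neg]
  have h2 : 2 * Zs (fun σ => B σ + spin (σ i) * V σ) = Zs (B + V) + Zs (B - V) := by
    rw [Zs, two_mul_sum_eq_sum_flipAt i, Zs, Zs, ← sum_add_distrib]
    refine sum_congr rfl fun σ _ => ?_
    rw [spin_flipAt_self, hB, hV, exp_add_exp_spin fun s => Real.exp (B σ + s * V σ)]
    simp [sub_eq_add_neg]
  have h3 : ∀ a c : ℝ, Real.tanh ((a - c) / 2) =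
      (Real.exp a - Real.exp c) / (Real.exp a + Real.exp c) := fun a c => by
    have ha : Real.exp a = Real.exp ((a + c) / 2) * Real.exp ((a - c) / 2) := by
      rw [← Real.exp_add]; ring_nf
    have hc : Real.exp c = Real.exp ((a + c) / 2) * Real.exp (-((a - c) / 2)) := by
      rw [← Real.exp_add]; ring_nf
    rw [Real.tanh_eq_sinh_div_cosh, Real.sinh_eq, Real.cosh_eq, ha, hc, ← mul_sub, ← mul_add,
      mul_div_mul_left _ _ (Real.exp_pos _).ne', div_div_div_cancel_right₀ two_ne_zero]
  rw [h3, exp_Phi, exp_Phi, ← h1, ← h2, mul_div_mul_left _ _ two_ne_zero]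
  rfl

theorem mag_eq_tanh_add (i : Fin N) {B V : Cfg N → ℝ} (hB : ∀ σ, B (flipAt i σ) = B σ)
    (hV : ∀ σ, V (flipAt i σ) = V σ) (c : ℝ) {e : Cfg N → ℝ}
    (he : ∀ σ, e σ = B σ + c * spin (σ i)) :
    mag i (fun σ => e σ + spin (σ i) * V σ) =
      Real.tanh (c + (Phi (e + V) - Phi (e - V)) / 2) := by
  have hcosh : ∀ W : Cfg N → ℝ, (∀ σ, W (flipAt i σ) = W σ) →
      Phi (e + W) = Real.log (Real.cosh c) + Phi (B + W) := fun W hW => by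
    rw [Phi, Phi, ← Real.log_mul (Real.cosh_pos c).ne' (Zs_pos _).ne']
    congr 1
    have : 2 * Zs (e + W) = 2 * (Real.cosh c * Zs (B + W)) := by
      rw [Zs, two_mul_sum_eq_sum_flipAt i, Zs, ← mul_assoc, mul_sum]
      refine sum_congr rfl fun σ _ => ?_
      simp only [Pi.add_apply]
      rw [he, he, spin_flipAt_self, hB, hW,
        exp_add_exp_spin fun s => Real.exp (B σ + c * s + W σ), Real.cosh_eq,
        show B σ + c * 1 + W σ = c + (B σ + W σ) by ring,
        show B σ + c * -1 + W σ = -c + (B σ + W σ) by ring, Real.exp_add c, Real.exp_add (-c)]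
      ring
    linarith
  have hc : ∀ r : ℝ, Phi (B + fun σ => r + V σ) = r + Phi (B + V) := fun r => by
    rw [Phi, Phi, ← Real.log_exp r, ← Real.log_mul (Real.exp_pos _).ne' (Zs_pos _).ne',
      Real.log_exp]
    congr 1
    rw [Zs, Zs, mul_sum]
    refine sum_congr rfl fun σ _ => ?_
    rw [← Real.exp_add]
    simp only [Pi.add_apply]
    ring_nf
  have hc' : Phi (B - fun σ => c + V σ) = -c + Phi (B - V) := by
    rw [Phi, Phi, ← Real.log_exp (-c), ← Real.log_mul (Real.exp_pos _).ne' (Zs_pos _).ne']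
    congr 1
    rw [Zs, Zs, mul_sum]
    refine sum_congr rfl fun σ _ => ?_
    rw [← Real.exp_add]
    simp only [Pi.sub_apply]
    ring_nf
  have h1 := mag_eq_tanh_half_sub i hB (V := fun σ => c + V σ) fun σ => by rw [hV]
  rw [show (fun σ => e σ + spin (σ i) * V σ) = fun σ => B σ + spin (σ i) * (c + V σ) from
    funext fun σ => by rw [he]; ring, h1, hc, hc', hcosh V hV, sub_eq_add_neg e,
    hcosh (-V) fun σ => by simp [hV], ← sub_eq_add_neg B]
  congr 1
  ring

/-- The field produced by the row of couplings `z` on the spins in `B`. -/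
def rowField (b : ℝ) (B : Finset (Fin N)) (z : Fin N → ℝ) : Fin N → ℝ :=
  fun j => if j ∈ B then b * z j else 0

theorem pairEnergy_flipAt (b : ℝ) {B : Finset (Fin N)} {i : Fin N} (hi : i ∉ B)
    (g : Fin N → Fin N → ℝ) (σ : Cfg N) :
    pairEnergy b B g (flipAt i σ) = pairEnergy b B g σ := by
  unfold pairEnergy
  congr 2
  funext j
  split_ifs with hj
  · rw [flipAt_of_ne (ne_of_mem_of_not_mem hj hi)]
  · rfl

theorem lin_flipAt {v : Fin N → ℝ} {i : Fin N} (hv : v i = 0) (σ : Cfg N) :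
    lin v (flipAt i σ) = lin v σ := by
  refine sum_congr rfl fun j _ => ?_
  by_cases h : j = i
  · rw [h, hv]; ring
  · rw [flipAt_of_ne h]

theorem lin_eq_update_add (h : Fin N → ℝ) (i : Fin N) (σ : Cfg N) :
    lin h σ = lin (Function.update h i 0) σ + h i * spin (σ i) := by
  have : h = Function.update h i 0 + Pi.single i (h i) := by
    ext j
    by_cases hj : j = i
    · subst hj; simp
    · simp [hj]
  conv_lhs => rw [this]
  rw [lin_add]
  congr 1
  simp [lin, Pi.single_apply]

theorem pairEnergy_eq_erase_add (b : ℝ) {A : Finset (Fin N)} {i : Fin N} (hi : i ∈ A)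
    (g : Fin N → Fin N → ℝ) (σ : Cfg N) :
    pairEnergy b A g σ = pairEnergy b (A.erase i) g σ +
      spin (σ i) * lin (rowField b (A.erase i) (rowOf i g)) σ := by
  set x : Fin N → ℝ := fun j => if j ∈ A.erase i then spin (σ j) else 0 with hx
  have hxi : x i = 0 := by simp [hx]
  have hterm : ∀ a c : Fin N, (if a < c then g a c * (if a ∈ A then spin (σ a) else 0) *
      (if c ∈ A then spin (σ c) else 0) else 0) = (if a < c then g a c * x a * x c else 0) +
      ((if a = i then (if i < c then spin (σ i) * (g i c * x c) else 0) else 0) +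
        (if c = i then (if a < i then spin (σ i) * (g a i * x a) else 0) else 0)) := by
    intro a c
    by_cases hac : a < c
    · by_cases ha : a = i
      · subst ha
        have hca : c ≠ a := hac.ne'
        simp [hac, hca, hi, hx]
        split_ifs <;> ring
      · by_cases hc : c = i
        · subst hc
          simp [hac, ha, hi, hx]
          split_ifs <;> ring
        · simp [hac, ha, hc, hx]
    · rw [if_neg hac, if_neg hac, zero_add]
      split_ifs <;> simp_all
  unfold pairEnergy quadForm lin
  simp_rw [hterm, sum_add_distrib]
  rw [mul_add]
  congr 1
  have h1 : ∑ a : Fin N, ∑ c : Fin N,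
      (if a = i then (if i < c then spin (σ i) * (g i c * x c) else 0) else 0) =
      ∑ j, if i < j then spin (σ i) * (g i j * x j) else 0 := by
    rw [sum_comm]; simp
  have h2 : ∑ a : Fin N, ∑ c : Fin N,
      (if c = i then (if a < i then spin (σ i) * (g a i * x a) else 0) else 0) =
      ∑ j, if j < i then spin (σ i) * (g j i * x j) else 0 := by
    simp
  rw [h1, h2, ← sum_add_distrib, mul_sum, mul_sum]
  refine sum_congr rfl fun j _ => ?_
  have hxj : rowField b (A.erase i) (rowOf i g) j * spin (σ j) = b * rowOf i g j * x j := by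
    simp only [rowField, hx]; split_ifs <;> ring
  rw [hxj]
  rcases lt_trichotomy i j with h | h | h
  · rw [if_pos h, if_neg h.not_gt, rowOf, if_pos h]; ring
  · subst h; simp [hxi]
  · rw [if_pos h, if_neg h.not_gt, rowOf, if_neg h.not_gt]; ring

theorem mag_pairEnergy_of_mem (b : ℝ) {A : Finset (Fin N)} {i : Fin N} (hi : i ∈ A)
    (g : Fin N → Fin N → ℝ) (h : Fin N → ℝ) :
    mag i (pairEnergy b A g + lin h) = Real.tanh (h i +
      (Phi (pairEnergy b (A.erase i) g + lin h + lin (rowField b (A.erase i) (rowOf i g))) -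
        Phi (pairEnergy b (A.erase i) g + lin h - lin (rowField b (A.erase i) (rowOf i g)))) /
          2) := by
  rw [← mag_eq_tanh_add i
    (B := fun σ => pairEnergy b (A.erase i) g σ + lin (Function.update h i 0) σ)
    (fun σ => by
      rw [pairEnergy_flipAt b (notMem_erase i A), lin_flipAt (by simp)])
    (lin_flipAt (by simp [rowField])) (h i) fun σ => by
      rw [Pi.add_apply, lin_eq_update_add h i]; ring]
  congr 1
  funext σ
  rw [Pi.add_apply, Pi.add_apply, pairEnergy_eq_erase_add b hi]
  ring

theorem mag_pairEnergy_of_notMem (b : ℝ) {A : Finset (Fin N)} {i : Fin N} (hi : i ∉ A)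
    (g : Fin N → Fin N → ℝ) (h : Fin N → ℝ) :
    mag i (pairEnergy b A g + lin h) = Real.tanh (h i) := by
  have := mag_eq_tanh_add i (V := fun _ => 0) (e := pairEnergy b A g + lin h)
    (B := fun σ => pairEnergy b A g σ + lin (Function.update h i 0) σ)
    (fun σ => by rw [pairEnergy_flipAt b hi, lin_flipAt (by simp)])
    (fun _ => rfl) (h i) fun σ => by rw [Pi.add_apply, lin_eq_update_add h i]; ring
  simp only [show (fun _ : Cfg N => (0 : ℝ)) = 0 from rfl, mul_zero, add_zero, sub_zero, sub_self,
    zero_div] at this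
  exact this

end LeaveOneOut

section CavityIncrement

variable {N : ℕ}

theorem continuous_lin : Continuous (lin : (Fin N → ℝ) → Cfg N → ℝ) :=
  continuous_pi fun _ => continuous_finsetSum _ fun j _ => (continuous_apply j).mul_const _

theorem continuous_rowField (b : ℝ) (B : Finset (Fin N)) : Continuous (rowField b B) :=
  continuous_pi fun j => by
    unfold rowField
    split_ifs
    · exact continuous_const.mul (continuous_apply j)
    · exact continuous_const

theorem measurable_pairEnergy (b : ℝ) (A : Finset (Fin N)) :
    Measurable (pairEnergy b A : (Fin N → Fin N → ℝ) → Cfg N → ℝ) :=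
  measurable_pi_lambda _ fun _ => (measurable_quadForm _).const_mul b

theorem measurable_rowOf (i : Fin N) :
    Measurable (rowOf i : (Fin N → Fin N → ℝ) → Fin N → ℝ) := by
  refine measurable_pi_lambda _ fun j => ?_
  unfold rowOf
  split_ifs <;> fun_prop

/-- Half the increment of the `k`-th derivative of the log-partition function between the
fields `r` and `-r`. -/
def phiDiff (t : Fin N → ℝ) (k : ℕ) (e : Cfg N → ℝ) (r : Fin N → ℝ) : ℝ :=
  (dirD (lin t) k Phi (e + lin r) - dirD (lin t) k Phi (e - lin r)) / 2

theorem continuous_phiDiff (t : Fin N → ℝ) (k : ℕ) :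
    Continuous fun p : (Cfg N → ℝ) × (Fin N → ℝ) => phiDiff t k p.1 p.2 := by
  have h1 := (contDiff_dirD (lin t) (contDiff_Phi (Ω := Cfg N)) k).continuous
  have h2 : Continuous fun p : (Cfg N → ℝ) × (Fin N → ℝ) => lin p.2 :=
    continuous_lin.comp continuous_snd
  exact ((h1.comp (continuous_fst.add h2)).sub (h1.comp (continuous_fst.sub h2))).div_const 2

/-- The effective field at `i` along a line of external fields. -/
def cavityField (t : Fin N → ℝ) (e : Cfg N → ℝ) (r : Fin N → ℝ) (c s u : ℝ) : ℝ :=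
  (c + u * s) + (Phi (e + lin r + u • lin t) - Phi (e - lin r + u • lin t)) * (1 / 2)

theorem contDiff_phi_line (e w : Cfg N → ℝ) :
    ContDiff ℝ (⊤ : ℕ∞) fun u : ℝ => Phi (e + u • w) :=
  contDiff_Phi.comp (contDiff_const.add (contDiff_id.smul contDiff_const))

theorem contDiff_cavityField (t : Fin N → ℝ) (e : Cfg N → ℝ) (r : Fin N → ℝ) (c s : ℝ) :
    ContDiff ℝ (⊤ : ℕ∞) (cavityField t e r c s) :=
  (contDiff_const.add (contDiff_id.mul contDiff_const)).add
    (((contDiff_phi_line _ _).sub (contDiff_phi_line _ _)).mul contDiff_const)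

theorem iteratedDeriv_affine (c s : ℝ) {k : ℕ} (hk : 1 ≤ k) :
    iteratedDeriv k (fun u : ℝ => c + u * s) 0 = if k = 1 then s else 0 := by
  obtain ⟨k, rfl⟩ := Nat.exists_eq_add_of_le' hk
  have h : deriv (fun u : ℝ => c + u * s) = fun _ => s := by
    funext u
    simp
  rw [iteratedDeriv_succ', h, iteratedDeriv_const]
  simp

theorem iteratedDeriv_cavityField (t : Fin N → ℝ) (e : Cfg N → ℝ) (r : Fin N → ℝ) (c s : ℝ)
    {k : ℕ} (hk : 1 ≤ k) :
    iteratedDeriv k (cavityField t e r c s) 0 = (if k = 1 then s else 0) + phiDiff t k e r := by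
  have hat : ∀ {f : ℝ → ℝ}, ContDiff ℝ (⊤ : ℕ∞) f → ContDiffAt ℝ k f 0 := fun hf =>
    hf.contDiffAt.of_le (by exact_mod_cast le_top)
  have haff : ContDiff ℝ (⊤ : ℕ∞) fun u : ℝ => c + u * s :=
    contDiff_const.add (contDiff_id.mul contDiff_const)
  unfold cavityField
  rw [iteratedDeriv_fun_add (hat haff)
    (hat (((contDiff_phi_line _ _).sub (contDiff_phi_line _ _)).mul contDiff_const)),
    iteratedDeriv_affine c s hk]
  congr 1
  simp_rw [mul_comm _ (1 / 2 : ℝ)]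
  rw [iteratedDeriv_const_mul_field, iteratedDeriv_fun_sub (hat (contDiff_phi_line _ _))
    (hat (contDiff_phi_line _ _)), iteratedDeriv_line _ contDiff_Phi,
    iteratedDeriv_line _ contDiff_Phi, phiDiff]
  simp
  ring

theorem dirD_mag_of_mem (b : ℝ) {A : Finset (Fin N)} {i : Fin N} (hi : i ∈ A)
    (g : Fin N → Fin N → ℝ) (h t : Fin N → ℝ) (k : ℕ) :
    dirD (lin t) k (mag i) (pairEnergy b A g + lin h) =
      iteratedDeriv k (fun u => Real.tanh (cavityField t (pairEnergy b (A.erase i) g + lin h)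
        (rowField b (A.erase i) (rowOf i g)) (h i) (t i) u)) 0 := by
  rw [dirD_eq_iteratedDeriv _ (contDiff_mag i)]
  congr 1
  funext u
  have hl : lin h + u • lin t = lin (h + u • t) := by
    funext σ
    rw [lin_add, lin_smul]; rfl
  rw [add_assoc, hl, mag_pairEnergy_of_mem b hi, ← hl, cavityField]
  congr 1
  simp only [Pi.add_apply, Pi.smul_apply, smul_eq_mul]
  rw [show pairEnergy b (A.erase i) g + (lin h + u • lin t) +
      lin (rowField b (A.erase i) (rowOf i g)) = pairEnergy b (A.erase i) g + lin h +
      lin (rowField b (A.erase i) (rowOf i g)) + u • lin t by abel,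
    show pairEnergy b (A.erase i) g + (lin h + u • lin t) -
      lin (rowField b (A.erase i) (rowOf i g)) = pairEnergy b (A.erase i) g + lin h -
      lin (rowField b (A.erase i) (rowOf i g)) + u • lin t by abel]
  ring

theorem dirD_mag_of_notMem (b : ℝ) {A : Finset (Fin N)} {i : Fin N} (hi : i ∉ A)
    (g : Fin N → Fin N → ℝ) (h t : Fin N → ℝ) (k : ℕ) :
    dirD (lin t) k (mag i) (pairEnergy b A g + lin h) =
      iteratedDeriv k (fun u => Real.tanh (h i + u * t i)) 0 := by
  rw [dirD_eq_iteratedDeriv _ (contDiff_mag i)]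
  congr 1
  funext u
  have hl : lin h + u • lin t = lin (h + u • t) := by
    funext σ
    rw [lin_add, lin_smul]; rfl
  rw [add_assoc, hl, mag_pairEnergy_of_notMem b hi]
  simp

theorem lintegral_phiDiff_pow_le (b : ℝ) (B : Finset (Fin N)) (t : Fin N → ℝ) (k q : ℕ)
    (e : Cfg N → ℝ) :
    ∫⁻ z, ENNReal.ofReal (phiDiff t k e (rowField b B z) ^ (2 * q)) ∂gaussVec N ≤
      ENNReal.ofReal (Real.pi ^ (2 * q) * (4 * (2 * q).factorial) / 4 ^ q) *
        ∫⁻ z, ENNReal.ofReal ((b ^ 2 * ∑ j, dirD (lin t) k (mag j)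
          (e + lin (rowField b B z)) ^ 2) ^ q) ∂gaussVec N := by
  have hadd : ∀ z w, lin (rowField b B (z + w)) = lin (rowField b B z) + lin (rowField b B w) := by
    intro z w; funext σ
    rw [Pi.add_apply, ← lin_add]; congr 1; funext j
    simp only [rowField, Pi.add_apply]; split_ifs <;> ring
  have hsmul : ∀ (c : ℝ) z, lin (rowField b B (c • z)) = c • lin (rowField b B z) := by
    intro c z; funext σ
    rw [Pi.smul_apply, smul_eq_mul, ← lin_smul]; congr 1; funext j
    simp only [rowField, Pi.smul_apply, smul_eq_mul]; split_ifs <;> ring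
  let L : (Fin N → ℝ) →L[ℝ] (Cfg N → ℝ) := LinearMap.toContinuousLinearMap
    { toFun := fun z => lin (rowField b B z), map_add' := hadd, map_smul' := hsmul }
  have hL : ∀ z, L z = lin (rowField b B z) := fun _ => rfl
  have hsm := contDiff_dirD (lin t) (contDiff_Phi (Ω := Cfg N)) k
  set F : (Fin N → ℝ) → ℝ := fun z => dirD (lin t) k Phi (e + L z) with hF
  have hFs : ContDiff ℝ (⊤ : ℕ∞) F := hsm.comp (contDiff_const.add L.contDiff)
  have hneg : ∀ z, (F z - F fun i => -z i) = 2 * phiDiff t k e (rowField b B z) := fun z => by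
    have : L (fun i => -z i) = -L z := L.map_neg z
    change dirD (lin t) k Phi (e + L z) - dirD (lin t) k Phi (e + L fun i => -z i) = _
    rw [this, ← sub_eq_add_neg, phiDiff, hL]; ring
  have hfd : ∀ z j, fderiv ℝ F z (Pi.single j 1) =
      (if j ∈ B then b else 0) * dirD (lin t) k (mag j) (e + lin (rowField b B z)) := by
    intro z j
    have h1 : HasFDerivAt F ((fderiv ℝ (dirD (lin t) k Phi) (e + L z)).comp L) z :=
      ((hsm.differentiable (by simp) _).hasFDerivAt).comp z (L.hasFDerivAt.const_add e)
    rw [h1.fderiv, ContinuousLinearMap.comp_apply, fderiv_dirD _ contDiff_Phi]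
    have h2 : (fun x : Cfg N → ℝ => fderiv ℝ Phi x (L (Pi.single j 1))) =
        fun x => ∑ i ∈ ({j} : Finset (Fin N)), (if j ∈ B then b else 0) * mag i x := by
      funext x
      rw [fderiv_Phi, hL, avg_lin, sum_singleton, sum_eq_single j]
      · simp [rowField]
      · intro i _ hij; simp [rowField, hij]
      · simp
    rw [h2, dirD_sum _ {j} (fun _ => if j ∈ B then b else 0) (fun i => contDiff_mag i),
      sum_singleton]
    rfl
  have hP := lintegral_sub_neg_pow_le F (hFs.of_le (by exact_mod_cast le_top)) q
  have e1 : ∀ z, ENNReal.ofReal ((F z - F fun i => -z i) ^ (2 * q)) =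
      ENNReal.ofReal (4 ^ q) * ENNReal.ofReal (phiDiff t k e (rowField b B z) ^ (2 * q)) := by
    intro z
    rw [hneg, ← ENNReal.ofReal_mul (by positivity), mul_pow, pow_mul]; norm_num
  simp_rw [e1] at hP
  rw [lintegral_const_mul' _ _ ENNReal.ofReal_ne_top] at hP
  have h4 : ENNReal.ofReal (4 ^ q : ℝ) * ENNReal.ofReal ((1 / 4 : ℝ) ^ q) = 1 := by
    rw [← ENNReal.ofReal_mul (by positivity), ← mul_pow]; norm_num
  have hP2 := mul_le_mul_right hP (ENNReal.ofReal ((1 / 4 : ℝ) ^ q))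
  rw [← mul_assoc, mul_comm (ENNReal.ofReal ((1 / 4 : ℝ) ^ q)), h4, one_mul, ← mul_assoc,
    ← ENNReal.ofReal_mul (by positivity)] at hP2
  refine hP2.trans (mul_le_mul' (ENNReal.ofReal_le_ofReal (le_of_eq ?_))
    (lintegral_mono fun z => ENNReal.ofReal_le_ofReal ?_))
  · rw [one_div, inv_pow]; field_simp
  · refine pow_le_pow_left₀ (sum_nonneg fun _ _ => sq_nonneg _) ?_ q
    rw [mul_sum]
    refine sum_le_sum fun j _ => ?_
    rw [hfd, mul_pow]
    refine mul_le_mul_of_nonneg_right ?_ (sq_nonneg _)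
    split_ifs
    · exact le_rfl
    · simpa using sq_nonneg b

theorem measurable_ofReal_phiDiff (t : Fin N → ℝ) (k p : ℕ) (b : ℝ) (B : Finset (Fin N))
    (h : Fin N → ℝ) : Measurable fun x : (Cfg N → ℝ) × (Fin N → ℝ) =>
      ENNReal.ofReal (phiDiff t k (x.1 + lin h) (rowField b B x.2) ^ p) := by
  refine (Continuous.measurable ?_).ennreal_ofReal
  exact ((continuous_phiDiff t k).comp ((continuous_fst.add continuous_const).prodMk
    ((continuous_rowField b B).comp continuous_snd))).pow p

theorem add_lin_add (e : Cfg N → ℝ) (h r : Fin N → ℝ) : e + lin h + lin r = e + lin (h + r) := by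
  rw [add_assoc]
  congr 1
  funext σ
  rw [lin_add]; rfl

theorem lintegral_phiDiff_row_pow_le (k q : ℕ) (hk : 1 ≤ k) :
    ∃ C : ℝ, 0 ≤ C ∧ ∀ (N : ℕ) (b : ℝ), 1 ≤ N → b ^ 2 * N ≤ 1 / 65536 →
      ∀ (B : Finset (Fin N)) (i : Fin N), i ∉ B → ∀ h t : Fin N → ℝ, ∑ i, t i ^ 2 = 1 →
        ∫⁻ g, ENNReal.ofReal (phiDiff t k (pairEnergy b B g + lin h)
          (rowField b B (rowOf i g)) ^ (2 * q)) ∂gaussN N ≤ ENNReal.ofReal (C * b ^ (2 * q)) := by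
  obtain ⟨C, hC0, hC⟩ := sum_sq_dirD_mag_le k hk
  obtain ⟨K, hK0, hK⟩ := integral_radius_pow_le (2 * (k + 1) * q)
  set c : ℝ := Real.pi ^ (2 * q) * (4 * (2 * q).factorial) / 4 ^ q with hc
  have hc0 : 0 ≤ c := by positivity
  refine ⟨c * C ^ q * K, by positivity, fun N b hN hb B i hi h t ht => ?_⟩
  rw [lintegral_resample b hi (Ψ := fun e z => ENNReal.ofReal (phiDiff t k (e + lin h)
    (rowField b B z) ^ (2 * q))) (measurable_ofReal_phiDiff t k (2 * q) b B h)]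
  have h1 : ∀ g, ∫⁻ z, ENNReal.ofReal (phiDiff t k (pairEnergy b B g + lin h)
      (rowField b B z) ^ (2 * q)) ∂gaussVec N ≤
      ENNReal.ofReal (c * C ^ q * b ^ (2 * q)) *
        ENNReal.ofReal (radius b g ^ (2 * (k + 1) * q)) := by
    intro g
    refine (lintegral_phiDiff_pow_le b B t k q _).trans ?_
    have h2 : ∀ z, ENNReal.ofReal ((b ^ 2 * ∑ j, dirD (lin t) k (mag j)
        (pairEnergy b B g + lin h + lin (rowField b B z)) ^ 2) ^ q) ≤
        ENNReal.ofReal ((b ^ 2 * (C * radius b g ^ (2 * (k + 1)))) ^ q) := fun z => by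
      refine ENNReal.ofReal_le_ofReal (pow_le_pow_left₀ ?_ ?_ q)
      · exact mul_nonneg (sq_nonneg b) (sum_nonneg fun _ _ => sq_nonneg _)
      · rw [add_lin_add]
        exact mul_le_mul_of_nonneg_left (hC N _ _ (radBound_radius b hN g B) _ t ht) (sq_nonneg b)
    refine (mul_le_mul_right (lintegral_mono h2) _).trans (le_of_eq ?_)
    rw [lintegral_const, measure_univ, mul_one, ← ENNReal.ofReal_mul hc0,
      ← ENNReal.ofReal_mul (by rw [pow_mul]; positivity)]
    congr 1
    rw [mul_pow, mul_pow, ← pow_mul, ← pow_mul]; ring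
  refine (lintegral_mono h1).trans ?_
  rw [lintegral_const_mul' _ _ ENNReal.ofReal_ne_top, ← ofReal_integral_eq_lintegral_ofReal
    (integrable_radius_pow b hN _) (Filter.Eventually.of_forall fun g => by
      have := one_le_radius b hN g
      positivity), ← ENNReal.ofReal_mul (by rw [pow_mul b]; positivity)]
  refine ENNReal.ofReal_le_ofReal ?_
  have h0 : 0 ≤ c * C ^ q * b ^ (2 * q) := by rw [pow_mul b]; positivity
  nlinarith [mul_le_mul_of_nonneg_left (hK N b hN hb) h0]

theorem lintegral_phiDiff_row_sq_le (b : ℝ) {B : Finset (Fin N)} {i : Fin N} (hi : i ∉ B)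
    (h t : Fin N → ℝ) (k : ℕ) {c : ℝ} (hc : ∀ h' : Fin N → ℝ,
      ∫⁻ g, ENNReal.ofReal (∑ j, dirD (lin t) k (mag j) (pairEnergy b B g + lin h') ^ 2)
        ∂gaussN N ≤ ENNReal.ofReal c) :
    ∫⁻ g, ENNReal.ofReal (phiDiff t k (pairEnergy b B g + lin h)
      (rowField b B (rowOf i g)) ^ 2) ∂gaussN N ≤ ENNReal.ofReal (20 * b ^ 2 * c) := by
  rw [lintegral_resample b hi (Ψ := fun e z => ENNReal.ofReal (phiDiff t k (e + lin h)
    (rowField b B z) ^ 2)) (measurable_ofReal_phiDiff t k 2 b B h)]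
  have hconst : Real.pi ^ (2 * 1) * (4 * (2 * 1).factorial) / 4 ^ 1 ≤ (20 : ℝ) := by
    have := Real.pi_lt_d2
    have := Real.pi_pos
    norm_num [Nat.factorial]
    nlinarith
  set G : (Fin N → Fin N → ℝ) → (Fin N → ℝ) → ENNReal := fun g z => ENNReal.ofReal
    (∑ j, dirD (lin t) k (mag j) (pairEnergy b B g + lin (h + rowField b B z)) ^ 2) with hG
  have hGm : Measurable (Function.uncurry G) := by
    have hcont : Continuous fun p : (Cfg N → ℝ) × (Fin N → ℝ) =>
        ∑ j, dirD (lin t) k (mag j) (p.1 + lin (h + rowField b B p.2)) ^ 2 :=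
      continuous_finsetSum _ fun j _ =>
        ((contDiff_dirD (lin t) (contDiff_mag j) k).continuous.comp (continuous_fst.add
          (continuous_lin.comp (continuous_const.add
            ((continuous_rowField b B).comp continuous_snd))))).pow 2
    exact (hcont.measurable.comp (((measurable_pairEnergy b B).comp measurable_fst).prodMk
      measurable_snd)).ennreal_ofReal
  have h1 : ∀ g, ∫⁻ z, ENNReal.ofReal (phiDiff t k (pairEnergy b B g + lin h)
      (rowField b B z) ^ 2) ∂gaussVec N ≤
      ENNReal.ofReal (20 * b ^ 2) * ∫⁻ z, G g z ∂gaussVec N := fun g => by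
    have := lintegral_phiDiff_pow_le b B t k 1 (pairEnergy b B g + lin h)
    rw [mul_one] at this
    refine this.trans ?_
    simp only [pow_one, add_lin_add, ENNReal.ofReal_mul (sq_nonneg b)]
    rw [lintegral_const_mul' _ _ ENNReal.ofReal_ne_top, ← mul_assoc,
      ENNReal.ofReal_mul (by norm_num : (0 : ℝ) ≤ 20)]
    gcongr
    simpa using hconst
  refine (lintegral_mono h1).trans ?_
  rw [lintegral_const_mul' _ _ ENNReal.ofReal_ne_top, lintegral_lintegral_swap hGm.aemeasurable,
    ENNReal.ofReal_mul (p := 20 * b ^ 2) (by positivity)]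
  refine mul_le_mul_right ((lintegral_mono fun z => hc _).trans ?_) _
  rw [lintegral_const, measure_univ, mul_one]

end CavityIncrement

section LintegralBounds

variable {α : Type*} [MeasurableSpace α] {μ : Measure α}

theorem lintegral_ofReal_add_le {f g : α → ℝ} {c d : ℝ} (hf : Measurable f) (hc : 0 ≤ c)
    (hd : 0 ≤ d) (h1 : ∫⁻ x, ENNReal.ofReal (f x) ∂μ ≤ ENNReal.ofReal c)
    (h2 : ∫⁻ x, ENNReal.ofReal (g x) ∂μ ≤ ENNReal.ofReal d) :
    ∫⁻ x, ENNReal.ofReal (f x + g x) ∂μ ≤ ENNReal.ofReal (c + d) := by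
  rw [ENNReal.ofReal_add hc hd]
  refine (lintegral_mono fun x => ENNReal.ofReal_add_le).trans ?_
  rw [lintegral_add_left hf.ennreal_ofReal]
  exact add_le_add h1 h2

theorem lintegral_ofReal_const_mul_le {f : α → ℝ} {c r : ℝ} (hr : 0 ≤ r)
    (h : ∫⁻ x, ENNReal.ofReal (f x) ∂μ ≤ ENNReal.ofReal c) :
    ∫⁻ x, ENNReal.ofReal (r * f x) ∂μ ≤ ENNReal.ofReal (r * c) := by
  simp_rw [ENNReal.ofReal_mul hr]
  rw [lintegral_const_mul' _ _ ENNReal.ofReal_ne_top]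
  exact mul_le_mul_right h _

theorem lintegral_ofReal_sum_le {κ : Type*} (s : Finset κ) {f : κ → α → ℝ} {c : κ → ℝ}
    (hf : ∀ i, Measurable (f i)) (hc : ∀ i, 0 ≤ c i)
    (h : ∀ i, ∫⁻ x, ENNReal.ofReal (f i x) ∂μ ≤ ENNReal.ofReal (c i)) :
    ∫⁻ x, ENNReal.ofReal (∑ i ∈ s, f i x) ∂μ ≤ ENNReal.ofReal (∑ i ∈ s, c i) := by
  classical
  induction s using Finset.induction_on with
  | empty => simp
  | insert a s ha ih =>
    simp_rw [sum_insert ha]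
    exact lintegral_ofReal_add_le (hf a) (hc a) (sum_nonneg fun i _ => hc i) (h a) ih

theorem lintegral_ofReal_const_le [IsProbabilityMeasure μ] (c : ℝ) :
    ∫⁻ _, ENNReal.ofReal c ∂μ ≤ ENNReal.ofReal c := by
  rw [lintegral_const, measure_univ, mul_one]

theorem add_sum_pow_le {x : ℝ} (hx : 0 ≤ x) {y : ℕ → ℝ} (hy : ∀ j, 0 ≤ y j) (m : ℕ) {n : ℕ}
    (hn : 1 ≤ n) :
    (x + ∑ j ∈ range m, y j) ^ n ≤ (m + 1) ^ n * (x ^ n + ∑ j ∈ range m, y j ^ n) := by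
  obtain ⟨n, rfl⟩ := Nat.exists_eq_add_of_le' hn
  set f : ℕ → ℝ := fun j => Nat.casesOn j x y with hf
  have h := pow_sum_div_card_le_sum_pow (s := range (m + 1)) (f := f)
    (fun j _ => by cases j <;> simp [hf, hx, hy]) n
  rw [card_range, div_le_iff₀ (by positivity), sum_range_succ', sum_range_succ'] at h
  simp only [hf] at h
  push_cast at h
  rw [add_comm x, add_comm (x ^ (n + 1))]
  refine h.trans ?_
  rw [mul_comm]
  refine mul_le_mul_of_nonneg_right (pow_le_pow_right₀ (by linarith [Nat.cast_nonneg (α := ℝ) m])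
    (Nat.le_succ n)) ?_
  exact add_nonneg (sum_nonneg fun j _ => pow_nonneg (hy j) _) (pow_nonneg hx _)

end LintegralBounds

section DerivativeDecay

variable {N : ℕ}

/-- A bound for the lower-order derivatives of the effective field at `i`. -/
def cavitySize (t : Fin N → ℝ) (m : ℕ) (i : Fin N) (e : Cfg N → ℝ) (r : Fin N → ℝ) : ℝ :=
  |t i| + ∑ j ∈ range m, |phiDiff t (j + 1) e r|

theorem abs_le_cavitySize (t : Fin N → ℝ) (m : ℕ) (i : Fin N) (e : Cfg N → ℝ) (r : Fin N → ℝ) :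
    |t i| ≤ cavitySize t m i e r :=
  le_add_of_nonneg_right (sum_nonneg fun _ _ => abs_nonneg _)

theorem abs_iteratedDeriv_cavityField_le (t : Fin N → ℝ) (m : ℕ) (i : Fin N) (e : Cfg N → ℝ)
    (r : Fin N → ℝ) (c : ℝ) {j : ℕ} (h1 : 1 ≤ j) (h2 : j ≤ m) :
    |iteratedDeriv j (cavityField t e r c (t i)) 0| ≤ cavitySize t m i e r := by
  rw [iteratedDeriv_cavityField _ _ _ _ _ h1]
  refine (abs_add_le _ _).trans (add_le_add ?_ ?_)
  · split_ifs
    · exact le_rfl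
    · simp
  · obtain ⟨j, rfl⟩ := Nat.exists_eq_add_of_le' h1
    exact single_le_sum (f := fun j => |phiDiff t (j + 1) e r|) (fun _ _ => abs_nonneg _)
      (mem_range.2 (by omega))

theorem sq_dirD_mag_le (m : ℕ) (hm : 1 ≤ m) :
    ∃ (K : ℝ) (q : ℕ), 0 ≤ K ∧ 2 ≤ q ∧ ∀ (N : ℕ) (b : ℝ) (A : Finset (Fin N)) (i : Fin N)
      (g : Fin N → Fin N → ℝ) (h t : Fin N → ℝ),
      dirD (lin t) (m + 1) (mag i) (pairEnergy b A g + lin h) ^ 2 ≤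
        2 * (if i ∈ A then phiDiff t (m + 1) (pairEnergy b (A.erase i) g + lin h)
          (rowField b (A.erase i) (rowOf i g)) else 0) ^ 2 +
        K * (cavitySize t m i (pairEnergy b (A.erase i) g + lin h)
            (rowField b (A.erase i) (rowOf i g)) ^ (2 * 2) +
          cavitySize t m i (pairEnergy b (A.erase i) g + lin h)
            (rowField b (A.erase i) (rowOf i g)) ^ (2 * q)) := by
  obtain ⟨K, P, hK, hb⟩ := abs_iteratedDeriv_tanh_comp_le_add m
  refine ⟨2 * K ^ 2 * 2 ^ (2 * P), P + 2, by positivity, by omega, fun N b A i g h t => ?_⟩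
  set e := pairEnergy b (A.erase i) g + lin h
  set r := rowField b (A.erase i) (rowOf i g)
  set a := cavitySize t m i e r
  have hta : |t i| ≤ a := abs_le_cavitySize t m i e r
  have ha : 0 ≤ a := (abs_nonneg _).trans hta
  set X : ℝ := if i ∈ A then phiDiff t (m + 1) e r else 0 with hX
  have h1 : |dirD (lin t) (m + 1) (mag i) (pairEnergy b A g + lin h)| ≤
      |X| + K * a ^ 2 * (1 + a) ^ P := by
    by_cases hi : i ∈ A
    · rw [dirD_mag_of_mem b hi, hX, if_pos hi]
      have := hb _ a (contDiff_cavityField t e r (h i) (t i)) ha fun j h1 h2 =>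
        abs_iteratedDeriv_cavityField_le t m i e r (h i) h1 h2
      rwa [iteratedDeriv_cavityField _ _ _ _ _ (Nat.le_add_left 1 m), if_neg (by omega),
        zero_add] at this
    · rw [dirD_mag_of_notMem b hi, hX, if_neg hi, abs_zero]
      have := hb (fun u => h i + u * t i) a
        (contDiff_const.add (contDiff_id.mul contDiff_const)) ha fun j h1 _ => by
          rw [iteratedDeriv_affine _ _ h1]
          split_ifs
          · exact hta
          · simpa using ha
      rwa [iteratedDeriv_affine _ _ (Nat.le_add_left 1 m), if_neg (by omega), abs_zero] at this
  have h2 : (1 + a) ^ (2 * P) ≤ 2 ^ (2 * P) * (1 + a ^ (2 * P)) := by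
    refine (add_pow_le zero_le_one ha (2 * P)).trans ?_
    rw [one_pow]
    refine mul_le_mul_of_nonneg_right (pow_le_pow_right₀ one_le_two (by omega)) (by positivity)
  calc _ = |dirD (lin t) (m + 1) (mag i) (pairEnergy b A g + lin h)| ^ 2 := (sq_abs _).symm
    _ ≤ (|X| + K * a ^ 2 * (1 + a) ^ P) ^ 2 :=
        pow_le_pow_left₀ (abs_nonneg _) h1 2
    _ ≤ 2 * |X| ^ 2 + 2 * (K * a ^ 2 * (1 + a) ^ P) ^ 2 := by
        linarith [sq_nonneg (|X| - K * a ^ 2 * (1 + a) ^ P)]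
    _ = 2 * X ^ 2 + 2 * K ^ 2 * a ^ 4 * (1 + a) ^ (2 * P) := by
        rw [sq_abs]; ring
    _ ≤ 2 * X ^ 2 +
          2 * K ^ 2 * a ^ 4 * (2 ^ (2 * P) * (1 + a ^ (2 * P))) := by gcongr
    _ = _ := by ring

theorem measurable_phiDiff_row (t h : Fin N → ℝ) (k : ℕ) (b : ℝ) (B : Finset (Fin N))
    (i : Fin N) : Measurable fun g => phiDiff t k (pairEnergy b B g + lin h)
      (rowField b B (rowOf i g)) :=
  (continuous_phiDiff t k).measurable.comp (((measurable_pairEnergy b B).add_const _).prodMk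
    ((continuous_rowField b B).measurable.comp (measurable_rowOf i)))

theorem measurable_cavitySize_row (t h : Fin N → ℝ) (m : ℕ) (b : ℝ) (B : Finset (Fin N))
    (i : Fin N) : Measurable fun g => cavitySize t m i (pairEnergy b B g + lin h)
      (rowField b B (rowOf i g)) := by
  unfold cavitySize
  refine Measurable.const_add (Finset.measurable_sum _ fun j _ => ?_) _
  have := measurable_phiDiff_row t h (j + 1) b B i
  exact this.abs

theorem measurable_dirD_mag (t h : Fin N → ℝ) (k : ℕ) (b : ℝ) (A : Finset (Fin N)) (i : Fin N) :
    Measurable fun g => dirD (lin t) k (mag i) (pairEnergy b A g + lin h) :=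
  (contDiff_dirD (lin t) (contDiff_mag i) k).continuous.measurable.comp
    ((measurable_pairEnergy b A).add_const _)

theorem lintegral_cavitySize_pow_le (m q : ℕ) (hq : 1 ≤ q) :
    ∃ C : ℝ, 0 ≤ C ∧ ∀ (N : ℕ) (b : ℝ), 1 ≤ N → b ^ 2 * N ≤ 1 / 65536 →
      ∀ (B : Finset (Fin N)) (i : Fin N), i ∉ B → ∀ h t : Fin N → ℝ, ∑ i, t i ^ 2 = 1 →
        ∫⁻ g, ENNReal.ofReal (cavitySize t m i (pairEnergy b B g + lin h)
          (rowField b B (rowOf i g)) ^ (2 * q)) ∂gaussN N ≤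
            ENNReal.ofReal (C * (t i ^ (2 * q) + b ^ (2 * q))) := by
  choose C hC0 hC using fun j : ℕ => lintegral_phiDiff_row_pow_le (j + 1) q (by omega)
  refine ⟨(m + 1) ^ (2 * q) * (1 + ∑ j ∈ range m, C j),
    mul_nonneg (by positivity) (add_nonneg zero_le_one (sum_nonneg fun j _ => hC0 j)),
    fun N b hN hb B i hi h t ht => ?_⟩
  have hb0 : 0 ≤ b ^ (2 * q) := by rw [pow_mul]; positivity
  have ht0 : 0 ≤ t i ^ (2 * q) := by rw [pow_mul]; positivity
  refine (lintegral_mono fun g => ENNReal.ofReal_le_ofReal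
    (add_sum_pow_le (abs_nonneg _) (fun _ => abs_nonneg _) m (by omega))).trans ?_
  simp only [(even_two_mul q).pow_abs]
  have hsum := lintegral_ofReal_sum_le (μ := gaussN N) (range m)
    (f := fun j g => phiDiff t (j + 1) (pairEnergy b B g + lin h)
      (rowField b B (rowOf i g)) ^ (2 * q)) (c := fun j => C j * b ^ (2 * q))
    (fun j => (measurable_phiDiff_row t h (j + 1) b B i).pow_const _)
    (fun j => mul_nonneg (hC0 j) hb0) fun j => hC j N b hN hb B i hi h t ht
  refine (lintegral_ofReal_const_mul_le (by positivity) (lintegral_ofReal_add_le measurable_const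
    ht0 (sum_nonneg fun j _ => mul_nonneg (hC0 j) hb0) (lintegral_ofReal_const_le _)
    hsum)).trans (ENNReal.ofReal_le_ofReal ?_)
  rw [← sum_mul, mul_assoc]
  refine mul_le_mul_of_nonneg_left ?_ (by positivity)
  have : 0 ≤ ∑ j ∈ range m, C j := sum_nonneg fun j _ => hC0 j
  nlinarith [mul_nonneg this ht0]

/-- The higher derivatives of the magnetizations along `t` are of the order of the largest entry
of `t`, in mean square. -/
theorem lintegral_sum_sq_dirD_mag_le (m : ℕ) (hm : 1 ≤ m) :
    ∃ K : ℝ, 0 ≤ K ∧ ∀ (N : ℕ) (b : ℝ), 1 ≤ N → b ^ 2 * N ≤ 1 / 65536 →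
      ∀ (t : Fin N → ℝ) (τ : ℝ), ∑ i, t i ^ 2 = 1 → (∀ i, t i ^ 2 ≤ τ) →
        ∀ (A : Finset (Fin N)) (h : Fin N → ℝ),
        ∫⁻ g, ENNReal.ofReal (∑ j, dirD (lin t) (m + 1) (mag j) (pairEnergy b A g + lin h) ^ 2)
          ∂gaussN N ≤ ENNReal.ofReal (K * (τ + b ^ 2)) := by
  obtain ⟨K, q, hK, hq, hsite⟩ := sq_dirD_mag_le m hm
  obtain ⟨C2, hC20, hC2⟩ := lintegral_cavitySize_pow_le m 2 (by norm_num)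
  obtain ⟨Cq, hCq0, hCq⟩ := lintegral_cavitySize_pow_le m q (by omega)
  refine ⟨2 * (K * (C2 + Cq)), by positivity, fun N b hN hb t τ ht hτ => ?_⟩
  have hNr : (1 : ℝ) ≤ N := by exact_mod_cast hN
  have hτ0 : 0 ≤ τ := (sq_nonneg _).trans (hτ ⟨0, hN⟩)
  have hb1 : b ^ 2 ≤ 1 := by nlinarith [sq_nonneg b]
  have ht1 : ∀ i, t i ^ 2 ≤ 1 := fun i => ht ▸ single_le_sum (f := fun i => t i ^ 2)
    (fun _ _ => sq_nonneg _) (mem_univ i)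
  have htp : ∀ p, 2 ≤ p → ∑ i, t i ^ (2 * p) ≤ τ := fun p hp => by
    calc ∑ i, t i ^ (2 * p) ≤ ∑ i, t i ^ 2 * τ := sum_le_sum fun i _ => by
          rw [pow_mul]
          refine (pow_le_pow_of_le_one (sq_nonneg _) (ht1 i) hp).trans ?_
          rw [sq (t i ^ 2)]
          exact mul_le_mul_of_nonneg_left (hτ i) (sq_nonneg _)
      _ = τ := by rw [← sum_mul, ht, one_mul]
  have hbp : ∀ p, 2 ≤ p → N * b ^ (2 * p) ≤ b ^ 2 := fun p hp => by
    have h1 : b ^ (2 * p) ≤ (b ^ 2) ^ 2 := by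
      rw [pow_mul]; exact pow_le_pow_of_le_one (sq_nonneg _) hb1 hp
    nlinarith [sq_nonneg b]
  have hpow : ∀ p, 2 ≤ p → ∑ i, (t i ^ (2 * p) + b ^ (2 * p)) ≤ τ + b ^ 2 := fun p hp => by
    rw [sum_add_distrib, sum_const, card_univ, Fintype.card_fin, nsmul_eq_mul]
    exact add_le_add (htp p hp) (hbp p hp)
  have hpos : ∀ p i, 0 ≤ t i ^ (2 * p) + b ^ (2 * p) := fun p i => by
    rw [pow_mul, pow_mul]; positivity
  set c : ℝ := 2 * (K * (C2 + Cq)) * (τ + b ^ 2) with hc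
  have hc0 : 0 ≤ c := by positivity
  intro A
  induction A using Finset.strongInduction with
  | H A ih => ?_
  intro h
  have hi : ∀ i : Fin N, ∫⁻ g, ENNReal.ofReal (dirD (lin t) (m + 1) (mag i)
      (pairEnergy b A g + lin h) ^ 2) ∂gaussN N ≤ ENNReal.ofReal (2 * (20 * b ^ 2 * c) +
        K * (C2 * (t i ^ (2 * 2) + b ^ (2 * 2)) + Cq * (t i ^ (2 * q) + b ^ (2 * q)))) := by
    intro i
    have hni : i ∉ A.erase i := notMem_erase i A
    refine (lintegral_mono fun g => ENNReal.ofReal_le_ofReal (hsite N b A i g h t)).trans ?_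
    have hX : ∫⁻ g, ENNReal.ofReal ((if i ∈ A then phiDiff t (m + 1) (pairEnergy b (A.erase i) g +
        lin h) (rowField b (A.erase i) (rowOf i g)) else 0) ^ 2) ∂gaussN N ≤
        ENNReal.ofReal (20 * b ^ 2 * c) := by
      by_cases hiA : i ∈ A
      · simp only [if_pos hiA]
        exact lintegral_phiDiff_row_sq_le b hni h t (m + 1) (ih _ (erase_ssubset hiA))
      · simp [if_neg hiA]
    have hXm : Measurable fun g => (if i ∈ A then phiDiff t (m + 1) (pairEnergy b (A.erase i) g +
        lin h) (rowField b (A.erase i) (rowOf i g)) else 0) := by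
      by_cases hiA : i ∈ A
      · simp only [if_pos hiA]
        exact measurable_phiDiff_row t h (m + 1) b (A.erase i) i
      · simp only [if_neg hiA]
        exact measurable_const
    refine lintegral_ofReal_add_le ((hXm.pow_const 2).const_mul 2) (by positivity)
      (mul_nonneg hK (add_nonneg (mul_nonneg hC20 (hpos 2 i)) (mul_nonneg hCq0 (hpos q i))))
      (lintegral_ofReal_const_mul_le zero_le_two hX) (lintegral_ofReal_const_mul_le hK ?_)
    exact lintegral_ofReal_add_le ((measurable_cavitySize_row t h m b _ i).pow_const _)
      (mul_nonneg hC20 (hpos 2 i)) (mul_nonneg hCq0 (hpos q i))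
      (hC2 N b hN hb _ i hni h t ht) (hCq N b hN hb _ i hni h t ht)
  refine (lintegral_ofReal_sum_le univ (fun i => (measurable_dirD_mag t h (m + 1) b A i).pow_const 2)
    (fun i => add_nonneg (by positivity) (mul_nonneg hK (add_nonneg (mul_nonneg hC20 (hpos 2 i))
      (mul_nonneg hCq0 (hpos q i))))) hi).trans (ENNReal.ofReal_le_ofReal ?_)
  rw [sum_add_distrib, sum_const, card_univ, Fintype.card_fin, nsmul_eq_mul, ← mul_sum,
    sum_add_distrib, ← mul_sum, ← mul_sum]
  have e1 := mul_le_mul_of_nonneg_left (hpow 2 le_rfl) hC20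
  have e2 := mul_le_mul_of_nonneg_left (hpow q hq) hCq0
  have e3 := mul_le_mul_of_nonneg_left (add_le_add e1 e2) hK
  have e4 := mul_le_mul_of_nonneg_left hb (mul_nonneg (by norm_num : (0 : ℝ) ≤ 40) hc0)
  linarith

end DerivativeDecay

section PairMoments

theorem avg_prod_mul {Ω Ω' : Type} [Fintype Ω] [Fintype Ω'] (e f : Ω → ℝ) (e' f' : Ω' → ℝ) :
    avg (fun p : Ω × Ω' => e p.1 + e' p.2) (fun p => f p.1 * f' p.2) = avg e f * avg e' f' := by
  simp only [avg, Zs, Fintype.sum_prod_type, Real.exp_add]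
  rw [div_mul_div_comm, Fintype.sum_mul_sum, Fintype.sum_mul_sum]
  congr 1
  exact sum_congr rfl fun x _ => sum_congr rfl fun y _ => by ring

theorem avg_prod_fst {Ω Ω' : Type} [Fintype Ω] [Fintype Ω'] [Nonempty Ω'] (e f : Ω → ℝ)
    (e' : Ω' → ℝ) : avg (fun p : Ω × Ω' => e p.1 + e' p.2) (fun p => f p.1) = avg e f := by
  simpa [avg_const] using avg_prod_mul e f e' fun _ => 1

theorem avg_prod_snd {Ω Ω' : Type} [Fintype Ω] [Fintype Ω'] [Nonempty Ω] (e : Ω → ℝ)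
    (e' f' : Ω' → ℝ) : avg (fun p : Ω × Ω' => e p.1 + e' p.2) (fun p => f' p.2) = avg e' f' := by
  simpa [avg_const] using avg_prod_mul e (fun _ => 1) e' f'

variable {N : ℕ}

/-- The difference of the values of `lin t` on a pair of replicas. -/
def pairLin (t : Fin N → ℝ) (p : Cfg N × Cfg N) : ℝ := lin t p.1 - lin t p.2

/-- The moments of `pairLin t` under two independent replicas. -/
def pairMoment (t : Fin N → ℝ) (k : ℕ) (e : Cfg N → ℝ) : ℝ :=
  avg (fun p : Cfg N × Cfg N => e p.1 + e p.2) fun p => pairLin t p ^ k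

theorem contDiff_pairMoment (t : Fin N → ℝ) (k : ℕ) :
    ContDiff ℝ (⊤ : ℕ∞) (pairMoment t k) := by
  refine (contDiff_avg _).comp (contDiff_pi.2 fun p => ?_)
  exact (contDiff_apply ℝ ℝ p.1).add (contDiff_apply ℝ ℝ p.2)

/-- The derivative of the log-Laplace transform of `pairLin t`. -/
def pairMean (t : Fin N → ℝ) (e : Cfg N → ℝ) (u : ℝ) : ℝ :=
  avg (e + u • lin t) (lin t) - avg (e + (-u) • lin t) (lin t)

theorem contDiff_sum_mag (t : Fin N → ℝ) : ContDiff ℝ (⊤ : ℕ∞) fun x : Cfg N → ℝ => avg x (lin t) :=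
  contDiff_avg _

theorem iteratedDeriv_pairMean (t : Fin N → ℝ) (e : Cfg N → ℝ) (a : ℕ) :
    iteratedDeriv a (pairMean t e) 0 =
      (1 - (-1) ^ a) * ∑ i, t i * dirD (lin t) a (mag i) e := by
  have hs : ContDiff ℝ (⊤ : ℕ∞) fun u : ℝ => avg (e + u • lin t) (lin t) :=
    (contDiff_sum_mag t).comp (contDiff_const.add (contDiff_id.smul contDiff_const))
  have hs' : ContDiff ℝ (⊤ : ℕ∞) fun u : ℝ => avg (e + (-u) • lin t) (lin t) :=
    hs.comp contDiff_neg
  have h0 : iteratedDeriv a (fun u : ℝ => avg (e + u • lin t) (lin t)) 0 =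
      ∑ i, t i * dirD (lin t) a (mag i) e := by
    rw [← dirD_eq_iteratedDeriv (lin t) (contDiff_sum_mag t)]
    simp_rw [avg_lin]
    exact dirD_sum (lin t) univ t (fun i => contDiff_mag i) a e
  unfold pairMean
  rw [iteratedDeriv_fun_sub (hs.contDiffAt.of_le (by exact_mod_cast le_top))
    (hs'.contDiffAt.of_le (by exact_mod_cast le_top)),
    iteratedDeriv_comp_neg a fun u : ℝ => avg (e + u • lin t) (lin t), neg_zero, h0, smul_eq_mul]
  ring

theorem pairMoment_succ (t : Fin N → ℝ) (e : Cfg N → ℝ) (k : ℕ) :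
    pairMoment t (k + 1) e = ∑ a ∈ range (k + 1), (k.choose a : ℝ) *
      iteratedDeriv a (pairMean t e) 0 * pairMoment t (k - a) e := by
  set e2 : Cfg N × Cfg N → ℝ := fun p => e p.1 + e p.2 with he2
  set m : ℝ → ℝ := fun u => avg e2 fun p => 1 * Real.exp (u * pairLin t p) with hm
  have hms : ContDiff ℝ (⊤ : ℕ∞) m := contDiff_avg_exp _ _ _
  have hmk : ∀ k, iteratedDeriv k m 0 = pairMoment t k e := fun k => by
    rw [hm, iteratedDeriv_avg_exp_zero]; simp [pairMoment, he2]
  have hps : ContDiff ℝ (⊤ : ℕ∞) (pairMean t e) :=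
    ((contDiff_sum_mag t).comp (contDiff_const.add (contDiff_id.smul contDiff_const))).sub
      ((contDiff_sum_mag t).comp (contDiff_const.add (contDiff_neg.smul contDiff_const)))
  have hd : deriv m = pairMean t e * m := by
    rw [← iteratedDeriv_one, hm, iteratedDeriv_avg_exp]
    funext u
    have h1 : avg (e2 + u • pairLin t) (pairLin t) = pairMean t e u := by
      have : e2 + u • pairLin t = fun p => (e + u • lin t) p.1 + (e + (-u) • lin t) p.2 := by
        funext p
        simp only [he2, Pi.add_apply, Pi.smul_apply, smul_eq_mul, pairLin]
        ring
      rw [this, pairMean, ← avg_prod_fst (e + u • lin t) (lin t) (e + (-u) • lin t),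
        ← avg_prod_snd (e + u • lin t) (e + (-u) • lin t) (lin t), ← avg_sub]
      rfl
    have hpos : 0 < avg e2 fun p => Real.exp ((u • pairLin t) p) :=
      div_pos (sum_pos (fun p _ => mul_pos (Real.exp_pos _) (Real.exp_pos _)) univ_nonempty)
        (Zs_pos _)
    rw [Pi.mul_apply, ← h1, avg_add_energy, eq_comm]
    simp only [one_mul, pow_one, Pi.smul_apply, smul_eq_mul] at hpos ⊢
    exact div_mul_cancel₀ _ hpos.ne'
  rw [← hmk (k + 1), iteratedDeriv_succ', hd,
    iteratedDeriv_mul (hps.contDiffAt.of_le (by exact_mod_cast le_top))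
      (hms.contDiffAt.of_le (by exact_mod_cast le_top))]
  exact sum_congr rfl fun a _ => by rw [hmk]

theorem abs_iteratedDeriv_pairMean_le {t : Fin N → ℝ} (ht : ∑ i, t i ^ 2 = 1) (e : Cfg N → ℝ)
    (a : ℕ) : |iteratedDeriv a (pairMean t e) 0| ≤
      2 * Real.sqrt (∑ i, dirD (lin t) a (mag i) e ^ 2) := by
  rw [iteratedDeriv_pairMean, abs_mul]
  refine mul_le_mul ?_ ?_ (abs_nonneg _) zero_le_two
  · refine (abs_sub _ _).trans ?_
    rw [abs_one, abs_pow, abs_neg, abs_one, one_pow]; norm_num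
  · refine Real.abs_le_sqrt ?_
    have := sum_mul_sq_le_sq_mul_sq univ t fun i => dirD (lin t) a (mag i) e
    rwa [ht, one_mul] at this

theorem abs_pairMoment_sub_le {t : Fin N → ℝ} (ht : ∑ i, t i ^ 2 = 1) (e : Cfg N → ℝ) (p : ℕ) :
    |pairMoment t (p + 3) e - (p + 2) * (pairMoment t 2 e * pairMoment t (p + 1) e)| ≤
      ∑ a ∈ range (p + 1), 2 ^ (p + 3) * Real.sqrt (∑ i, dirD (lin t) (a + 2) (mag i) e ^ 2) *
        |pairMoment t (p - a) e| := by
  have hz : iteratedDeriv 0 (pairMean t e) 0 = 0 := by rw [iteratedDeriv_pairMean]; simp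
  have hm0 : pairMoment t 0 e = 1 := by simp [pairMoment, avg_const]
  have h2 : pairMoment t 2 e = iteratedDeriv 1 (pairMean t e) 0 := by
    rw [pairMoment_succ, sum_range_succ, sum_range_one, hz]; simp [hm0]
  rw [pairMoment_succ, sum_range_succ', sum_range_succ', hz, h2]
  have hsimp : ∀ x y : ℝ, x + ((p + 2).choose (0 + 1) : ℝ) *
      iteratedDeriv (0 + 1) (pairMean t e) 0 * pairMoment t (p + 2 - (0 + 1)) e +
      ((p + 2).choose 0 : ℝ) * 0 * y - (p + 2) * (iteratedDeriv 1 (pairMean t e) 0 *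
        pairMoment t (p + 1) e) = x := fun x y => by
    rw [zero_add, Nat.choose_one_right, show p + 2 - 1 = p + 1 by omega]
    push_cast
    ring
  rw [hsimp]
  refine (abs_sum_le_sum_abs _ _).trans (sum_le_sum fun a ha => ?_)
  rw [abs_mul, abs_mul, Nat.abs_cast, show p + 2 - (a + 1 + 1) = p - a by omega]
  refine mul_le_mul_of_nonneg_right ?_ (abs_nonneg _)
  rw [pow_succ (2 : ℝ) (p + 2), mul_assoc]
  refine mul_le_mul ?_ (abs_iteratedDeriv_pairMean_le ht e _) (abs_nonneg _) (by positivity)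
  exact_mod_cast Nat.choose_le_two_pow (p + 2) (a + 1 + 1)

theorem abs_pairMoment_le (q : ℕ) :
    ∃ K : ℝ, 0 ≤ K ∧ ∀ (N : ℕ) (e : Cfg N → ℝ) (R : ℝ), RadBound e R →
      ∀ h t : Fin N → ℝ, ∑ i, t i ^ 2 = 1 → |pairMoment t q (e + lin h)| ≤ K * R ^ (2 * q) := by
  refine ⟨1 + 2 ^ (2 * q) * (2 * ((2 * q).factorial * 6)), by positivity,
    fun N e R hR h t ht => ?_⟩
  have hR1 : (1 : ℝ) ≤ R ^ (2 * q) := one_le_pow₀ hR.one_le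
  set e' := e + lin h with he'
  set c := avg e' (lin t) with hc
  have hm := hR.avg_centered_pow_le h t ht q
  have hpt : ∀ p : Cfg N × Cfg N, |pairLin t p ^ q| ≤ 1 + 2 ^ (2 * q) *
      ((lin t p.1 - c) ^ (2 * q) + (lin t p.2 - c) ^ (2 * q)) := fun p => by
    have h1 : |pairLin t p ^ q| ≤ 1 + pairLin t p ^ (2 * q) := by
      rw [mul_comm, pow_mul]
      nlinarith [sq_nonneg (|pairLin t p ^ q| - 1), sq_abs (pairLin t p ^ q),
        abs_nonneg (pairLin t p ^ q)]
    have h2 : |pairLin t p| ≤ |lin t p.1 - c| + |lin t p.2 - c| := by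
      rw [show pairLin t p = (lin t p.1 - c) - (lin t p.2 - c) by rw [pairLin]; ring]
      exact abs_sub _ _
    have h3 := pow_le_pow_left₀ (abs_nonneg _) h2 (2 * q)
    have h4 := add_pow_le (abs_nonneg (lin t p.1 - c)) (abs_nonneg (lin t p.2 - c)) (2 * q)
    simp only [(even_two_mul q).pow_abs] at h3 h4
    have h5 : (2 : ℝ) ^ (2 * q - 1) ≤ 2 ^ (2 * q) := pow_le_pow_right₀ one_le_two (by omega)
    have h6 : 0 ≤ (lin t p.1 - c) ^ (2 * q) + (lin t p.2 - c) ^ (2 * q) :=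
      add_nonneg ((even_two_mul q).pow_nonneg _) ((even_two_mul q).pow_nonneg _)
    nlinarith
  unfold pairMoment
  refine (abs_avg_le _ _).trans ((avg_mono hpt).trans ?_)
  rw [avg_add, avg_const, avg_const_mul, avg_add,
    avg_prod_fst e' (fun σ => (lin t σ - c) ^ (2 * q)) e',
    avg_prod_snd e' e' (fun σ => (lin t σ - c) ^ (2 * q))]
  have h7 := mul_le_mul_of_nonneg_left (add_le_add hm hm) (by positivity : (0 : ℝ) ≤ 2 ^ (2 * q))
  calc _ ≤ R ^ (2 * q) + 2 ^ (2 * q) * ((2 * q).factorial * 6 * R ^ (2 * q) +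
        (2 * q).factorial * 6 * R ^ (2 * q)) := add_le_add hR1 h7
    _ = _ := by ring

end PairMoments

section MomentRecursion

variable {N : ℕ}

theorem exists_abs_prod_pairMoment_le {ι : Type*} (s : Finset ι) (k : ι → ℕ) :
    ∃ (K : ℝ) (q : ℕ), 0 ≤ K ∧ ∀ (N : ℕ) (e : Cfg N → ℝ) (R : ℝ), RadBound e R →
      ∀ h t : Fin N → ℝ, ∑ i, t i ^ 2 = 1 →
        |∏ j ∈ s, pairMoment t (k j) (e + lin h)| ≤ K * R ^ q := by
  choose K hK0 hK using fun j => abs_pairMoment_le (k j)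
  refine ⟨∏ j ∈ s, K j, ∑ j ∈ s, 2 * k j, prod_nonneg fun j _ => hK0 j,
    fun N e R hR h t ht => ?_⟩
  rw [abs_prod, ← prod_pow_eq_pow_sum, ← prod_mul_distrib]
  exact prod_le_prod (fun _ _ => abs_nonneg _) fun j _ => hK j N e R hR h t ht

theorem measurable_pairMoment (t h : Fin N → ℝ) (k : ℕ) (b : ℝ) (A : Finset (Fin N)) :
    Measurable fun g => pairMoment t k (pairEnergy b A g + lin h) :=
  (contDiff_pairMoment t k).continuous.measurable.comp
    ((measurable_pairEnergy b A).add_const (lin h))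

theorem integrable_prod_pairMoment {ι : Type*} (s : Finset ι) (k : ι → ℕ) (b : ℝ) (hN : 1 ≤ N)
    {t : Fin N → ℝ} (ht : ∑ i, t i ^ 2 = 1) (h : Fin N → ℝ) :
    Integrable (fun g => ∏ j ∈ s, pairMoment t (k j) (pairEnergy b univ g + lin h)) (gaussN N) := by
  obtain ⟨K, q, -, hK⟩ := exists_abs_prod_pairMoment_le s k
  refine ((integrable_radius_pow b hN q).const_mul K).mono'
    (measurable_prod s fun j _ => measurable_pairMoment t h (k j) b univ).aestronglyMeasurable
    (ae_of_all _ fun g => ?_)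
  exact hK N _ _ (radBound_radius b hN g univ) h t ht

theorem mul_mul_le_of_pos {x y τ : ℝ} (hτ : 0 < τ) : x * y ≤ τ * y ^ 2 + τ⁻¹ * x ^ 2 := by
  have h2 : τ * y ^ 2 + τ⁻¹ * x ^ 2 = τ * (y ^ 2 + (τ⁻¹ * x) ^ 2) := by field_simp
  rw [h2, show x * y = τ * ((τ⁻¹ * x) * y) by field_simp]
  refine mul_le_mul_of_nonneg_left ?_ hτ.le
  nlinarith [sq_nonneg (τ⁻¹ * x - y), sq_nonneg (τ⁻¹ * x), sq_nonneg y]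

/-- Replacing `m_{p+3}` by `(p + 2) m_2 m_{p+1}` in a product of pair moments costs at most a
multiple of the largest coefficient of the linear statistic. -/
theorem abs_integral_pairMoment_sub_le {ι : Type*} (s : Finset ι) (k : ι → ℕ) (p : ℕ) :
    ∃ K : ℝ, ∀ (N : ℕ) (b : ℝ), 1 ≤ N → b ^ 2 * N ≤ 1 / 65536 → ∀ (t : Fin N → ℝ) (τ : ℝ),
      ∑ i, t i ^ 2 = 1 → 0 < τ → (∀ i, t i ^ 2 ≤ τ ^ 2) → b ^ 2 ≤ τ ^ 2 → ∀ h : Fin N → ℝ,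
        |∫ g, (pairMoment t (p + 3) (pairEnergy b univ g + lin h) - (p + 2) *
          (pairMoment t 2 (pairEnergy b univ g + lin h) *
            pairMoment t (p + 1) (pairEnergy b univ g + lin h))) *
          ∏ j ∈ s, pairMoment t (k j) (pairEnergy b univ g + lin h) ∂gaussN N| ≤ K * τ := by
  obtain ⟨P, q, hP0, hP⟩ := exists_abs_prod_pairMoment_le s k
  choose C hC0 hC using abs_pairMoment_le
  choose V hV0 hV using fun a : ℕ => lintegral_sum_sq_dirD_mag_le (a + 1) (by omega)
  choose I hI0 hI using integral_radius_pow_le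
  set D : ℕ → ℝ := fun a => 2 ^ (p + 3) * (C (p - a) * P) with hD
  set r : ℕ → ℕ := fun a => 2 * (2 * (p - a) + q) with hr
  refine ⟨∑ a ∈ range (p + 1), (D a ^ 2 * I (r a) + V a * 2), fun N b hN hb t τ ht hτ htτ hbτ h => ?_⟩
  set E : (Fin N → Fin N → ℝ) → Cfg N → ℝ := fun g => pairEnergy b univ g + lin h with hE
  set W : ℕ → (Fin N → Fin N → ℝ) → ℝ := fun a g => ∑ i, dirD (lin t) (a + 2) (mag i) (E g) ^ 2
    with hW
  have hW0 : ∀ a g, 0 ≤ W a g := fun a g => sum_nonneg fun i _ => sq_nonneg _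
  have hWm : ∀ a, Measurable (W a) := fun a =>
    measurable_fun_sum _ fun i _ => (measurable_dirD_mag t h (a + 2) b univ i).pow_const 2
  have hRm := measurable_radius (N := N) b
  have hpt : ∀ g, |(pairMoment t (p + 3) (E g) - (p + 2) *
      (pairMoment t 2 (E g) * pairMoment t (p + 1) (E g))) * ∏ j ∈ s, pairMoment t (k j) (E g)| ≤
      ∑ a ∈ range (p + 1), (τ * D a ^ 2 * radius b g ^ r a + τ⁻¹ * W a g) := fun g => by
    have hR := radBound_radius b hN g univ
    have hR1 : 0 ≤ radius b g := zero_le_one.trans hR.one_le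
    rw [abs_mul]
    refine (mul_le_mul_of_nonneg_right (abs_pairMoment_sub_le ht (E g) p) (abs_nonneg _)).trans ?_
    rw [sum_mul]
    refine sum_le_sum fun a _ => ?_
    have h1 : |pairMoment t (p - a) (E g)| * |∏ j ∈ s, pairMoment t (k j) (E g)| ≤
        C (p - a) * radius b g ^ (2 * (p - a)) * (P * radius b g ^ q) :=
      mul_le_mul (hC _ N _ _ hR h t ht) (hP N _ _ hR h t ht) (abs_nonneg _)
        (mul_nonneg (hC0 _) (pow_nonneg hR1 _))
    have h2 := mul_le_mul_of_nonneg_left h1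
      (mul_nonneg (by positivity : (0 : ℝ) ≤ 2 ^ (p + 3)) (Real.sqrt_nonneg (W a g)))
    have h3 := mul_mul_le_of_pos (x := Real.sqrt (W a g))
      (y := D a * radius b g ^ (2 * (p - a) + q)) hτ
    rw [Real.sq_sqrt (hW0 a g), mul_pow, ← pow_mul, mul_comm _ 2] at h3
    rw [hD, hr] at *
    rw [pow_add (radius b g)] at h3
    simp only [hW] at *
    linarith
  have hlin : ∫⁻ g, ENNReal.ofReal (∑ a ∈ range (p + 1),
      (τ * D a ^ 2 * radius b g ^ r a + τ⁻¹ * W a g)) ∂gaussN N ≤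
      ENNReal.ofReal (∑ a ∈ range (p + 1),
        (τ * D a ^ 2 * I (r a) + τ⁻¹ * (V a * (τ ^ 2 + b ^ 2)))) := by
    refine lintegral_ofReal_sum_le _
      (fun a => (((hRm.pow_const _).const_mul _).add ((hWm a).const_mul _)))
      (fun a => add_nonneg (mul_nonneg (by positivity) (hI0 _))
        (mul_nonneg (by positivity) (mul_nonneg (hV0 a) (by positivity)))) fun a => ?_
    refine lintegral_ofReal_add_le ((hRm.pow_const _).const_mul _)
      (mul_nonneg (by positivity) (hI0 _))
      (mul_nonneg (by positivity) (mul_nonneg (hV0 a) (by positivity)))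
      (lintegral_ofReal_const_mul_le (by positivity) ?_)
      (lintegral_ofReal_const_mul_le (by positivity) (hV a N b hN hb t _ ht htτ univ h))
    rw [← ofReal_integral_eq_lintegral_ofReal (integrable_radius_pow b hN _)
      (ae_of_all _ fun g => pow_nonneg (zero_le_one.trans (one_le_radius b hN g)) _)]
    exact ENNReal.ofReal_le_ofReal (hI _ N b hN hb)
  have hsum : ∑ a ∈ range (p + 1), (τ * D a ^ 2 * I (r a) + τ⁻¹ * (V a * (τ ^ 2 + b ^ 2))) ≤
      (∑ a ∈ range (p + 1), (D a ^ 2 * I (r a) + V a * 2)) * τ := by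
    rw [sum_mul]
    refine sum_le_sum fun a _ => ?_
    have h1 : τ⁻¹ * (V a * (τ ^ 2 + b ^ 2)) ≤ τ⁻¹ * (V a * (τ ^ 2 + τ ^ 2)) := by
      have := hV0 a
      gcongr
    have h2 : τ⁻¹ * (V a * (τ ^ 2 + τ ^ 2)) = V a * 2 * τ := by field_simp; ring
    linarith
  have h0 : 0 ≤ (∑ a ∈ range (p + 1), (D a ^ 2 * I (r a) + V a * 2)) * τ :=
    mul_nonneg (sum_nonneg fun a _ => add_nonneg (mul_nonneg (sq_nonneg _) (hI0 _))
      (mul_nonneg (hV0 a) zero_le_two)) hτ.le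
  rw [← Real.norm_eq_abs]
  refine (norm_integral_le_lintegral_norm _).trans (ENNReal.toReal_le_of_le_ofReal h0 ?_)
  exact (lintegral_mono fun g => ENNReal.ofReal_le_ofReal (hpt g)).trans
    (hlin.trans (ENNReal.ofReal_le_ofReal hsum))

end MomentRecursion

section GibbsFactorization

variable {N : ℕ}

theorem negH_eq (β h : ℝ) (g : Fin N → Fin N → ℝ) :
    negH N β h g = pairEnergy (β / Real.sqrt N) univ g + lin fun _ => h := by
  funext σ
  simp only [negH, pairEnergy, quadForm, lin, Pi.add_apply, mem_univ, if_true, mul_sum]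

theorem Sbar_eq_pairLin {m : ℕ} (t : Fin N → ℝ) (σs : Fin m × Fin 2 → Cfg N) (l : Fin m) :
    Sbar N m t σs l = pairLin t (σs (l, 0), σs (l, 1)) := by
  simp only [Sbar, pairLin, lin, mul_sub, sum_sub_distrib]

theorem gibbs_prod_Sbar_pow (β h : ℝ) (g : Fin N → Fin N → ℝ) (t : Fin N → ℝ) {m : ℕ}
    (p : Fin m → ℕ) :
    gibbs N β h g (fun σs : Fin m × Fin 2 → Cfg N => ∏ l, Sbar N m t σs l ^ p l) =
      ∏ l, pairMoment t (p l) (negH N β h g) := by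
  set e := negH N β h g with he
  let φ : (Fin m × Fin 2 → Cfg N) ≃ (Fin m → Cfg N × Cfg N) :=
    (Equiv.curry _ _ _).trans (Equiv.piCongrRight fun _ => finTwoArrowEquiv _)
  have hZ : Zs (fun x : Cfg N × Cfg N => e x.1 + e x.2) = Zs e ^ 2 := by
    simp only [Zs, Real.exp_add, Fintype.sum_prod_type, sq, sum_mul_sum]
  unfold gibbs pairMoment avg
  rw [prod_div_distrib, hZ, prod_const, card_univ, Fintype.card_fin, ← pow_mul,
    Fintype.card_prod, Fintype.card_fin, Fintype.card_fin, mul_comm 2 m, Fintype.prod_sum]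
  congr 1
  refine Fintype.sum_equiv φ _ _ fun σs => ?_
  rw [Fintype.prod_prod_type, ← prod_mul_distrib]
  refine prod_congr rfl fun l _ => ?_
  rw [Fin.prod_univ_two, ← Real.exp_add, Sbar_eq_pairLin]
  rfl

end GibbsFactorization

/-- the key induction step (24) in the proof of Theorem 1: for even
`k₁,…,k_n` with `k₁ ≥ 4`,
`|E⟨∏_{l=1}^n S_l^{k_l}⟩ − (k₁−1)·E⟨S₀² S₁^{k₁−2} ∏_{l=2}^n S_l^{k_l}⟩| ≤ K·max_i|t_i|`.
Here the replica pairs are indexed by `Fin (n+2) × Fin 2`: the pair `0` carries `S₀` and the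
pair `j+1` carries `S_{j+1}` with exponent `kvec j` (so `k₁ = kvec 0`); the number of `S_l`'s
with `l ≥ 1` is `n+1 ≥ 1`. -/
theorem stmt15 :
    ∃ β₀ : ℝ, 0 < β₀ ∧
      ∀ n : ℕ, ∀ kvec : Fin (n + 1) → ℕ, (∀ j, Even (kvec j)) → 4 ≤ kvec 0 →
        ∃ K : ℝ, ∀ β : ℝ, 0 < β → β < β₀ → ∀ M : ℕ, ∀ h : ℝ, 0 ≤ h →
          ∀ t : Fin (M + 1) → ℝ, (∑ i, t i ^ 2) = 1 →
            |nu (M + 1) β h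
                (fun σs : Fin (n + 2) × Fin 2 → Cfg (M + 1) =>
                  ∏ j : Fin (n + 1), Sbar (M + 1) (n + 2) t σs j.succ ^ kvec j) -
              ((kvec 0 : ℝ) - 1) *
                nu (M + 1) β h
                  (fun σs : Fin (n + 2) × Fin 2 → Cfg (M + 1) =>
                    Sbar (M + 1) (n + 2) t σs 0 ^ 2 *
                      Sbar (M + 1) (n + 2) t σs 1 ^ (kvec 0 - 2) *
                      ∏ j ∈ Finset.univ.erase (0 : Fin (n + 1)),
                        Sbar (M + 1) (n + 2) t σs j.succ ^ kvec j)| ≤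
              K * ⨆ i, |t i| := by
  refine ⟨1 / 256, by norm_num, fun n kvec _ hk => ?_⟩
  obtain ⟨p, hp⟩ : ∃ p, kvec 0 = p + 3 := ⟨kvec 0 - 3, by omega⟩
  obtain ⟨K, hK⟩ := abs_integral_pairMoment_sub_le (univ.erase (0 : Fin (n + 1))) kvec p
  refine ⟨K, fun β hβ hβ0 M h _ t ht => ?_⟩
  set b : ℝ := β / Real.sqrt (M + 1 : ℕ) with hb
  set τ : ℝ := ⨆ i, |t i| with hτ
  have hN : (0 : ℝ) < (M + 1 : ℕ) := by positivity
  have hbN : b ^ 2 * (M + 1 : ℕ) = β ^ 2 := by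
    rw [hb, div_pow, Real.sq_sqrt hN.le, div_mul_cancel₀ _ hN.ne']
  have hτi : ∀ i, |t i| ≤ τ := le_ciSup (Set.finite_range _).bddAbove
  have htτ : ∀ i, t i ^ 2 ≤ τ ^ 2 := fun i => sq_le_sq' (abs_le.1 (hτi i)).1 (abs_le.1 (hτi i)).2
  have hτN : 1 ≤ τ ^ 2 * (M + 1 : ℕ) := by
    rw [← ht]
    refine (sum_le_sum fun i _ => htτ i).trans_eq ?_
    rw [sum_const, card_univ, Fintype.card_fin, nsmul_eq_mul, mul_comm]
  have hτ0 : 0 < τ := by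
    refine lt_of_le_of_ne ((abs_nonneg _).trans (hτi 0)) fun h0 => ?_
    rw [← h0] at hτN
    norm_num at hτN
  have hβ2 : β ^ 2 ≤ 1 / 65536 := by nlinarith
  have hbτ : b ^ 2 ≤ τ ^ 2 := le_of_mul_le_mul_right (by linarith) hN
  have hmain := hK (M + 1) b (by omega) (hbN.trans_le hβ2) t τ ht hτ0 htτ hbτ fun _ => h
  set E : (Fin (M + 1) → Fin (M + 1) → ℝ) → Cfg (M + 1) → ℝ :=
    fun g => pairEnergy b univ g + lin fun _ => h with hE
  have hprod : ∀ f : Fin (n + 1) → ℝ, ∏ j, f j = f 0 * ∏ j ∈ univ.erase 0, f j := fun f =>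
    (mul_prod_erase univ f (mem_univ 0)).symm
  have hG : ∀ (q : Fin (n + 2) → ℕ) g, gibbs (M + 1) β h g
      (fun σs : Fin (n + 2) × Fin 2 → Cfg (M + 1) => ∏ l, Sbar (M + 1) (n + 2) t σs l ^ q l) =
      ∏ l, pairMoment t (q l) (E g) := fun q g => by
    rw [gibbs_prod_Sbar_pow, negH_eq]
  have hint : ∀ q : Fin (n + 2) → ℕ, Integrable (fun g => ∏ l, pairMoment t (q l) (E g))
      (gaussN (M + 1)) := fun q => integrable_prod_pairMoment univ q b (by omega) ht fun _ => h
  set q₁ : Fin (n + 2) → ℕ := Fin.cons 0 kvec with hq₁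
  set q₂ : Fin (n + 2) → ℕ := Fin.cons 2 (Function.update kvec 0 (kvec 0 - 2)) with hq₂
  have hup : ∀ f : Fin (n + 1) → ℕ → ℝ,
      ∏ j ∈ univ.erase 0, f j (Function.update kvec 0 (kvec 0 - 2) j) =
        ∏ j ∈ univ.erase 0, f j (kvec j) := fun f =>
    prod_congr rfl fun j hj => by rw [Function.update_of_ne (ne_of_mem_erase hj)]
  have h₁ : (fun σs : Fin (n + 2) × Fin 2 → Cfg (M + 1) =>
      ∏ j : Fin (n + 1), Sbar (M + 1) (n + 2) t σs j.succ ^ kvec j) =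
      fun σs => ∏ l, Sbar (M + 1) (n + 2) t σs l ^ q₁ l := by
    funext σs
    rw [Fin.prod_univ_succ (n := n + 1)]
    simp only [hq₁, Fin.cons_zero, Fin.cons_succ, pow_zero, one_mul]
  have h₂ : (fun σs : Fin (n + 2) × Fin 2 → Cfg (M + 1) =>
      Sbar (M + 1) (n + 2) t σs 0 ^ 2 * Sbar (M + 1) (n + 2) t σs 1 ^ (kvec 0 - 2) *
        ∏ j ∈ Finset.univ.erase (0 : Fin (n + 1)), Sbar (M + 1) (n + 2) t σs j.succ ^ kvec j) =
      fun σs => ∏ l, Sbar (M + 1) (n + 2) t σs l ^ q₂ l := by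
    funext σs
    rw [Fin.prod_univ_succ, hprod]
    simp only [hq₂, Fin.cons_zero, Fin.cons_succ]
    rw [hup fun j m => Sbar (M + 1) (n + 2) t σs j.succ ^ m, Function.update_self, mul_assoc]
    rfl
  rw [h₁, h₂]
  unfold nu
  simp only [hG]
  rw [← integral_const_mul, ← integral_sub (hint q₁) ((hint q₂).const_mul _)]
  refine (congrArg abs (integral_congr_ae (ae_of_all _ fun g => ?_))).trans_le hmain
  simp only [Fin.prod_univ_succ (n := n + 1), hq₁, hq₂, Fin.cons_zero, Fin.cons_succ]
  rw [hprod, hprod, hup fun _ m => pairMoment t m (E g), Function.update_self, hp,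
    show p + 3 - 2 = p + 1 by omega]
  have hm0 : pairMoment t 0 (E g) = 1 := by simp [pairMoment, avg_const]
  rw [hm0]
  push_cast
  ring

end
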